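/- arXiv:1511.05456 — 5 statements merged into one kernel-verified Lean document; each statement's English description precedes it below -/
import Mathlib

section
/- For n ≥ 2, the sum over all permutations π of [n] of the number of indices i with 1 ≤ i ≤ n-1 such that i is an ascent of π and i+1 is a descent of π equals (n-1)! · (n² + 4n - 6)/6. -/
open Finset

/-- The word of a permutation of `[n]` in one-line notation (positions `0,…,n-1`
give values `1,…,n`), with the convention that position `n` carries the value `n+1`. -/
def pval (n : ℕ) (π : Equiv.Perm (Fin n)) (t : ℕ) : ℕ :=
  if h : t < n then (π ⟨t, h⟩ : ℕ) + 1 else n + 1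

/-- The value `i` is an ascent of `π`. -/
def IsValAscent (n : ℕ) (π : Equiv.Perm (Fin n)) (i : ℕ) : Prop :=
  ∃ t < n, pval n π t = i ∧ pval n π t < pval n π (t + 1)

/-- The value `i` is a descent of `π`. -/
def IsValDescent (n : ℕ) (π : Equiv.Perm (Fin n)) (i : ℕ) : Prop :=
  ∃ t < n, pval n π t = i ∧ pval n π t > pval n π (t + 1)

lemma pval_lt {n : ℕ} (π : Equiv.Perm (Fin n)) {t : ℕ} (h : t < n) :
    1 ≤ pval n π t ∧ pval n π t ≤ n := by
  unfold pval
  rw [dif_pos h]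
  have := (π ⟨t, h⟩).isLt
  omega

lemma pval_ge {n : ℕ} (π : Equiv.Perm (Fin n)) {t : ℕ} (h : n ≤ t) :
    pval n π t = n + 1 := by
  unfold pval
  rw [dif_neg (by omega)]

lemma pval_inj {n : ℕ} (π : Equiv.Perm (Fin n)) {s t : ℕ} (hs : s < n) (ht : t < n)
    (h : pval n π s = pval n π t) : s = t := by
  unfold pval at h
  rw [dif_pos hs, dif_pos ht] at h
  have h2 : π ⟨s, hs⟩ = π ⟨t, ht⟩ := Fin.ext (by omega)
  have := π.injective h2
  simpa using this

lemma card_fix {n k : ℕ} (p v : Fin k → Fin n) (hp : Function.Injective p)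
    (hv : Function.Injective v) :
    (univ.filter (fun π : Equiv.Perm (Fin n) => ∀ j, π (p j) = v j)).card
      = (n - k).factorial := by
  classical
  let e0 : Set.range p ≃ Set.range v :=
    (Equiv.ofInjective p hp).symm.trans (Equiv.ofInjective v hv)
  have he : ∀ j, (e0 ⟨p j, Set.mem_range_self j⟩ : Fin n) = v j := by
    intro j
    have : (Equiv.ofInjective p hp).symm ⟨p j, Set.mem_range_self j⟩ = j :=
      Equiv.ofInjective_symm_apply hp j
    simp [e0, this]
  have c1 : Fintype.card ((Set.range p)ᶜ : Set (Fin n)) = n - k := by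
    rw [Fintype.card_compl_set, Set.card_range_of_injective hp]; simp
  have c2 : Fintype.card ((Set.range v)ᶜ : Set (Fin n)) = n - k := by
    rw [Fintype.card_compl_set, Set.card_range_of_injective hv]; simp
  have key := Fintype.card_congr (Equiv.Set.compl e0)
  rw [Fintype.card_equiv (Fintype.equivOfCardEq (c1.trans c2.symm)), c1] at key
  rw [← key, ← Fintype.card_subtype]
  apply Fintype.card_congr
  refine Equiv.subtypeEquivRight ?_
  intro π
  constructor
  · rintro h ⟨_, j, rfl⟩
    rw [he, ← h]
  · intro h j
    rw [← he]
    exact h ⟨p j, Set.mem_range_self j⟩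

lemma card_match {n k : ℕ} (p v : Fin k → ℕ) (hp : Function.Injective p)
    (hv : Function.Injective v) (hpn : ∀ j, p j < n) (hvn : ∀ j, 1 ≤ v j ∧ v j ≤ n) :
    (univ.filter (fun π : Equiv.Perm (Fin n) => ∀ j, pval n π (p j) = v j)).card
      = (n - k).factorial := by
  rw [← card_fix (n := n) (fun j => ⟨p j, hpn j⟩)
    (fun j => ⟨v j - 1, by have := hvn j; omega⟩)]
  · congr 1
    ext π
    simp only [mem_filter, mem_univ, true_and]
    refine forall_congr' fun j => ?_
    unfold pval
    rw [dif_pos (hpn j), Fin.ext_iff]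
    have := hvn j
    simp only
    omega
  · intro x y h
    simp only [Fin.mk.injEq] at h
    exact hp h
  · intro x y h
    simp only [Fin.mk.injEq] at h
    have := hvn x
    have := hvn y
    exact hv (by omega)

open scoped Classical in
lemma card_family {ι : Type} {n k : ℕ} (T : Finset ι) (p v : ι → Fin k → ℕ)
    (hp : ∀ i ∈ T, Function.Injective (p i))
    (hv : ∀ i ∈ T, Function.Injective (v i)) (hpn : ∀ i ∈ T, ∀ j, p i j < n)
    (hvn : ∀ i ∈ T, ∀ j, 1 ≤ v i j ∧ v i j ≤ n)
    (hu : ∀ i ∈ T, ∀ i' ∈ T, ∀ π : Equiv.Perm (Fin n), (∀ j, pval n π (p i j) = v i j) →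
      (∀ j, pval n π (p i' j) = v i' j) → i = i') :
    (univ.filter (fun π : Equiv.Perm (Fin n) =>
      ∃ i ∈ T, ∀ j, pval n π (p i j) = v i j)).card = T.card * (n - k).factorial := by
  have : (univ.filter (fun π : Equiv.Perm (Fin n) =>
      ∃ i ∈ T, ∀ j, pval n π (p i j) = v i j)) =
      T.biUnion (fun i => univ.filter (fun π : Equiv.Perm (Fin n) =>
        ∀ j, pval n π (p i j) = v i j)) := by
    ext π; simp
  rw [this, card_biUnion]
  · rw [Finset.sum_congr rfl (g := fun _ => (n - k).factorial), sum_const, smul_eq_mul]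
    intro i hi
    convert card_match (p i) (v i) (hp i hi) (hv i hi) (hpn i hi) (hvn i hi)
  · intro i hi i' hi' hne
    rw [Function.onFun, Finset.disjoint_left]
    intro π h1 h2
    simp only [mem_filter, mem_univ, true_and] at h1 h2
    exact hne (hu i hi i' hi' π h1 h2)

def S1 (n i : ℕ) (π : Equiv.Perm (Fin n)) : Prop :=
  pval n π (n-2) = i + 1 ∧ pval n π (n-1) = i
def S2 (n i : ℕ) (π : Equiv.Perm (Fin n)) : Prop :=
  ∃ x ∈ range (n-2) ×ˢ Icc (i+2) n,
    pval n π x.1 = i + 1 ∧ pval n π (x.1+1) = i ∧ pval n π (x.1+2) = x.2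
def S3 (n i : ℕ) (π : Equiv.Perm (Fin n)) : Prop :=
  ∃ x ∈ range (n-2) ×ˢ Ico 1 i,
    pval n π x.1 = i + 1 ∧ pval n π (x.1+1) = x.2 ∧ pval n π (n-1) = i
def S4 (n i : ℕ) (π : Equiv.Perm (Fin n)) : Prop :=
  ∃ x ∈ range (n-2) ×ˢ Ico 1 i,
    pval n π x.1 = i ∧ pval n π (x.1+1) = i+1 ∧ pval n π (x.1+2) = x.2
/-- shifted positions of a pair -/
def q1 (x : ℕ × ℕ) : ℕ := if x.1 < x.2 then x.1 else x.1 + 1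
/-- shifted positions of a pair -/
def q2 (x : ℕ × ℕ) : ℕ := if x.1 < x.2 then x.2 + 1 else x.2
def S5 (n i : ℕ) (π : Equiv.Perm (Fin n)) : Prop :=
  ∃ x ∈ (range (n-2)).offDiag ×ˢ (Ico 1 i ×ˢ Icc (i+2) n),
    pval n π (q1 x.1) = i + 1 ∧ pval n π (q1 x.1 + 1) = x.2.1 ∧
    pval n π (q2 x.1) = i ∧ pval n π (q2 x.1 + 1) = x.2.2

section
open scoped Classical

lemma card_S1 {n i : ℕ} (hi : 1 ≤ i) (hin : i < n) :
    (univ.filter (S1 n i)).card = (n-2).factorial := by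
  have := card_match (n := n) (k := 2) ![n-2, n-1] ![i+1, i]
    (by intro x y; fin_cases x <;> fin_cases y <;> simp <;> omega)
    (by intro x y; fin_cases x <;> fin_cases y <;> simp)
    (by intro x; fin_cases x <;> simp <;> omega)
    (by intro x; fin_cases x <;> simp <;> omega)
  rw [← this]
  congr 1
  ext π
  simp [S1, Fin.forall_fin_succ]

lemma card_S2 {n i : ℕ} (hi : 1 ≤ i) (hin : i < n) :
    (univ.filter (S2 n i)).card = ((n-2) * (n - 1 - i)) * (n-3).factorial := by
  have := card_family (n := n) (k := 3) (range (n-2) ×ˢ Icc (i+2) n)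
    (fun x => ![x.1, x.1+1, x.1+2]) (fun x => ![i+1, i, x.2])
    (by rintro ⟨a, b⟩ h x y; simp at h; fin_cases x <;> fin_cases y <;> simp)
    (by rintro ⟨a, b⟩ h x y; simp at h; fin_cases x <;> fin_cases y <;> simp <;> omega)
    (by rintro ⟨a, b⟩ h x; simp at h; fin_cases x <;> simp <;> omega)
    (by rintro ⟨a, b⟩ h x; simp at h; fin_cases x <;> simp <;> omega)
    (by
      rintro ⟨a, b⟩ h ⟨a', b'⟩ h' π
      simp [Fin.forall_fin_succ] at h h' ⊢
      intro h1 h2 h3 h4 h5 h6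
      have := pval_inj π (by omega) (by omega) (h1.trans h4.symm)
      subst this
      omega)
  rw [card_product, card_range, Nat.card_Icc] at this
  rw [show n - 1 - i = n + 1 - (i + 2) by omega, ← this]
  congr 1
  ext π
  simp [S2, Fin.forall_fin_succ]

lemma card_S3 {n i : ℕ} (hi : 1 ≤ i) (hin : i < n) :
    (univ.filter (S3 n i)).card = ((n-2) * (i-1)) * (n-3).factorial := by
  have := card_family (n := n) (k := 3) (range (n-2) ×ˢ Ico 1 i)
    (fun x => ![x.1, x.1+1, n-1]) (fun x => ![i+1, x.2, i])
    (by rintro ⟨a, b⟩ h x y; simp at h; fin_cases x <;> fin_cases y <;> simp <;> omega)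
    (by rintro ⟨a, b⟩ h x y; simp at h; fin_cases x <;> fin_cases y <;> simp <;> omega)
    (by rintro ⟨a, b⟩ h x; simp at h; fin_cases x <;> simp <;> omega)
    (by rintro ⟨a, b⟩ h x; simp at h; fin_cases x <;> simp <;> omega)
    (by
      rintro ⟨a, b⟩ h ⟨a', b'⟩ h' π
      simp [Fin.forall_fin_succ] at h h' ⊢
      intro h1 h2 h3 h4 h5 h6
      have := pval_inj π (by omega) (by omega) (h1.trans h4.symm)
      subst this
      omega)
  rw [card_product, card_range, Nat.card_Ico] at this
  rw [← this]
  congr 1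
  ext π
  simp [S3, Fin.forall_fin_succ]

lemma card_S4 {n i : ℕ} (hi : 1 ≤ i) (hin : i < n) :
    (univ.filter (S4 n i)).card = ((n-2) * (i-1)) * (n-3).factorial := by
  have := card_family (n := n) (k := 3) (range (n-2) ×ˢ Ico 1 i)
    (fun x => ![x.1, x.1+1, x.1+2]) (fun x => ![i, i+1, x.2])
    (by rintro ⟨a, b⟩ h x y; simp at h; fin_cases x <;> fin_cases y <;> simp)
    (by rintro ⟨a, b⟩ h x y; simp at h; fin_cases x <;> fin_cases y <;> simp <;> omega)
    (by rintro ⟨a, b⟩ h x; simp at h; fin_cases x <;> simp <;> omega)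
    (by rintro ⟨a, b⟩ h x; simp at h; fin_cases x <;> simp <;> omega)
    (by
      rintro ⟨a, b⟩ h ⟨a', b'⟩ h' π
      simp [Fin.forall_fin_succ] at h h' ⊢
      intro h1 h2 h3 h4 h5 h6
      have := pval_inj π (by omega) (by omega) (h1.trans h4.symm)
      subst this
      omega)
  rw [card_product, card_range, Nat.card_Ico] at this
  rw [← this]
  congr 1
  ext π
  simp [S4, Fin.forall_fin_succ]

lemma card_S5 {n i : ℕ} (hi : 1 ≤ i) (hin : i < n) :
    (univ.filter (S5 n i)).card =
      (((n-2) * (n-2) - (n-2)) * ((i-1) * (n-1-i))) * (n-4).factorial := by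
  have := card_family (n := n) (k := 4) ((range (n-2)).offDiag ×ˢ (Ico 1 i ×ˢ Icc (i+2) n))
    (fun x => ![q1 x.1, q1 x.1 + 1, q2 x.1, q2 x.1 + 1]) (fun x => ![i+1, x.2.1, i, x.2.2])
    (by
      rintro ⟨⟨s, t⟩, c, d⟩ h x y
      simp [q1, q2] at h ⊢
      fin_cases x <;> fin_cases y <;> simp <;> split_ifs <;> omega)
    (by
      rintro ⟨⟨s, t⟩, c, d⟩ h x y
      simp at h ⊢
      fin_cases x <;> fin_cases y <;> simp <;> omega)
    (by
      rintro ⟨⟨s, t⟩, c, d⟩ h x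
      simp [q1, q2] at h ⊢
      fin_cases x <;> simp <;> split_ifs <;> omega)
    (by rintro ⟨⟨s, t⟩, c, d⟩ h x; simp at h; fin_cases x <;> simp <;> omega)
    (by
      rintro ⟨⟨s, t⟩, c, d⟩ h ⟨⟨s', t'⟩, c', d'⟩ h' π
      simp [Fin.forall_fin_succ] at h h' ⊢
      intro h1 h2 h3 h4 h5 h6 h7 h8
      have e1 := pval_inj π (by simp [q1]; split_ifs <;> omega)
        (by simp [q1]; split_ifs <;> omega) (h1.trans h5.symm)
      have e2 := pval_inj π (by simp [q2]; split_ifs <;> omega)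
        (by simp [q2]; split_ifs <;> omega) (h3.trans h7.symm)
      rw [e1] at h2
      rw [e2] at h4
      simp only [q1, q2] at e1 e2
      split_ifs at e1 e2 <;> omega)
  rw [card_product, card_product, offDiag_card, card_range, Nat.card_Ico, Nat.card_Icc] at this
  rw [show n - 1 - i = n + 1 - (i + 2) by omega, ← this]
  congr 1
  ext π
  simp [S5, Fin.forall_fin_succ]
end

lemma main_iff {n i : ℕ} (hi : 1 ≤ i) (hin : i < n) (π : Equiv.Perm (Fin n)) :
    (IsValAscent n π i ∧ IsValDescent n π (i + 1)) ↔
      (S1 n i π ∨ S2 n i π ∨ S3 n i π ∨ S4 n i π ∨ S5 n i π) := by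
  constructor
  · rintro ⟨⟨t, ht, ht1, ht2⟩, ⟨s, hs, hs1, hs2⟩⟩
    have hst : s ≠ t := by rintro rfl; omega
    have hsn : s + 1 < n := by
      by_contra h
      rw [pval_ge π (by omega : n ≤ s + 1)] at hs2
      omega
    have hc := pval_lt π hsn
    have hci : pval n π (s+1) ≠ i + 1 := by omega
    by_cases h1 : t = s + 1
    · subst h1
      by_cases h2 : s + 1 = n - 1
      · left
        refine ⟨?_, ?_⟩
        · rw [← hs1]; congr 1; omega
        · rw [← ht1]; congr 1; omega
      · right; left
        have hd := pval_lt π (show s + 1 + 1 < n by omega)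
        have : pval n π (s+1+1) ≠ i + 1 := by
          intro h
          have := pval_inj π (by omega) (by omega) (h.trans hs1.symm)
          omega
        refine ⟨(s, pval n π (s+1+1)), ?_, hs1, ht1, rfl⟩
        simp; omega
    have hca : pval n π (s+1) ≠ i := by
      intro h
      have := pval_inj π (by omega) (by omega) (h.trans ht1.symm)
      omega
    by_cases h2 : t = n - 1
    · right; right; left
      refine ⟨(s, pval n π (s+1)), ?_, hs1, rfl, by rw [← h2]; exact ht1⟩
      simp; omega
    by_cases h3 : s = t + 1
    · subst h3
      right; right; right; left
      refine ⟨(t, pval n π (t+1+1)), ?_, ht1, hs1, rfl⟩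
      simp; omega
    right; right; right; right
    have hd := pval_lt π (show t + 1 < n by omega)
    have hdi : pval n π (t+1) ≠ i + 1 := by
      intro h
      have := pval_inj π (by omega) (by omega) (h.trans hs1.symm)
      omega
    by_cases h4 : s < t
    · have e1 : q1 (s, t-1) = s := by simp only [q1]; split_ifs <;> omega
      have e2 : q2 (s, t-1) = t := by simp only [q2]; split_ifs <;> omega
      refine ⟨((s, t-1), pval n π (s+1), pval n π (t+1)), ?_, ?_⟩
      · simp; omega
      · simp only [e1, e2]; exact ⟨hs1, trivial, ht1, trivial⟩
    · have e1 : q1 (s-1, t) = s := by simp only [q1]; split_ifs <;> omega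
      have e2 : q2 (s-1, t) = t := by simp only [q2]; split_ifs <;> omega
      refine ⟨((s-1, t), pval n π (s+1), pval n π (t+1)), ?_, ?_⟩
      · simp; omega
      · simp only [e1, e2]; exact ⟨hs1, trivial, ht1, trivial⟩
  · rintro (⟨h1, h2⟩ | ⟨⟨s, d⟩, hx, h1, h2, h3⟩ | ⟨⟨s, c⟩, hx, h1, h2, h3⟩ |
      ⟨⟨s, c⟩, hx, h1, h2, h3⟩ | ⟨⟨⟨s, t⟩, c, d⟩, hx, h1, h2, h3, h4⟩)
    · refine ⟨⟨n-1, by omega, h2, ?_⟩, ⟨n-2, by omega, h1, ?_⟩⟩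
      · rw [pval_ge π (by omega : n ≤ n - 1 + 1)]; omega
      · rw [show n - 2 + 1 = n - 1 by omega]; omega
    · simp at hx h1 h2 h3
      exact ⟨⟨s+1, by omega, h2, by rw [h2, h3]; omega⟩, ⟨s, by omega, h1, by omega⟩⟩
    · simp at hx h1 h2 h3
      refine ⟨⟨n-1, by omega, h3, ?_⟩, ⟨s, by omega, h1, by omega⟩⟩
      rw [pval_ge π (by omega : n ≤ n - 1 + 1)]; omega
    · simp at hx h1 h2 h3
      exact ⟨⟨s, by omega, h1, by omega⟩, ⟨s+1, by omega, h2, by rw [h2, h3]; omega⟩⟩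
    · simp at hx h1 h2 h3 h4
      have b1 : q1 (s, t) < n := by simp only [q1]; split_ifs <;> omega
      have b2 : q2 (s, t) < n := by simp only [q2]; split_ifs <;> omega
      exact ⟨⟨_, b2, h3, by omega⟩, ⟨_, b1, h1, by omega⟩⟩

/-- all the position data is determined -/
lemma disj_aux {n i : ℕ} (hi : 1 ≤ i) (hin : i < n) (π : Equiv.Perm (Fin n)) :
    ∃ s t, s < n ∧ t < n ∧
      (S1 n i π → t = s + 1 ∧ t = n - 1) ∧
      (S2 n i π → t = s + 1 ∧ t < n - 1) ∧
      (S3 n i π → t = n - 1 ∧ s + 1 < t) ∧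
      (S4 n i π → s = t + 1) ∧
      (S5 n i π → s ≠ t + 1 ∧ t ≠ s + 1 ∧ t < n - 1) := by
  have ex : ∀ v, 1 ≤ v → v ≤ n → ∃ t < n, pval n π t = v := by
    intro v h1 h2
    refine ⟨π.symm ⟨v - 1, by omega⟩, (π.symm ⟨v - 1, by omega⟩).isLt, ?_⟩
    unfold pval
    rw [dif_pos (π.symm ⟨v - 1, by omega⟩).isLt]
    simp; omega
  obtain ⟨t, ht, ht1⟩ := ex i hi (by omega)
  obtain ⟨s, hs, hs1⟩ := ex (i+1) (by omega) (by omega)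
  have us : ∀ x < n, pval n π x = i + 1 → x = s := fun x hx h =>
    pval_inj π hx hs (h.trans hs1.symm)
  have ut : ∀ x < n, pval n π x = i → x = t := fun x hx h =>
    pval_inj π hx ht (h.trans ht1.symm)
  refine ⟨s, t, hs, ht, ?_, ?_, ?_, ?_, ?_⟩
  · rintro ⟨h1, h2⟩
    have := us _ (by omega) h1
    have := ut _ (by omega) h2
    omega
  · rintro ⟨⟨x, d⟩, hx, h1, h2, h3⟩
    simp at hx h1 h2 h3
    have := us _ (by omega) h1
    have := ut _ (by omega) h2
    omega
  · rintro ⟨⟨x, d⟩, hx, h1, h2, h3⟩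
    simp at hx h1 h2 h3
    have := us _ (by omega) h1
    have := ut _ (by omega) h3
    omega
  · rintro ⟨⟨x, d⟩, hx, h1, h2, h3⟩
    simp at hx h1 h2 h3
    have := ut _ (by omega) h1
    have := us _ (by omega) h2
    omega
  · rintro ⟨⟨⟨x, y⟩, c, d⟩, hx, h1, h2, h3, h4⟩
    simp at hx h1 h2 h3 h4
    have e1 := us _ (by simp only [q1]; split_ifs <;> omega) h1
    have e2 := ut _ (by simp only [q2]; split_ifs <;> omega) h3
    simp only [q1, q2] at e1 e2
    split_ifs at e1 e2 <;> omega

lemma arith {n i : ℕ} (hi : 1 ≤ i) (hin : i < n) :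
    (n-2).factorial + (((n-2) * (n - 1 - i)) * (n-3).factorial +
      (((n-2) * (i-1)) * (n-3).factorial + (((n-2) * (i-1)) * (n-3).factorial +
      (((n-2) * (n-2) - (n-2)) * ((i-1) * (n-1-i))) * (n-4).factorial))) + (n-2).factorial
      = (n-2).factorial * (i * (n + 1 - i)) := by
  obtain ⟨a, rfl⟩ : ∃ a, i = a + 1 := ⟨i - 1, by omega⟩
  obtain ⟨b, rfl⟩ : ∃ b, n = a + b + 2 := ⟨n - a - 2, by omega⟩
  rw [show a + b + 2 - 1 - (a + 1) = b by omega, show a + 1 - 1 = a by omega,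
    show a + b + 2 + 1 - (a + 1) = b + 2 by omega, show a + b + 2 - 2 = a + b by omega,
    show a + b + 2 - 3 = a + b - 1 by omega, show a + b + 2 - 4 = a + b - 2 by omega]
  rcases h : a + b with _ | _ | m
  · obtain ⟨rfl, rfl⟩ : a = 0 ∧ b = 0 := by omega
    simp
  · have : (a = 0 ∧ b = 1) ∨ (a = 1 ∧ b = 0) := by omega
    rcases this with ⟨rfl, rfl⟩ | ⟨rfl, rfl⟩ <;> simp
  · rw [show m + 1 + 1 - 1 = m + 1 by omega, show m + 1 + 1 - 2 = m by omega,
      show (m+1+1)*(m+1+1) - (m+1+1) = (m+2)*(m+1) by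
        rw [← Nat.mul_sub_one]; rfl,
      Nat.factorial_succ (m+1), Nat.factorial_succ m]
    ring

open scoped Classical in
lemma card_i {n i : ℕ} (hi : 1 ≤ i) (hin : i < n) :
    (univ.filter (fun π : Equiv.Perm (Fin n) =>
      IsValAscent n π i ∧ IsValDescent n π (i + 1))).card + (n-2).factorial
      = (n-2).factorial * (i * (n + 1 - i)) := by
  rw [← arith hi hin]
  congr 1
  have e : (univ.filter (fun π : Equiv.Perm (Fin n) =>
      IsValAscent n π i ∧ IsValDescent n π (i + 1))) =
      univ.filter (S1 n i) ∪ (univ.filter (S2 n i) ∪ (univ.filter (S3 n i) ∪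
        (univ.filter (S4 n i) ∪ univ.filter (S5 n i)))) := by
    ext π
    simp only [mem_filter, mem_union, mem_univ, true_and]
    exact main_iff hi hin π
  rw [e, card_union_of_disjoint, card_union_of_disjoint, card_union_of_disjoint,
    card_union_of_disjoint, card_S1 hi hin, card_S2 hi hin, card_S3 hi hin, card_S4 hi hin,
    card_S5 hi hin]
  all_goals
    rw [Finset.disjoint_left]
    intro π h1 h2
    simp only [mem_filter, mem_union, mem_univ, true_and] at h1 h2
    obtain ⟨s, t, a1, a2, b1, b2, b3, b4, b5⟩ := disj_aux hi hin π
    have b1' := b1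
    grind

lemma sum_aux (m : ℕ) : 6 * ∑ i ∈ Icc 1 (m+1), i * (m + 3 - i)
    = (m + 1) * ((m+2)^2 + 4 * (m+2)) := by
  have h : ∀ k, k ≤ m + 1 → 6 * ∑ i ∈ Icc 1 k, i * (m + 3 - i) + k * (k+1) * (2*k+1)
      = 3 * (m + 3) * (k * (k+1)) := by
    intro k
    induction k with
    | zero => simp
    | succ k ih =>
      intro hk
      have := ih (by omega)
      rw [sum_Icc_succ_top (by omega)]
      obtain ⟨r, rfl⟩ : ∃ r, m = k + r := ⟨m - k, by omega⟩
      rw [show k + r + 3 - (k+1) = r + 2 by omega]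
      nlinarith
  have := h (m+1) le_rfl
  nlinarith

open scoped Classical in
theorem stmt1 (n : ℕ) (hn : 2 ≤ n) :
    6 * ∑ π : Equiv.Perm (Fin n),
        ((Finset.Icc 1 (n - 1)).filter
          (fun i => IsValAscent n π i ∧ IsValDescent n π (i + 1))).card
    = (n - 1).factorial * (n ^ 2 + 4 * n - 6) := by
  have swap : ∑ π : Equiv.Perm (Fin n), ((Finset.Icc 1 (n - 1)).filter
          (fun i => IsValAscent n π i ∧ IsValDescent n π (i + 1))).card
      = ∑ i ∈ Finset.Icc 1 (n-1), (univ.filter (fun π : Equiv.Perm (Fin n) =>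
      IsValAscent n π i ∧ IsValDescent n π (i + 1))).card := by
    simp only [card_filter]
    exact sum_comm
  rw [swap]
  have h := sum_congr (rfl : Finset.Icc 1 (n-1) = _) (fun i hi =>
    card_i (n := n) (i := i) (by simp at hi; omega) (by simp at hi; omega))
  rw [sum_add_distrib, ← mul_sum, sum_const, Nat.card_Icc, smul_eq_mul] at h
  obtain ⟨m, rfl⟩ : ∃ m, n = m + 2 := ⟨n - 2, by omega⟩
  have h2 := sum_aux m
  rw [show m + 2 - 1 = m + 1 by omega, show m + 2 - 2 = m by omega] at h
  rw [show m + 2 - 1 = m + 1 by omega, Nat.factorial_succ]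
  obtain ⟨q, hq⟩ : ∃ q, (m+2)^2 + 4 * (m+2) = q + 6 := 
    ⟨(m+2)^2 + 4 * (m+2) - 6, by rw [Nat.sub_add_cancel]; nlinarith⟩
  rw [hq] at h2 ⊢
  rw [Nat.add_sub_cancel]
  rw [show m + 1 + 1 - 1 = m + 1 by omega] at h
  have h3 := congrArg (fun z => m.factorial * z) h2
  nlinarith
end

section
/- For n ≥ 2, the number of corners in the set of tree-like tableaux of size n equals n! · (n+4)/6. -/
open Finset

/-- `D` is a Young-diagram-shaped finite set of cells (cell `(i,j)` is in row `i`, column `j`,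
indexed from the top-left corner `(0,0)`). -/
def IsYoung (D : Finset (ℕ × ℕ)) : Prop :=
  ∀ i j i' j', (i, j) ∈ D → i' ≤ i → j' ≤ j → (i', j') ∈ D

/-- `(D, P)` is a tree-like tableau: `D` is the Young-diagram shape and `P ⊆ D` is the
set of pointed cells.  The top-left cell is pointed (root point); every non-root
point has a point above it in its column or a point to its left in its row, but not both;
every row and every column of `D` contains a point. -/
def IsTLT (D P : Finset (ℕ × ℕ)) : Prop :=
  IsYoung D ∧ P ⊆ D ∧ (0, 0) ∈ P ∧
  (∀ c ∈ P, c ≠ (0, 0) →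
    ((∃ r < c.1, (r, c.2) ∈ P) ↔ ¬ (∃ k < c.2, (c.1, k) ∈ P))) ∧
  (∀ c ∈ D, (∃ k, (c.1, k) ∈ P) ∧ (∃ r, (r, c.2) ∈ P))

/-- A corner of the diagram `D`: a cell whose bottom and right edges are border edges. -/
def CornerCell (D : Finset (ℕ × ℕ)) (c : ℕ × ℕ) : Prop :=
  c ∈ D ∧ (c.1 + 1, c.2) ∉ D ∧ (c.1, c.2 + 1) ∉ D

open scoped Classical in
/-- The (finite) set of tree-like tableaux of size `n`; any such tableau has at most `n`
rows and `n` columns, hence fits inside the `(n+1) × (n+1)` grid. -/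
noncomputable def TLTs (n : ℕ) : Finset (Finset (ℕ × ℕ) × Finset (ℕ × ℕ)) :=
  ((Finset.range (n + 1) ×ˢ Finset.range (n + 1)).powerset ×ˢ
      (Finset.range (n + 1) ×ˢ Finset.range (n + 1)).powerset).filter
    (fun T => IsTLT T.1 T.2 ∧ T.2.card = n)

open scoped Classical in
noncomputable def cornersOf (D : Finset (ℕ × ℕ)) : Finset (ℕ × ℕ) :=
  D.filter (CornerCell D)

namespace TLTProof
open scoped Classical

/-- Coordinate form of the tree-like tableau condition. -/
theorem isTLT_iff (D P : Finset (ℕ × ℕ)) : IsTLT D P ↔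
    (∀ i j i' j', (i, j) ∈ D → i' ≤ i → j' ≤ j → (i', j') ∈ D) ∧
    (∀ i j, (i, j) ∈ P → (i, j) ∈ D) ∧ (0, 0) ∈ P ∧
    (∀ i j, (i, j) ∈ P → (i ≠ 0 ∨ j ≠ 0) →
      ((∃ r < i, (r, j) ∈ P) ↔ ¬ (∃ k < j, (i, k) ∈ P))) ∧
    (∀ i j, (i, j) ∈ D → (∃ k, (i, k) ∈ P) ∧ (∃ r, (r, j) ∈ P)) := by
  unfold IsTLT IsYoung
  refine and_congr Iff.rfl (and_congr ?_ (and_congr Iff.rfl (and_congr ?_ ?_)))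
  · simp [Finset.subset_iff]
  · simp only [Prod.forall, ne_eq, Prod.mk.injEq, not_and_or]
  · simp only [Prod.forall]

theorem mem_TLTs (n : ℕ) (D P : Finset (ℕ × ℕ)) :
    (D, P) ∈ TLTs n ↔ IsTLT D P ∧ P.card = n := by
  unfold TLTs
  simp only [Finset.mem_filter, Finset.mem_product, Finset.mem_powerset, and_iff_right_iff_imp]
  rintro ⟨h, hc⟩
  rw [isTLT_iff] at h
  obtain ⟨hY, hPD, h0, ht, hrc⟩ := h
  have hD : D ⊆ Finset.range (n + 1) ×ˢ Finset.range (n + 1) := by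
    rintro ⟨i, j⟩ hij
    simp only [Finset.mem_product, Finset.mem_range]
    constructor
    · have : Finset.range (i + 1) ⊆ P.image Prod.fst := by
        intro a ha
        obtain ⟨k, hk⟩ := (hrc a j (hY i j a j hij (by simp at ha; omega) le_rfl)).1
        exact Finset.mem_image.2 ⟨_, hk, rfl⟩
      have := (Finset.card_le_card this).trans Finset.card_image_le
      simp at this; omega
    · have : Finset.range (j + 1) ⊆ P.image Prod.snd := by
        intro a ha
        obtain ⟨k, hk⟩ := (hrc i a (hY i j i a hij le_rfl (by simp at ha; omega))).2
        exact Finset.mem_image.2 ⟨_, hk, rfl⟩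
      have := (Finset.card_le_card this).trans Finset.card_image_le
      simp at this; omega
  exact ⟨hD, fun c hc => hD (hPD c.1 c.2 hc)⟩

/-- rows of the points in column `0` -/
noncomputable def col (P : Finset (ℕ × ℕ)) : Finset ℕ := (P.filter (fun c => c.2 = 0)).image Prod.fst

@[simp] theorem mem_col (P : Finset (ℕ × ℕ)) (i : ℕ) : i ∈ col P ↔ (i, 0) ∈ P := by
  simp [col]

/-- points outside column `0` -/
noncomputable def rest (P : Finset (ℕ × ℕ)) : Finset (ℕ × ℕ) := P.filter (fun c => c.2 ≠ 0)

theorem card_eq (P : Finset (ℕ × ℕ)) : P.card = (col P).card + (rest P).card := by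
  unfold col rest
  rw [Finset.card_image_of_injOn, Finset.card_filter_add_card_filter_not]
  rintro ⟨a, b⟩ h ⟨c, d⟩ h'
  simp at h h' ⊢
  omega

/-- The first two columns have the same height. -/
def HT (D : Finset (ℕ × ℕ)) : Prop := ∀ i, (i, 0) ∈ D → (i, 1) ∈ D

/-! ### adding a column -/

noncomputable def addD (D : Finset (ℕ × ℕ)) : Finset (ℕ × ℕ) :=
  D.filter (fun c => c.2 = 0) ∪ D.image (fun c => (c.1, c.2 + 1))

@[simp] theorem addD_zero (D i) : (i, 0) ∈ addD D ↔ (i, 0) ∈ D := by simp [addD]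
@[simp] theorem addD_succ (D i j) : (i, j + 1) ∈ addD D ↔ (i, j) ∈ D := by simp [addD]
@[simp] theorem addD_one (D i) : (i, 1) ∈ addD D ↔ (i, 0) ∈ D := by simp [addD]

noncomputable def addP (P : Finset (ℕ × ℕ)) (S : Finset ℕ) : Finset (ℕ × ℕ) :=
  P.filter (fun c => c.2 = 0 ∧ (c.1 ∈ S → ∀ s ∈ S, c.1 ≤ s)) ∪ S.image (fun i => (i, 1)) ∪
    (rest P).image (fun c => (c.1, c.2 + 1))

@[simp] theorem addP_zero (P S i) : (i, 0) ∈ addP P S ↔ (i, 0) ∈ P ∧ (i ∈ S → ∀ s ∈ S, i ≤ s) := by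
  simp [addP]
@[simp] theorem addP_one (P S i) : (i, 1) ∈ addP P S ↔ i ∈ S := by simp [addP, rest]
@[simp] theorem addP_succ (P S i j) : (i, j + 2) ∈ addP P S ↔ (i, j + 1) ∈ P := by
  simp [addP, rest]

noncomputable def remD (D : Finset (ℕ × ℕ)) : Finset (ℕ × ℕ) :=
  (rest D).image (fun c => (c.1, c.2 - 1))

@[simp] theorem mem_remD (D i j) : (i, j) ∈ remD D ↔ (i, j + 1) ∈ D := by
  simp only [remD, rest, Finset.mem_image, Finset.mem_filter, Prod.exists, Prod.mk.injEq]
  constructor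
  · rintro ⟨a, b, ⟨h, hb⟩, rfl, rfl⟩
    rwa [Nat.sub_add_cancel (by simp at hb; omega)]
  · intro h
    exact ⟨i, j + 1, ⟨h, by simp⟩, rfl, rfl⟩

noncomputable def remP (P : Finset (ℕ × ℕ)) : Finset (ℕ × ℕ) :=
  remD P ∪ P.filter (fun c => c.2 = 0)

@[simp] theorem remP_zero (P i) : (i, 0) ∈ remP P ↔ (i, 1) ∈ P ∨ (i, 0) ∈ P := by simp [remP]
@[simp] theorem remP_succ (P i j) : (i, j + 1) ∈ remP P ↔ (i, j + 2) ∈ P := by simp [remP]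

noncomputable def remS (P : Finset (ℕ × ℕ)) : Finset ℕ := col (remD P)

@[simp] theorem mem_remS (P i) : i ∈ remS P ↔ (i, 1) ∈ P := by simp [remS]

theorem col_addP (P S) (hS : S ⊆ col P) (hne : S.Nonempty) :
    (col (addP P S)).card + S.card = (col P).card + 1 := by
  have : col (addP P S) = insert (S.min' hne) (col P \ S) := by
    ext i
    simp only [mem_col, addP_zero, Finset.mem_insert, Finset.mem_sdiff]
    constructor
    · rintro ⟨h1, h2⟩
      by_cases h : i ∈ S
      · left
        exact le_antisymm (h2 h _ (S.min'_mem hne)) (S.min'_le _ h)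
      · exact Or.inr ⟨h1, h⟩
    · rintro (rfl | ⟨h1, h2⟩)
      · exact ⟨by simpa using hS (S.min'_mem hne), fun _ s hs => S.min'_le _ hs⟩
      · exact ⟨h1, fun h => absurd h h2⟩
  rw [this, Finset.card_insert_of_notMem (by simp [S.min'_mem hne]), Finset.card_sdiff_of_subset hS]
  have := Finset.card_le_card hS
  omega

theorem rest_addP (P S) : (rest (addP P S)).card = S.card + (rest P).card := by
  have : rest (addP P S) = S.image (fun i => (i, 1)) ∪ (rest P).image (fun c => (c.1, c.2 + 1)) := by
    ext ⟨i, j⟩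
    rcases j with _ | _ | j <;> simp [rest]
  rw [this, Finset.card_union_of_disjoint, Finset.card_image_of_injective,
    Finset.card_image_of_injective]
  · rintro ⟨a, b⟩ ⟨c, d⟩ h
    simpa using h
  · intro a b h
    simpa using h
  · rw [Finset.disjoint_left]
    rintro ⟨i, j⟩
    simp [rest]
    grind

theorem card_addP (P S) (hS : S ⊆ col P) (hne : S.Nonempty) :
    (addP P S).card = P.card + 1 := by
  have h1 := col_addP P S hS hne
  have h2 := rest_addP P S
  rw [card_eq, card_eq P]
  omega

theorem tlt_add {D P S} (h : IsTLT D P) (hS : S ⊆ col P) (hne : S.Nonempty) :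
    IsTLT (addD D) (addP P S) := by
  rw [isTLT_iff] at h ⊢
  obtain ⟨hY, hPD, h0, ht, hrc⟩ := h
  have hS' : ∀ i ∈ S, (i, 0) ∈ P := fun i hi => by simpa using hS hi
  have h00 : (0, 0) ∈ addP P S := by simp [h0]
  have key : ∀ i j, (∃ k < j + 2, (i, k) ∈ addP P S) ↔ ∃ k < j + 1, (i, k) ∈ P := by
    intro i j
    constructor
    · rintro ⟨k, hk, h⟩
      rcases k with _ | _ | k
      · exact ⟨0, by omega, ((addP_zero _ _ _).1 h).1⟩
      · exact ⟨0, by omega, hS' _ ((addP_one _ _ _).1 h)⟩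
      · exact ⟨k + 1, by omega, (addP_succ _ _ _ _).1 h⟩
    · rintro ⟨k, hk, h⟩
      rcases k with _ | k
      · by_cases hi : i ∈ S
        · exact ⟨1, by omega, (addP_one _ _ _).2 hi⟩
        · exact ⟨0, by omega, (addP_zero _ _ _).2 ⟨h, fun h' => absurd h' hi⟩⟩
      · exact ⟨k + 2, by omega, (addP_succ _ _ _ _).2 h⟩
  refine ⟨?_, ?_, h00, ?_, ?_⟩
  · intro i j i' j' h hi hj
    rcases j with _ | j
    · obtain rfl : j' = 0 := by omega
      simp at h ⊢
      exact hY _ _ _ _ h hi le_rfl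
    · rcases j' with _ | j'
      · simp at h ⊢
        exact hY _ _ _ _ h hi (by omega)
      · simp at h ⊢
        exact hY _ _ _ _ h hi (by omega)
  · intro i j h
    rcases j with _ | _ | j
    · simp at h ⊢; exact hPD _ _ h.1
    · simp at h ⊢; exact hPD _ _ (hS' _ h)
    · simp at h; rw [addD_succ]; exact hPD _ _ h
  · intro i j h hne0
    rcases j with _ | _ | j
    · have : ∃ r < i, (r, 0) ∈ addP P S := ⟨0, by omega, h00⟩
      simp only [this, true_iff]
      simp
    · simp only [zero_add, addP_one] at h ⊢
      constructor
      · rintro ⟨r, hr, hrS⟩ ⟨k, hk, h'⟩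
        obtain rfl : k = 0 := by omega
        have := ((addP_zero _ _ _).1 h').2 h r hrS
        omega
      · intro hk
        by_contra hcon
        push Not at hcon
        refine hk ⟨0, by omega, (addP_zero _ _ _).2 ⟨hS' i h, fun _ s hs => ?_⟩⟩
        by_contra hlt
        exact hcon s (by omega) hs
    · rw [key]
      simp only [addP_succ] at h ⊢
      exact ht _ _ h (by omega)
  · intro i j h
    have hrow : ∀ i j, (i, j) ∈ D → ∃ k, (i, k) ∈ addP P S := by
      intro i j h
      obtain ⟨k, hk⟩ := (hrc i j h).1
      obtain ⟨k', _, hk'⟩ := (key i k).2 ⟨k, by omega, hk⟩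
      exact ⟨k', hk'⟩
    rcases j with _ | _ | j
    · simp only [addD_zero] at h
      exact ⟨hrow _ _ h, 0, h00⟩
    · simp only [zero_add, addD_one] at h
      obtain ⟨s, hs⟩ := hne
      exact ⟨hrow _ _ h, s, (addP_one _ _ _).2 hs⟩
    · rw [addD_succ] at h
      obtain ⟨r, hr⟩ := (hrc _ _ h).2
      exact ⟨hrow _ _ h, r, (addP_succ _ _ _ _).2 hr⟩

theorem HT_add {D} : HT (addD D) := by
  intro i h
  simpa using h

theorem tlt_rem {D P} (h : IsTLT D P) (hH : HT D) : IsTLT (remD D) (remP P) := by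
  rw [isTLT_iff] at h ⊢
  obtain ⟨hY, hPD, h0, ht, hrc⟩ := h
  have key : ∀ i j, (∃ k < j + 2, (i, k) ∈ P) ↔ ∃ k < j + 1, (i, k) ∈ remP P := by
    intro i j
    constructor
    · rintro ⟨k, hk, h⟩
      rcases k with _ | _ | k
      · exact ⟨0, by omega, by simp [h]⟩
      · exact ⟨0, by omega, by simp at h; simp [h]⟩
      · exact ⟨k + 1, by omega, by simpa using h⟩
    · rintro ⟨k, hk, h⟩
      rcases k with _ | k
      · simp at h
        rcases h with h | h
        · exact ⟨1, by omega, h⟩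
        · exact ⟨0, by omega, h⟩
      · exact ⟨k + 2, by omega, by simpa using h⟩
  have h00 : (0, 0) ∈ remP P := by simp [h0]
  refine ⟨?_, ?_, h00, ?_, ?_⟩
  · intro i j i' j' h hi hj
    simp at h ⊢
    exact hY _ _ _ _ h hi (by omega)
  · intro i j h
    rcases j with _ | j
    · simp at h ⊢
      rcases h with h | h
      · exact hPD _ _ h
      · exact hH _ (hPD _ _ h)
    · simp at h ⊢
      exact hPD _ _ h
  · intro i j h hne0
    rcases j with _ | j
    · have : ∃ r < i, (r, 0) ∈ remP P := ⟨0, by omega, h00⟩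
      simp only [this, true_iff]
      simp
    · rw [← key]
      simp only [remP_succ] at h ⊢
      exact ht _ _ h (by omega)
  · intro i j h
    simp only [mem_remD] at h
    obtain ⟨⟨k, hk⟩, r, hr⟩ := hrc _ _ h
    constructor
    · obtain ⟨k', _, hk'⟩ := (key i k).1 ⟨k, by omega, hk⟩
      exact ⟨k', hk'⟩
    · rcases j with _ | j
      · exact ⟨0, h00⟩
      · exact ⟨r, by simpa using hr⟩

theorem remS_sub (P) : remS P ⊆ col (remP P) := by
  intro i h
  simp at h ⊢
  exact Or.inl h

theorem remS_ne {D P} (h : IsTLT D P) (hH : HT D) : (remS P).Nonempty := by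
  rw [isTLT_iff] at h
  obtain ⟨hY, hPD, h0, ht, hrc⟩ := h
  obtain ⟨r, hr⟩ := (hrc _ _ (hH 0 (hPD _ _ h0))).2
  exact ⟨r, by simpa using hr⟩

theorem addD_remD {D P} (h : IsTLT D P) (hH : HT D) : addD (remD D) = D := by
  ext ⟨i, j⟩
  rcases j with _ | j
  · simp
    exact ⟨fun h' => h.1 _ _ _ _ h' le_rfl (by omega), hH i⟩
  · simp

theorem addP_remP {D P} (h : IsTLT D P) : addP (remP P) (remS P) = P := by
  rw [isTLT_iff] at h
  obtain ⟨hY, hPD, h0, ht, hrc⟩ := h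
  ext ⟨i, j⟩
  rcases j with _ | _ | j
  · simp
    constructor
    · rintro ⟨h1 | h1, h2⟩
      · have h3 := ht i 1 h1 (by omega)
        by_contra hcon
        have h4 : ¬ ∃ k < 1, (i, k) ∈ P := by
          rintro ⟨k, hk, hk'⟩
          obtain rfl : k = 0 := by omega
          exact hcon hk'
        obtain ⟨r, hr, hr'⟩ := h3.2 h4
        have := h2 h1 r hr'
        omega
      · exact h1
    · intro h1
      refine ⟨Or.inr h1, fun h2 s hs => ?_⟩
      by_contra hlt
      exact (ht i 1 h2 (by omega)).1 ⟨s, by omega, hs⟩ ⟨0, by omega, h1⟩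
  · simp
  · simp

theorem remD_addD (D) : remD (addD D) = D := by
  ext ⟨i, j⟩; simp

theorem remP_addP {P S} (hS : S ⊆ col P) : remP (addP P S) = P := by
  ext ⟨i, j⟩
  have hS' : ∀ i ∈ S, (i, 0) ∈ P := fun i hi => by simpa using hS hi
  rcases j with _ | j
  · simp
    constructor
    · rintro (h | h)
      · exact hS' _ h
      · exact h.1
    · intro h
      by_cases h' : i ∈ S
      · exact Or.inl h'
      · exact Or.inr ⟨h, fun h'' => absurd h'' h'⟩
  · simp

theorem remS_addP (P S) : remS (addP P S) = S := by
  ext i; simp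

/-- Sum over tableaux with first two columns of the same height. -/
theorem sum_HT (n : ℕ) (F : Finset (ℕ × ℕ) → ℕ → ℕ) :
    ∑ T ∈ (TLTs (n + 1)).filter (fun T => HT T.1), F T.1 (col T.2).card =
    ∑ T ∈ TLTs n, ∑ S ∈ (col T.2).powerset.filter (fun S => S.Nonempty),
      F (addD T.1) ((col T.2).card + 1 - S.card) := by
  rw [Finset.sum_sigma']
  refine Finset.sum_bij' (fun T _ => ⟨(remD T.1, remP T.2), remS T.2⟩)
    (fun X _ => (addD X.1.1, addP X.1.2 X.2)) ?_ ?_ ?_ ?_ ?_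
  · rintro ⟨D, P⟩ h
    simp only [Finset.mem_filter, mem_TLTs, Finset.mem_sigma, Finset.mem_powerset] at h ⊢
    obtain ⟨⟨h, hc⟩, hH⟩ := h
    refine ⟨⟨tlt_rem h hH, ?_⟩, remS_sub P, remS_ne h hH⟩
    have := card_addP (remP P) (remS P) (remS_sub P) (remS_ne h hH)
    rw [addP_remP h] at this
    omega
  · rintro ⟨⟨D, P⟩, S⟩ h
    simp only [Finset.mem_filter, mem_TLTs, Finset.mem_sigma, Finset.mem_powerset] at h ⊢
    obtain ⟨⟨h, hc⟩, hS, hne⟩ := h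
    exact ⟨⟨tlt_add h hS hne, by rw [card_addP P S hS hne, hc]⟩, HT_add⟩
  · rintro ⟨D, P⟩ h
    simp only [Finset.mem_filter, mem_TLTs] at h
    obtain ⟨⟨h, hc⟩, hH⟩ := h
    simp only [addP_remP h, addD_remD h hH]
  · rintro ⟨⟨D, P⟩, S⟩ h
    simp only [Finset.mem_filter, mem_TLTs, Finset.mem_sigma, Finset.mem_powerset] at h
    obtain ⟨⟨h, hc⟩, hS, hne⟩ := h
    simp only [remD_addD, remP_addP hS, remS_addP]
  · rintro ⟨D, P⟩ h
    simp only [Finset.mem_filter, mem_TLTs] at h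
    obtain ⟨⟨h, hc⟩, hH⟩ := h
    have := col_addP (remP P) (remS P) (remS_sub P) (remS_ne h hH)
    rw [addP_remP h] at this
    simp only [addD_remD h hH]
    congr 1
    omega

theorem sum_subsets (C : Finset ℕ) (x : ℕ) :
    ∑ S ∈ C.powerset.filter (fun S => S.Nonempty), x ^ (C.card + 1 - S.card) + x * x ^ C.card
      = x * (x + 1) ^ C.card := by
  have h1 : C.powerset = insert ∅ (C.powerset.filter (fun S => S.Nonempty)) := by
    ext S
    simp only [Finset.mem_powerset, Finset.mem_insert, Finset.mem_filter]
    rcases S.eq_empty_or_nonempty with rfl | h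
    · simp
    · simp [h, h.ne_empty]
  have h2 : ∑ S ∈ C.powerset, x ^ (C.card + 1 - S.card) = x * (x + 1) ^ C.card := by
    have := Finset.sum_pow_mul_eq_add_pow 1 x C
    rw [add_comm x 1, ← this, Finset.mul_sum]
    refine Finset.sum_congr rfl fun S hS => ?_
    have := Finset.card_le_card (Finset.mem_powerset.1 hS)
    rw [one_pow, one_mul, ← pow_succ', Nat.sub_add_comm this]
  rw [h1, Finset.sum_insert (by simp)] at h2
  rw [← h2, Finset.card_empty, Nat.sub_zero, pow_succ']
  ring

/-! ### adding a row -/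

noncomputable def ht (D : Finset (ℕ × ℕ)) : ℕ := (col D).card

theorem mem_ht {D} (h : IsYoung D) (i : ℕ) : (i, 0) ∈ D ↔ i < ht D := by
  have hex : ∃ m, m ∉ col D := Infinite.exists_notMem_finset _
  have : col D = Finset.range (Nat.find hex) := by
    ext a
    simp only [Finset.mem_range]
    constructor
    · intro ha
      by_contra hlt
      refine Nat.find_spec hex ?_
      rw [mem_col] at ha ⊢
      exact h _ _ _ _ ha (not_lt.1 hlt) le_rfl
    · intro ha
      exact not_not.1 (Nat.find_min hex ha)
  rw [ht, ← mem_col, this, Finset.card_range, Finset.mem_range]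

theorem notMem_ht {D} (h : IsYoung D) (i j : ℕ) (hi : ht D ≤ i) : (i, j) ∉ D := by
  intro h'
  have := (mem_ht h i).1 (h _ _ _ _ h' le_rfl (by omega))
  omega

theorem tlt_addRow {D P} (h : IsTLT D P) :
    IsTLT (insert (ht D, 0) D) (insert (ht D, 0) P) := by
  have hY0 := h.1
  have m1 := mem_ht hY0
  have m2 := notMem_ht hY0
  rw [isTLT_iff] at h ⊢
  obtain ⟨hY, hPD, h0, ht', hrc⟩ := h
  have m3 : ∀ i j, ht D ≤ i → (i, j) ∉ P := fun i j hi hp => m2 i j hi (hPD _ _ hp)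
  have hpos : 0 < ht D := (m1 0).1 (hPD _ _ h0)
  simp only [Finset.mem_insert, Prod.mk.injEq]
  refine ⟨?_, ?_, Or.inr h0, ?_, ?_⟩
  · rintro i j i' j' (⟨rfl, rfl⟩ | h) hi hj
    · rcases hi.eq_or_lt with rfl | hlt
      · left; omega
      · right
        obtain rfl : j' = 0 := by omega
        exact (m1 _).2 hlt
    · exact Or.inr (hY _ _ _ _ h hi hj)
  · rintro i j (h | h)
    · exact Or.inl h
    · exact Or.inr (hPD _ _ h)
  · rintro i j (⟨rfl, rfl⟩ | h) hne
    · have : ∃ r < ht D, (r = ht D ∧ True) ∨ (r, 0) ∈ P := ⟨0, hpos, Or.inr h0⟩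
      simpa using this
    · have hi : i < ht D := by
        by_contra hcon
        exact m3 i j (by omega) h
      have e1 : (∃ r < i, r = ht D ∧ j = 0 ∨ (r, j) ∈ P) ↔ ∃ r < i, (r, j) ∈ P := by
        refine exists_congr fun r => and_congr_right fun hr => ?_
        have : r ≠ ht D := by omega
        simp [this]
      have e2 : (∃ k < j, i = ht D ∧ k = 0 ∨ (i, k) ∈ P) ↔ ∃ k < j, (i, k) ∈ P := by
        have : i ≠ ht D := by omega
        simp [this]
      rw [e1, e2]
      exact ht' i j h hne
  · rintro i j (⟨rfl, rfl⟩ | h)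
    · exact ⟨⟨0, Or.inl ⟨rfl, rfl⟩⟩, ⟨0, Or.inr h0⟩⟩
    · obtain ⟨⟨k, hk⟩, r, hr⟩ := hrc i j h
      exact ⟨⟨k, Or.inr hk⟩, r, Or.inr hr⟩

theorem ht_insert {D} (h : IsYoung D) : ht (insert (ht D, 0) D) = ht D + 1 := by
  have : col (insert (ht D, 0) D) = insert (ht D) (col D) := by
    ext i; simp
  rw [ht, this, Finset.card_insert_of_notMem, ht]
  simp only [mem_col]
  exact notMem_ht h _ _ le_rfl

/-- Facts about the last row in the other case. -/
theorem lastRow {D P} (h : IsTLT D P) (hH : ¬ HT D) :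
    ∃ l, ht D = l + 1 ∧ (l, 0) ∈ D ∧ (l, 0) ∈ P ∧ ∀ j, (l, j) ∈ D → j = 0 := by
  have hY0 := h.1
  have m1 := mem_ht hY0
  rw [isTLT_iff] at h
  obtain ⟨hY, hPD, h0, ht', hrc⟩ := h
  have hpos : 0 < ht D := (m1 0).1 (hPD _ _ h0)
  have hl : (ht D - 1, 0) ∈ D := (m1 _).2 (by omega)
  simp only [HT, not_forall] at hH
  obtain ⟨i, hi, hi'⟩ := hH
  have hz : ∀ j, (ht D - 1, j) ∈ D → j = 0 := by
    intro j hj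
    by_contra hne
    have := (m1 i).1 hi
    exact hi' (hY _ _ _ _ hj (by omega) (by omega))
  refine ⟨ht D - 1, by omega, hl, ?_, hz⟩
  obtain ⟨k, hk⟩ := (hrc _ _ hl).1
  have := hz k (hPD _ _ hk)
  rwa [this] at hk

theorem tlt_remRow {D P} (h : IsTLT D P) (l : ℕ) (hl : ht D = l + 1) (hl0 : l ≠ 0)
    (hz : ∀ j, (l, j) ∈ D → j = 0) : IsTLT (D.erase (l, 0)) (P.erase (l, 0)) := by
  have hY0 := h.1
  have m1 := mem_ht hY0
  have m2 := notMem_ht hY0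
  rw [isTLT_iff] at h ⊢
  obtain ⟨hY, hPD, h0, ht', hrc⟩ := h
  have hlt : ∀ i j, (i, j) ∈ D.erase (l, 0) → i < l := by
    intro i j h
    simp only [Finset.mem_erase, ne_eq, Prod.mk.injEq] at h
    by_contra hcon
    rcases Nat.lt_or_ge l i with h1 | h1
    · exact m2 i j (by omega) h.2
    · obtain rfl : i = l := by omega
      exact h.1 ⟨rfl, hz _ h.2⟩
  have e0 : ∀ (Q : Finset (ℕ × ℕ)) i j, i < l → ((i, j) ∈ Q.erase (l, 0) ↔ (i, j) ∈ Q) := by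
    intro Q i j hi
    have : i ≠ l := by omega
    simp [this]
  have hPD' : ∀ i j, (i, j) ∈ P.erase (l, 0) → (i, j) ∈ D.erase (l, 0) := by
    intro i j h
    rw [Finset.mem_erase] at h ⊢
    exact ⟨h.1, hPD _ _ h.2⟩
  have h00 : (0, 0) ∈ P.erase (l, 0) := (e0 _ _ _ (by omega)).2 h0
  refine ⟨?_, hPD', h00, ?_, ?_⟩
  · intro i j i' j' h hi hj
    have := hlt _ _ h
    rw [e0 _ _ _ (by omega)] at h ⊢
    exact hY _ _ _ _ h hi hj
  · intro i j h hne
    have hi := hlt _ _ (hPD' _ _ h)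
    rw [e0 _ _ _ hi] at h
    have e1 : (∃ r < i, (r, j) ∈ P.erase (l, 0)) ↔ ∃ r < i, (r, j) ∈ P :=
      exists_congr fun r => and_congr_right fun hr => e0 _ _ _ (by omega)
    have e2 : (∃ k < j, (i, k) ∈ P.erase (l, 0)) ↔ ∃ k < j, (i, k) ∈ P :=
      exists_congr fun r => and_congr_right fun hr => e0 _ _ _ hi
    rw [e1, e2]
    exact ht' i j h hne
  · intro i j h
    have hi := hlt _ _ h
    rw [e0 _ _ _ hi] at h
    obtain ⟨⟨k, hk⟩, r, hr⟩ := hrc i j h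
    refine ⟨⟨k, (e0 _ _ _ hi).2 hk⟩, ?_⟩
    rcases Nat.eq_zero_or_pos j with rfl | hj
    · exact ⟨0, h00⟩
    · refine ⟨r, Finset.mem_erase.2 ⟨?_, hr⟩⟩
      simp only [ne_eq, Prod.mk.injEq]
      omega

theorem ht_erase {D} (l : ℕ) (hl : ht D = l + 1) (hmem : (l, 0) ∈ D) :
    ht (D.erase (l, 0)) = l := by
  have : col (D.erase (l, 0)) = (col D).erase l := by
    ext i; simp
  rw [ht, this, Finset.card_erase_of_mem (by simpa using hmem)]
  rw [ht] at hl
  omega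

theorem sum_VT (n : ℕ) (hn : 1 ≤ n) (F : Finset (ℕ × ℕ) → ℕ → ℕ) :
    ∑ T ∈ (TLTs (n + 1)).filter (fun T => ¬ HT T.1), F T.1 (col T.2).card =
    ∑ T ∈ TLTs n, F (insert (ht T.1, 0) T.1) ((col T.2).card + 1) := by
  refine Finset.sum_bij' (fun T _ => (T.1.erase (ht T.1 - 1, 0), T.2.erase (ht T.1 - 1, 0)))
    (fun T _ => (insert (ht T.1, 0) T.1, insert (ht T.1, 0) T.2)) ?_ ?_ ?_ ?_ ?_
  · rintro ⟨D, P⟩ h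
    simp only [Finset.mem_filter, mem_TLTs] at h ⊢
    obtain ⟨⟨h, hc⟩, hH⟩ := h
    obtain ⟨l, hl, hD, hP, hz⟩ := lastRow h hH
    have hl0 : l ≠ 0 := by
      rintro rfl
      have : P ⊆ {(0, 0)} := by
        rintro ⟨i, j⟩ hp
        have hp' := h.2.1 hp
        have : i < 1 := by
          by_contra hcon
          exact notMem_ht h.1 i j (by omega) hp'
        obtain rfl : i = 0 := by omega
        simp [hz j hp']
      have := Finset.card_le_card this
      simp at this
      omega
    have e : ht D - 1 = l := by omega
    rw [e]
    exact ⟨tlt_remRow h l hl hl0 hz, by rw [Finset.card_erase_of_mem hP]; omega⟩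
  · rintro ⟨D, P⟩ h
    simp only [Finset.mem_filter, mem_TLTs] at h ⊢
    obtain ⟨h, hc⟩ := h
    have hn1 : (ht D, 0) ∉ P := fun h' => notMem_ht h.1 _ _ le_rfl (h.2.1 h')
    refine ⟨⟨tlt_addRow h, by rw [Finset.card_insert_of_notMem hn1, hc]⟩, ?_⟩
    intro hH
    have := hH (ht D) (by simp)
    simp only [Finset.mem_insert, Prod.mk.injEq] at this
    rcases this with h' | h'
    · omega
    · exact notMem_ht h.1 _ _ le_rfl h'
  · rintro ⟨D, P⟩ h
    simp only [Finset.mem_filter, mem_TLTs] at h ⊢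
    obtain ⟨⟨h, hc⟩, hH⟩ := h
    obtain ⟨l, hl, hD, hP, hz⟩ := lastRow h hH
    have e : ht D - 1 = l := by omega
    simp only [e, ht_erase l hl hD, Finset.insert_erase hD, Finset.insert_erase hP]
  · rintro ⟨D, P⟩ h
    simp only [mem_TLTs] at h ⊢
    obtain ⟨h, hc⟩ := h
    have hn0 : (ht D, 0) ∉ D := notMem_ht h.1 _ _ le_rfl
    have hn1 : (ht D, 0) ∉ P := fun h' => hn0 (h.2.1 h')
    simp only [ht_insert h.1, Nat.add_sub_cancel, Finset.erase_insert hn0, Finset.erase_insert hn1]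
  · rintro ⟨D, P⟩ h
    simp only [Finset.mem_filter, mem_TLTs] at h ⊢
    obtain ⟨⟨h, hc⟩, hH⟩ := h
    obtain ⟨l, hl, hD, hP, hz⟩ := lastRow h hH
    have e : ht D - 1 = l := by omega
    simp only [e, ht_erase l hl hD, Finset.insert_erase hD]
    have : ht P = ht (P.erase (l, 0)) + 1 := by
      have : col (P.erase (l, 0)) = (col P).erase l := by
        ext i; simp
      rw [ht, ht, this, Finset.card_erase_add_one (by simpa using hP)]
    rw [ht, ht] at this
    rw [this]

/-! ### corners -/

theorem mem_corners (D i j) : (i, j) ∈ cornersOf D ↔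
    (i, j) ∈ D ∧ (i + 1, j) ∉ D ∧ (i, j + 1) ∉ D := by
  simp [cornersOf, CornerCell]

theorem corners_add (D) : (cornersOf (addD D)).card = (cornersOf D).card := by
  have : cornersOf (addD D) = (cornersOf D).image (fun c => (c.1, c.2 + 1)) := by
    ext ⟨i, j⟩
    rw [mem_corners]
    rcases j with _ | j
    · simp; tauto
    · simp [mem_corners]
  rw [this, Finset.card_image_of_injective]
  rintro ⟨a, b⟩ ⟨c, d⟩ h
  simpa using h

theorem corners_row {D P} (h : IsTLT D P) :
    (cornersOf (insert (ht D, 0) D)).card = (cornersOf D).card + if HT D then 1 else 0 := by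
  have m1 := mem_ht h.1
  have m2 := notMem_ht h.1
  have hY := h.1
  have hpos : 0 < ht D := (m1 0).1 (h.2.1 h.2.2.1)
  have hnot : (ht D, 0) ∉ cornersOf D := fun h' => m2 _ _ le_rfl ((mem_corners _ _ _).1 h').1
  split_ifs with hH
  · have : cornersOf (insert (ht D, 0) D) = insert (ht D, 0) (cornersOf D) := by
      ext ⟨i, j⟩
      simp only [mem_corners, Finset.mem_insert, Prod.mk.injEq]
      constructor
      · rintro ⟨h1 | h1, h2, h3⟩
        · exact Or.inl h1
        · exact Or.inr ⟨h1, fun h => h2 (Or.inr h), fun h => h3 (Or.inr h)⟩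
      · rintro (⟨rfl, rfl⟩ | ⟨h1, h2, h3⟩)
        · refine ⟨Or.inl ⟨rfl, rfl⟩, ?_, ?_⟩
          · rintro (h | h)
            · omega
            · exact m2 _ _ (by omega) h
          · rintro (h | h)
            · omega
            · exact m2 _ _ le_rfl h
        · refine ⟨Or.inr h1, ?_, ?_⟩
          · rintro (h | h)
            · obtain ⟨ha, rfl⟩ := h
              exact h3 (hH _ h1)
            · exact h2 h
          · rintro (h | h)
            · omega
            · exact h3 h
    rw [this, Finset.card_insert_of_notMem hnot]
  · obtain ⟨l, hl, hD, hP, hz⟩ := lastRow h hH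
    have hlc : (l, 0) ∈ cornersOf D := by
      rw [mem_corners]
      refine ⟨hD, m2 _ _ (by omega), fun h' => ?_⟩
      have := hz _ h'
      omega
    have : cornersOf (insert (ht D, 0) D) = insert (ht D, 0) ((cornersOf D).erase (l, 0)) := by
      ext ⟨i, j⟩
      simp only [mem_corners, Finset.mem_insert, Finset.mem_erase, Prod.mk.injEq, ne_eq]
      constructor
      · rintro ⟨h1 | h1, h2, h3⟩
        · exact Or.inl h1
        · refine Or.inr ⟨?_, h1, fun h => h2 (Or.inr h), fun h => h3 (Or.inr h)⟩
          rintro ⟨rfl, rfl⟩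
          exact h2 (Or.inl ⟨hl.symm, rfl⟩)
      · rintro (⟨rfl, rfl⟩ | ⟨h0, h1, h2, h3⟩)
        · refine ⟨Or.inl ⟨rfl, rfl⟩, ?_, ?_⟩
          · rintro (h | h)
            · omega
            · exact m2 _ _ (by omega) h
          · rintro (h | h)
            · omega
            · exact m2 _ _ le_rfl h
        · refine ⟨Or.inr h1, ?_, ?_⟩
          · rintro (h | h)
            · exact h0 ⟨by omega, h.2⟩
            · exact h2 h
          · rintro (h | h)
            · omega
            · exact h3 h
    rw [this, Finset.card_insert_of_notMem (fun h' => hnot (Finset.mem_of_mem_erase h')),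
      Finset.card_erase_add_one hlc, add_zero]

/-! ### generating functions -/

noncomputable def B (n x : ℕ) : ℕ := ∑ T ∈ TLTs n, x ^ (col T.2).card
noncomputable def K (n x : ℕ) : ℕ := ∑ T ∈ TLTs n, (cornersOf T.1).card * x ^ (col T.2).card
noncomputable def H (n x : ℕ) : ℕ :=
  ∑ T ∈ (TLTs n).filter (fun T => HT T.1), x ^ (col T.2).card

theorem H_rec (n x : ℕ) : H (n + 1) x + x * B n x = x * B n (x + 1) := by
  unfold H B
  rw [sum_HT n (fun _ c => x ^ c), Finset.mul_sum, Finset.mul_sum, ← Finset.sum_add_distrib]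
  exact Finset.sum_congr rfl fun T _ => sum_subsets _ _

theorem B_rec (n x : ℕ) (hn : 1 ≤ n) : B (n + 1) x = x * B n (x + 1) := by
  rw [← H_rec]
  have := sum_VT n hn (fun _ c => x ^ c)
  rw [B, ← Finset.sum_filter_add_sum_filter_not _ (fun T => HT T.1), this, H, B, Finset.mul_sum]
  simp only [pow_succ']

theorem K_rec (n x : ℕ) (hn : 1 ≤ n) : K (n + 1) x = x * K n (x + 1) + x * H n x := by
  have h1 := sum_VT n hn (fun D c => (cornersOf D).card * x ^ c)
  have h2 := sum_HT n (fun D c => (cornersOf D).card * x ^ c)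
  rw [K, ← Finset.sum_filter_add_sum_filter_not _ (fun T => HT T.1), h1, h2, H, K,
    Finset.sum_filter, Finset.mul_sum, Finset.mul_sum, ← Finset.sum_add_distrib,
    ← Finset.sum_add_distrib]
  refine Finset.sum_congr rfl ?_
  rintro ⟨D, P⟩ hT
  rw [mem_TLTs] at hT
  have h3 := sum_subsets (col P) x
  simp only [corners_add, corners_row hT.1, ← Finset.mul_sum]
  have h4 : x * ((cornersOf D).card * (x + 1) ^ (col P).card) =
    (cornersOf D).card * (∑ S ∈ (col P).powerset.filter (fun S => S.Nonempty),
      x ^ ((col P).card + 1 - S.card) + x * x ^ (col P).card) := by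
    rw [h3]; ring
  rw [h4]
  split_ifs <;> ring

theorem TLTs_one : TLTs 1 = {({(0, 0)}, {(0, 0)})} := by
  ext ⟨D, P⟩
  rw [mem_TLTs, Finset.mem_singleton, isTLT_iff, Prod.mk.injEq]
  constructor
  · rintro ⟨⟨hY, hPD, h0, ht, hrc⟩, hc⟩
    obtain ⟨a, rfl⟩ := Finset.card_eq_one.1 hc
    obtain rfl : (0, 0) = a := by simpa using h0
    refine ⟨?_, rfl⟩
    ext ⟨i, j⟩
    constructor
    · intro h
      have := hrc i j h
      simp at this
      simp [this]
    · intro h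
      exact hPD _ _ h
  · rintro ⟨rfl, rfl⟩
    simp
    omega

theorem col_one : col {((0 : ℕ), (0 : ℕ))} = {0} := by
  ext i
  simp

theorem B_one (x) : B 1 x = x := by
  simp [B, TLTs_one, col_one]

theorem K_one (x) : K 1 x = x := by
  have : cornersOf {((0 : ℕ), (0 : ℕ))} = {(0, 0)} := by
    ext ⟨i, j⟩
    simp [mem_corners]
  simp [K, TLTs_one, col_one, this]

theorem H_one (x) : H 1 x = 0 := by
  simp [H, TLTs_one, Finset.filter_singleton, HT]

theorem B_asc (n x : ℕ) : B (n + 1) x = x.ascFactorial (n + 1) := by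
  induction n generalizing x with
  | zero => simp [B_one, Nat.ascFactorial]
  | succ n ih => rw [B_rec _ _ (by omega), ih, Nat.succ_ascFactorial, ← Nat.ascFactorial_succ]

theorem H_val (n x : ℕ) : H (n + 2) x = (n + 1) * x.ascFactorial (n + 1) := by
  have h := H_rec (n + 1) x
  rw [B_asc, B_asc, Nat.succ_ascFactorial] at h
  nlinarith

theorem K_val (m x : ℕ) : 6 * K (m + 2) x + x.ascFactorial m * m =
    x.ascFactorial m * (6 * (x + m) * (x + m + 1) + 3 * x * m * (m + 1) + m ^ 3) := by
  induction m generalizing x with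
  | zero =>
    rw [K_rec _ _ (by omega), K_one, H_one]
    simp
    ring
  | succ m ih =>
    have h := ih (x + 1)
    have e : x * (x + 1).ascFactorial m = x.ascFactorial (m + 1) := by
      rw [Nat.succ_ascFactorial, ← Nat.ascFactorial_succ]
    rw [K_rec _ _ (by omega), H_val]
    have h' : 6 * (x * K (m + 2) (x + 1)) + (x * (x + 1).ascFactorial m) * m =
        (x * (x + 1).ascFactorial m) * (6 * (x + 1 + m) * (x + 1 + m + 1) +
          3 * (x + 1) * m * (m + 1) + m ^ 3) := by
      linear_combination x * h
    rw [e] at h'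
    linear_combination h'

end TLTProof

open scoped Classical in
theorem stmt3 (n : ℕ) (hn : 2 ≤ n) :
    6 * ∑ T ∈ TLTs n, (cornersOf T.1).card = n.factorial * (n + 4) := by
  obtain ⟨m, rfl⟩ : ∃ m, n = m + 2 := ⟨n - 2, by omega⟩
  have h := TLTProof.K_val m 1
  have e : TLTProof.K (m + 2) 1 = ∑ T ∈ TLTs (m + 2), (cornersOf T.1).card := by
    simp [TLTProof.K]
  rw [e, Nat.one_ascFactorial] at h
  rw [Nat.factorial_succ, Nat.factorial_succ]
  nlinarith
end

section
/- For n ≥ 3, the number of non-occupied corners in the set of tree-like tableaux of size n equals n! · (n-2)/6; for n = 1 and n = 2 this number is zero. -/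
open Finset

open scoped Classical in
/-- Non-occupied corners of a tableau `(D, P)`. -/
noncomputable def nocCornersOf (D P : Finset (ℕ × ℕ)) : Finset (ℕ × ℕ) :=
  D.filter (fun c => CornerCell D c ∧ c ∉ P)


def Op (P : Finset (ℕ × ℕ)) (x : ℕ) : Prop := ∃ q, (x, q) ∈ P
def Cl (P : Finset (ℕ × ℕ)) (x : ℕ) : Prop := ∃ p, (p, x) ∈ P

/-- arc model of tree-like tableaux with `m` border edges -/
structure IsArc (m : ℕ) (P : Finset (ℕ × ℕ)) : Prop where
  lt : ∀ p q, (p, q) ∈ P → p < q ∧ q < m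
  root : (0, m - 1) ∈ P
  tree : ∀ p q, (p, q) ∈ P → ¬ (p = 0 ∧ q = m - 1) →
    ((∃ q', q < q' ∧ (p, q') ∈ P) ↔ ¬ ∃ p', p' < p ∧ (p', q) ∈ P)
  typ : ∀ x < m, (Op P x ↔ ¬ Cl P x)

theorem IsArc.not_cl_zero {m P} (h : IsArc m P) : ¬ Cl P 0 := by
  rintro ⟨p, hp⟩
  have := h.lt _ _ hp
  omega

theorem IsArc.not_op_last {m P} (h : IsArc m P) : ¬ Op P (m - 1) := by
  rintro ⟨p, hp⟩
  have := h.lt _ _ hp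
  omega

def sw (i x : ℕ) : ℕ := if x = i then i + 1 else if x = i + 1 then i else x

theorem sw_sw (i x : ℕ) : sw i (sw i x) = x := by unfold sw; grind

def swP (i : ℕ) (P : Finset (ℕ × ℕ)) : Finset (ℕ × ℕ) := P.image (fun c => (sw i c.1, sw i c.2))

theorem mem_swP (i : ℕ) (P : Finset (ℕ × ℕ)) (p q : ℕ) :
    (p, q) ∈ swP i P ↔ (sw i p, sw i q) ∈ P := by
  simp only [swP, Finset.mem_image, Prod.exists, Prod.mk.injEq]
  constructor
  · rintro ⟨a, b, h, rfl, rfl⟩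
    simpa [sw_sw] using h
  · intro h
    exact ⟨_, _, h, sw_sw _ _, sw_sw _ _⟩

theorem swP_swP (i : ℕ) (P : Finset (ℕ × ℕ)) : swP i (swP i P) = P := by
  ext ⟨p, q⟩
  simp [mem_swP, sw_sw]

theorem op_swP (i : ℕ) (P : Finset (ℕ × ℕ)) (x : ℕ) : Op (swP i P) x ↔ Op P (sw i x) := by
  simp only [Op, mem_swP]
  constructor
  · rintro ⟨q, h⟩; exact ⟨_, h⟩
  · rintro ⟨q, h⟩; exact ⟨sw i q, by rwa [sw_sw]⟩

theorem cl_swP (i : ℕ) (P : Finset (ℕ × ℕ)) (x : ℕ) : Cl (swP i P) x ↔ Cl P (sw i x) := by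
  simp only [Cl, mem_swP]
  constructor
  · rintro ⟨q, h⟩; exact ⟨_, h⟩
  · rintro ⟨q, h⟩; exact ⟨sw i q, by rwa [sw_sw]⟩

theorem sw_lt {i x y : ℕ} (h : x < y) (h' : ¬ (x = i ∧ y = i + 1)) : sw i x < sw i y := by
  unfold sw; grind

theorem isArc_swP {m i : ℕ} {P : Finset (ℕ × ℕ)} (h : IsArc m P) (hi : 1 ≤ i) (him : i + 1 < m - 1)
    (h1 : (i, i + 1) ∉ P) (h2 : Op P i ↔ Cl P (i + 1)) : IsArc m (swP i P) := by
  have hti := h.typ i (by omega)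
  have htj := h.typ (i + 1) (by omega)
  have key : ∀ p q, (p, q) ∈ P → sw i p < sw i q := by
    intro p q hpq
    exact sw_lt (h.lt _ _ hpq).1 (by rintro ⟨rfl, rfl⟩; exact h1 hpq)
  have hm : ∀ x, x < m → sw i x < m := by intro x hx; unfold sw; grind
  have hs0 : sw i 0 = 0 := by unfold sw; grind
  have hsm : sw i (m - 1) = m - 1 := by unfold sw; grind
  have hop : ∀ x y, Op P x → Op P y → (x < y ↔ sw i x < sw i y) := by
    intro x y hx hy
    have : ¬ (x = i ∧ y = i + 1) := by rintro ⟨rfl, rfl⟩; tauto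
    have : ¬ (y = i ∧ x = i + 1) := by rintro ⟨rfl, rfl⟩; tauto
    unfold sw; grind
  have hcl : ∀ x y, Cl P x → Cl P y → (x < y ↔ sw i x < sw i y) := by
    intro x y hx hy
    have : ¬ (x = i ∧ y = i + 1) := by rintro ⟨rfl, rfl⟩; tauto
    have : ¬ (y = i ∧ x = i + 1) := by rintro ⟨rfl, rfl⟩; tauto
    unfold sw; grind
  refine ⟨?_, ?_, ?_, ?_⟩
  · intro p q hpq
    rw [mem_swP] at hpq
    have := key _ _ hpq
    have h3 := hm _ (h.lt _ _ hpq).2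
    rw [sw_sw] at h3
    rw [sw_sw, sw_sw] at this
    exact ⟨this, h3⟩
  · rw [mem_swP, hs0, hsm]; exact h.root
  · intro p q hpq hne
    rw [mem_swP] at hpq
    have := h.tree _ _ hpq (by
      rintro ⟨ha, hb⟩
      apply hne
      rw [← sw_sw i p, ← sw_sw i q, ha, hb]
      exact ⟨hs0, hsm⟩)
    convert this using 1
    · simp only [mem_swP]
      constructor
      · rintro ⟨q', ha, hb⟩
        refine ⟨sw i q', ?_, hb⟩
        rw [hcl _ _ ⟨_, hpq⟩ ⟨_, hb⟩, sw_sw, sw_sw]; exact ha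
      · rintro ⟨q', ha, hb⟩
        refine ⟨sw i q', ?_, by rwa [sw_sw]⟩
        rwa [hcl _ _ ⟨_, hpq⟩ ⟨_, hb⟩, sw_sw] at ha
    · simp only [mem_swP]
      apply not_congr
      constructor
      · rintro ⟨q', ha, hb⟩
        refine ⟨sw i q', ?_, hb⟩
        rw [hop _ _ ⟨_, hb⟩ ⟨_, hpq⟩, sw_sw, sw_sw]; exact ha
      · rintro ⟨q', ha, hb⟩
        refine ⟨sw i q', ?_, by rwa [sw_sw]⟩
        rwa [hop _ _ ⟨_, hb⟩ ⟨_, hpq⟩, sw_sw] at ha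
  · intro x hx
    rw [op_swP, cl_swP]
    exact h.typ _ (hm _ hx)

def sk (d x : ℕ) : ℕ := if x < d then x else x + 1
def un (d x : ℕ) : ℕ := if x < d then x else x - 1

theorem un_sk (d x : ℕ) : un d (sk d x) = x := by unfold un sk; grind
theorem sk_un {d x : ℕ} (h : x ≠ d) : sk d (un d x) = x := by unfold un sk; grind
theorem sk_ne (d x : ℕ) : sk d x ≠ d := by unfold sk; grind
theorem sk_lt (d x y : ℕ) : sk d x < sk d y ↔ x < y := by unfold sk; grind
theorem sk_inj {d x y : ℕ} : sk d x = sk d y ↔ x = y := by unfold sk; grind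

def ins (d i : ℕ) (P : Finset (ℕ × ℕ)) : Finset (ℕ × ℕ) :=
  insert (i, i + 1) (P.image (fun c => (sk d c.1, sk d c.2)))

def del (d : ℕ) (P : Finset (ℕ × ℕ)) : Finset (ℕ × ℕ) :=
  (P.filter (fun c => c.1 ≠ d ∧ c.2 ≠ d)).image (fun c => (un d c.1, un d c.2))

theorem mem_ins (d i : ℕ) (P : Finset (ℕ × ℕ)) (p q : ℕ) :
    (p, q) ∈ ins d i P ↔ (p = i ∧ q = i + 1) ∨ ∃ a b, (a, b) ∈ P ∧ sk d a = p ∧ sk d b = q := by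
  simp [ins]

theorem mem_ins_sk (d i : ℕ) (P : Finset (ℕ × ℕ)) (p q : ℕ) (hd : d = i ∨ d = i + 1) :
    (sk d p, sk d q) ∈ ins d i P ↔ (p, q) ∈ P := by
  rw [mem_ins]
  constructor
  · rintro (⟨h1, h2⟩ | ⟨a, b, h, h1, h2⟩)
    · rcases hd with h | h
      · exact absurd (h1.trans h.symm) (sk_ne _ _)
      · exact absurd (h2.trans h.symm) (sk_ne _ _)
    · rw [sk_inj] at h1 h2; subst h1 h2; exact h
  · intro h; exact Or.inr ⟨_, _, h, rfl, rfl⟩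

theorem mem_del (d : ℕ) (P : Finset (ℕ × ℕ)) (p q : ℕ) :
    (p, q) ∈ del d P ↔ (sk d p, sk d q) ∈ P := by
  simp only [del, Finset.mem_image, Finset.mem_filter, Prod.exists, Prod.mk.injEq]
  constructor
  · rintro ⟨a, b, ⟨h, h1, h2⟩, rfl, rfl⟩
    rwa [sk_un h1, sk_un h2]
  · intro h
    exact ⟨_, _, ⟨h, sk_ne _ _, sk_ne _ _⟩, un_sk _ _, un_sk _ _⟩

theorem del_ins (d i : ℕ) (P : Finset (ℕ × ℕ)) (hd : d = i ∨ d = i + 1) :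
    del d (ins d i P) = P := by
  ext ⟨p, q⟩
  rw [mem_del, mem_ins_sk _ _ _ _ _ hd]

theorem op_ins {d i : ℕ} {P : Finset (ℕ × ℕ)} (hd : (d = i ∧ Cl P i) ∨ (d = i + 1 ∧ Op P i))
    (x : ℕ) : Op (ins d i P) (sk d x) ↔ Op P x := by
  constructor
  · rintro ⟨q, hq⟩
    rw [mem_ins] at hq
    rcases hq with ⟨h1, h2⟩ | ⟨a, b, h, h1, h2⟩
    · rcases hd with ⟨rfl, hd⟩ | ⟨rfl, hd⟩
      · exact absurd h1 (sk_ne _ _)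
      · have : x = i := by unfold sk at h1; grind
        rwa [this]
    · rw [sk_inj] at h1; subst h1; exact ⟨_, h⟩
  · rintro ⟨q, hq⟩
    exact ⟨sk d q, (mem_ins _ _ _ _ _).2 (Or.inr ⟨_, _, hq, rfl, rfl⟩)⟩

theorem cl_ins {d i : ℕ} {P : Finset (ℕ × ℕ)} (hd : (d = i ∧ Cl P i) ∨ (d = i + 1 ∧ Op P i))
    (x : ℕ) : Cl (ins d i P) (sk d x) ↔ Cl P x := by
  constructor
  · rintro ⟨q, hq⟩
    rw [mem_ins] at hq
    rcases hq with ⟨h1, h2⟩ | ⟨a, b, h, h1, h2⟩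
    · rcases hd with ⟨rfl, hd⟩ | ⟨rfl, hd⟩
      · have : x = d := by unfold sk at h2; grind
        rwa [this]
      · exact absurd h2 (sk_ne _ _)
    · rw [sk_inj] at h2; subst h2; exact ⟨_, h⟩
  · rintro ⟨q, hq⟩
    exact ⟨sk d q, (mem_ins _ _ _ _ _).2 (Or.inr ⟨_, _, hq, rfl, rfl⟩)⟩

theorem isArc_ins {m d i : ℕ} {P : Finset (ℕ × ℕ)} (h : IsArc m P) (him : i < m)
    (hd : (d = i ∧ Cl P i) ∨ (d = i + 1 ∧ Op P i)) : IsArc (m + 1) (ins d i P) := by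
  have hr := h.lt _ _ h.root
  have hd' : d = i ∨ d = i + 1 := by tauto
  have hdi : 1 ≤ d ∧ d < m := by
    rcases hd with ⟨rfl, hd⟩ | ⟨rfl, hd⟩
    · refine ⟨?_, him⟩
      rcases Nat.eq_zero_or_pos d with h0 | h0
      · subst h0; exact absurd hd h.not_cl_zero
      · exact h0
    · refine ⟨by omega, ?_⟩
      by_contra hc
      have : i = m - 1 := by omega
      subst this
      exact h.not_op_last hd
  refine ⟨?_, ?_, ?_, ?_⟩
  · intro p q hpq
    rw [mem_ins] at hpq
    rcases hpq with ⟨rfl, rfl⟩ | ⟨a, b, hab, rfl, rfl⟩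
    · refine ⟨by omega, ?_⟩
      omega
    · have := h.lt _ _ hab
      rw [sk_lt]
      refine ⟨this.1, ?_⟩
      unfold sk; grind
  · have h1 := (mem_ins_sk d i P 0 (m - 1) hd').2 h.root
    have e1 : sk d 0 = 0 := by unfold sk; grind
    have e2 : sk d (m - 1) = m + 1 - 1 := by unfold sk; grind
    rwa [e1, e2] at h1
  · intro p q hpq hne
    rw [mem_ins] at hpq
    rcases hpq with ⟨rfl, rfl⟩ | ⟨a, b, hab, rfl, rfl⟩
    · rcases hd with ⟨rfl, a, ha⟩ | ⟨rfl, b, hb⟩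
      · have hR : ∃ p' < d, (p', d + 1) ∈ ins d d P := by
          have h1 := h.lt _ _ ha
          refine ⟨a, h1.1, (mem_ins _ _ _ _ _).2 (Or.inr ⟨_, _, ha, ?_, ?_⟩)⟩ <;>
            (unfold sk; grind)
        have hL : ¬ ∃ q', d + 1 < q' ∧ (d, q') ∈ ins d d P := by
          rintro ⟨q', h1, h2⟩
          rw [mem_ins] at h2
          rcases h2 with h2 | ⟨_, _, _, h3, _⟩
          · omega
          · exact sk_ne _ _ h3
        exact iff_of_false hL (not_not.2 hR)
      · have hR : ∃ q', p + 1 < q' ∧ (p, q') ∈ ins (p + 1) p P := by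
          have h1 := h.lt _ _ hb
          refine ⟨b + 1, by omega, (mem_ins _ _ _ _ _).2 (Or.inr ⟨_, _, hb, ?_, ?_⟩)⟩ <;>
            (unfold sk; grind)
        have hL : ¬ ∃ p' < p, (p', p + 1) ∈ ins (p + 1) p P := by
          rintro ⟨q', h1, h2⟩
          rw [mem_ins] at h2
          rcases h2 with h2 | ⟨_, _, _, _, h3⟩
          · omega
          · exact sk_ne _ _ h3
        exact iff_of_true hR hL
    · have ht := h.tree _ _ hab (by
        rintro ⟨rfl, rfl⟩
        apply hne
        constructor <;> (unfold sk; grind))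
      have hlt := h.lt _ _ hab
      convert ht using 1
      · constructor
        · rintro ⟨q', h1, h2⟩
          rw [mem_ins] at h2
          rcases h2 with h2 | ⟨a', b', h3, h4, rfl⟩
          · exfalso; revert h1 h2; unfold sk; grind
          · rw [sk_inj] at h4; subst h4
            exact ⟨b', (sk_lt _ _ _).1 h1, h3⟩
        · rintro ⟨b', h1, h2⟩
          exact ⟨sk d b', (sk_lt _ _ _).2 h1, (mem_ins_sk _ _ _ _ _ hd').2 h2⟩
      · apply not_congr
        constructor
        · rintro ⟨q', h1, h2⟩
          rw [mem_ins] at h2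
          rcases h2 with h2 | ⟨a', b', h3, rfl, h4⟩
          · exfalso; revert h1 h2; unfold sk; grind
          · rw [sk_inj] at h4; subst h4
            exact ⟨a', (sk_lt _ _ _).1 h1, h3⟩
        · rintro ⟨b', h1, h2⟩
          exact ⟨sk d b', (sk_lt _ _ _).2 h1, (mem_ins_sk _ _ _ _ _ hd').2 h2⟩
  · intro x hx
    by_cases hxd : x = d
    · subst hxd
      rcases hd with ⟨rfl, hd⟩ | ⟨rfl, hd⟩
      · have h1 : Op (ins x x P) x := ⟨_, (mem_ins _ _ _ _ _).2 (Or.inl ⟨rfl, rfl⟩)⟩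
        have h2 : ¬ Cl (ins x x P) x := by
          rintro ⟨p, hp⟩
          rw [mem_ins] at hp
          rcases hp with h2 | ⟨_, _, _, _, h3⟩
          · omega
          · exact sk_ne _ _ h3
        tauto
      · have h1 : Cl (ins (i+1) i P) (i+1) := ⟨_, (mem_ins _ _ _ _ _).2 (Or.inl ⟨rfl, rfl⟩)⟩
        have h2 : ¬ Op (ins (i+1) i P) (i+1) := by
          rintro ⟨p, hp⟩
          rw [mem_ins] at hp
          rcases hp with h2 | ⟨_, _, _, h3, _⟩
          · omega
          · exact sk_ne _ _ h3
        tauto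
    · rw [← sk_un hxd, op_ins hd, cl_ins hd]
      apply h.typ
      unfold un; grind

/-- the hypothesis under which the position `d` can be deleted -/
def DelHyp (d i : ℕ) (P : Finset (ℕ × ℕ)) : Prop :=
  (d = i ∧ ∃ p' < i, (p', i + 1) ∈ P) ∨ (d = i + 1 ∧ ∃ q', i + 1 < q' ∧ (i, q') ∈ P)

theorem delHyp_unique {m d i : ℕ} {P : Finset (ℕ × ℕ)} (h : IsArc (m + 1) P) (hm : 2 ≤ m)
    (hP : (i, i + 1) ∈ P) (hd : DelHyp d i P) :
    ∀ p q, (p, q) ∈ P → (p = d ∨ q = d) → p = i ∧ q = i + 1 := by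
  have ht := h.tree _ _ hP (by omega)
  have hlt := h.lt _ _ hP
  intro p q hpq h1
  have hlt' := h.lt _ _ hpq
  have ti := h.typ i (by omega)
  have tj := h.typ (i + 1) (by omega)
  have hoi : Op P i := ⟨_, hP⟩
  have hcj : Cl P (i + 1) := ⟨_, hP⟩
  rcases hd with ⟨rfl, hd⟩ | ⟨rfl, hd⟩
  · rcases h1 with rfl | rfl
    · refine ⟨rfl, ?_⟩
      by_contra hc
      exact ht.1 ⟨q, by omega, hpq⟩ hd
    · exact absurd ⟨_, hpq⟩ (ti.1 hoi)
  · rcases h1 with rfl | rfl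
    · exact absurd hcj (tj.1 ⟨_, hpq⟩)
    · refine ⟨?_, rfl⟩
      by_contra hc
      exact ht.1 hd ⟨p, by omega, hpq⟩

theorem ins_del {m d i : ℕ} {P : Finset (ℕ × ℕ)} (h : IsArc (m + 1) P) (hm : 2 ≤ m)
    (hP : (i, i + 1) ∈ P) (hd : DelHyp d i P) : ins d i (del d P) = P := by
  have hu := delHyp_unique h hm hP hd
  ext ⟨p, q⟩
  rw [mem_ins]
  constructor
  · rintro (⟨rfl, rfl⟩ | ⟨a, b, hab, rfl, rfl⟩)
    · exact hP
    · rwa [mem_del] at hab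
  · intro hpq
    by_cases hc : p = d ∨ q = d
    · exact Or.inl (hu _ _ hpq hc)
    · push Not at hc
      refine Or.inr ⟨un d p, un d q, ?_, sk_un hc.1, sk_un hc.2⟩
      rwa [mem_del, sk_un hc.1, sk_un hc.2]

theorem op_del {m d i : ℕ} {P : Finset (ℕ × ℕ)} (h : IsArc (m + 1) P) (hm : 2 ≤ m)
    (hP : (i, i + 1) ∈ P) (hd : DelHyp d i P) (x : ℕ) : Op (del d P) x ↔ Op P (sk d x) := by
  have hu := delHyp_unique h hm hP hd
  constructor
  · rintro ⟨q, hq⟩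
    exact ⟨_, (mem_del _ _ _ _).1 hq⟩
  · rintro ⟨q, hq⟩
    by_cases hc : q = d
    · have h1 := hu _ _ hq (Or.inr hc)
      rcases hd with ⟨rfl, hd⟩ | ⟨rfl, q', h2, h3⟩
      · omega
      · refine ⟨un (i + 1) q', ?_⟩
        rw [mem_del, sk_un (by omega), h1.1]
        exact h3
    · exact ⟨un d q, by rwa [mem_del, sk_un hc]⟩

theorem cl_del {m d i : ℕ} {P : Finset (ℕ × ℕ)} (h : IsArc (m + 1) P) (hm : 2 ≤ m)
    (hP : (i, i + 1) ∈ P) (hd : DelHyp d i P) (x : ℕ) : Cl (del d P) x ↔ Cl P (sk d x) := by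
  have hu := delHyp_unique h hm hP hd
  constructor
  · rintro ⟨q, hq⟩
    exact ⟨_, (mem_del _ _ _ _).1 hq⟩
  · rintro ⟨q, hq⟩
    by_cases hc : q = d
    · have h1 := hu _ _ hq (Or.inl hc)
      rcases hd with ⟨rfl, q', h2, h3⟩ | ⟨rfl, hd⟩
      · refine ⟨un d q', ?_⟩
        rw [mem_del, sk_un (by omega), h1.2]
        exact h3
      · omega
    · exact ⟨un d q, by rwa [mem_del, sk_un hc]⟩

theorem isArc_del {m d i : ℕ} {P : Finset (ℕ × ℕ)} (h : IsArc (m + 1) P) (hm : 2 ≤ m)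
    (hP : (i, i + 1) ∈ P) (hd : DelHyp d i P) : IsArc m (del d P) := by
  have hu := delHyp_unique h hm hP hd
  have hlt := h.lt _ _ hP
  have hd1 : 1 ≤ d ∧ d < m := by
    rcases hd with ⟨rfl, q', h2, h3⟩ | ⟨rfl, q', h2, h3⟩
    · omega
    · have := h.lt _ _ h3
      omega
  have e1 : sk d 0 = 0 := by unfold sk; grind
  have e2 : sk d (m - 1) = m := by unfold sk; grind
  refine ⟨?_, ?_, ?_, ?_⟩
  · intro p q hpq
    rw [mem_del] at hpq
    have := h.lt _ _ hpq
    rw [sk_lt] at this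
    refine ⟨this.1, ?_⟩
    have h2 := this.2
    unfold sk at h2
    grind
  · rw [mem_del, e1, e2]; exact h.root
  · intro p q hpq hne
    rw [mem_del] at hpq
    have ht := h.tree _ _ hpq (by
      rintro ⟨ha, hb⟩
      apply hne
      rw [← e1, sk_inj] at ha
      rw [show m + 1 - 1 = m by omega, ← e2, sk_inj] at hb
      exact ⟨ha, hb⟩)
    have hlt2 := h.lt _ _ hpq
    have n1 := sk_ne d p
    have n2 := sk_ne d q
    convert ht using 1
    · constructor
      · rintro ⟨q', h1, h2⟩
        exact ⟨sk d q', (sk_lt _ _ _).2 h1, (mem_del _ _ _ _).1 h2⟩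
      · rintro ⟨q', h1, h2⟩
        have hq' : q' ≠ d := by
          intro hc
          have := hu _ _ h2 (Or.inr hc)
          omega
        refine ⟨un d q', ?_, ?_⟩
        · rw [← sk_lt d, sk_un hq']; exact h1
        · rw [mem_del, sk_un hq']; exact h2
    · apply not_congr
      constructor
      · rintro ⟨q', h1, h2⟩
        exact ⟨sk d q', (sk_lt _ _ _).2 h1, (mem_del _ _ _ _).1 h2⟩
      · rintro ⟨q', h1, h2⟩
        have hq' : q' ≠ d := by
          intro hc
          have := hu _ _ h2 (Or.inl hc)
          omega
        refine ⟨un d q', ?_, ?_⟩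
        · rw [← sk_lt d, sk_un hq']; exact h1
        · rw [mem_del, sk_un hq']; exact h2
  · intro x hx
    rw [op_del h hm hP hd, cl_del h hm hP hd]
    apply h.typ
    unfold sk; grind

open scoped Classical in
noncomputable def Arcs (m : ℕ) : Finset (Finset (ℕ × ℕ)) :=
  (Finset.range m ×ˢ Finset.range m).powerset.filter (IsArc m)

theorem mem_Arcs {m : ℕ} {P : Finset (ℕ × ℕ)} : P ∈ Arcs m ↔ IsArc m P := by
  classical
  simp only [Arcs, Finset.mem_filter, Finset.mem_powerset, and_iff_right_iff_imp]
  rintro h ⟨p, q⟩ hpq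
  have := h.lt _ _ hpq
  simp only [Finset.mem_product, Finset.mem_range]
  omega

open scoped Classical in
noncomputable def cnt (m : ℕ) (Q : Finset (ℕ × ℕ) → Prop) : ℕ := ((Arcs m).filter Q).card

theorem cnt_congr {m : ℕ} {Q R : Finset (ℕ × ℕ) → Prop} (h : ∀ P, IsArc m P → (Q P ↔ R P)) :
    cnt m Q = cnt m R := by
  classical
  unfold cnt
  congr 1
  apply Finset.filter_congr
  intro P hP
  exact h P (mem_Arcs.1 hP)

theorem cnt_split (m : ℕ) (Q R : Finset (ℕ × ℕ) → Prop) :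
    cnt m Q = cnt m (fun P => Q P ∧ R P) + cnt m (fun P => Q P ∧ ¬ R P) := by
  classical
  unfold cnt
  rw [← Finset.card_filter_add_card_filter_not R, Finset.filter_filter, Finset.filter_filter]
  congr!

theorem cnt_zero {m : ℕ} {Q : Finset (ℕ × ℕ) → Prop} (h : ∀ P, IsArc m P → ¬ Q P) :
    cnt m Q = 0 := by
  classical
  unfold cnt
  rw [Finset.card_eq_zero, Finset.filter_eq_empty_iff]
  intro P hP
  exact h P (mem_Arcs.1 hP)

theorem cnt_bij {m m' : ℕ} {Q R : Finset (ℕ × ℕ) → Prop}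
    (f g : Finset (ℕ × ℕ) → Finset (ℕ × ℕ))
    (hf : ∀ P, IsArc m P → Q P → IsArc m' (f P) ∧ R (f P) ∧ g (f P) = P)
    (hg : ∀ P, IsArc m' P → R P → IsArc m (g P) ∧ Q (g P) ∧ f (g P) = P) :
    cnt m Q = cnt m' R := by
  classical
  unfold cnt
  refine Finset.card_bij' (fun P _ => f P) (fun P _ => g P) ?_ ?_ ?_ ?_
  all_goals
    intro P hP
    rw [Finset.mem_filter, mem_Arcs] at hP
    try simp only [Finset.mem_filter, mem_Arcs]
  · exact ⟨(hf P hP.1 hP.2).1, (hf P hP.1 hP.2).2.1⟩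
  · exact ⟨(hg P hP.1 hP.2).1, (hg P hP.1 hP.2).2.1⟩
  · exact (hf P hP.1 hP.2).2.2
  · exact (hg P hP.1 hP.2).2.2

theorem cnt_swap (m i j : ℕ) (hi : i + 1 < m) (hj : i + 1 < j) (h : Prop) :
    cnt m (fun P => Op P i ∧ Cl P (i + 1) ∧ (i, i + 1) ∉ P ∧ (h → Op P j)) =
    cnt m (fun P => Cl P i ∧ Op P (i + 1) ∧ (h → Op P j)) := by
  have s1 : sw i i = i + 1 := by unfold sw; grind
  have s2 : sw i (i + 1) = i := by unfold sw; grind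
  have s3 : sw i j = j := by unfold sw; grind
  apply cnt_bij (swP i) (swP i)
  · rintro P hP ⟨h1, h2, h3, h4⟩
    refine ⟨?_, ?_, swP_swP _ _⟩
    · apply isArc_swP hP _ _ h3 (by tauto)
      · by_contra hc
        have : i = 0 := by omega
        subst this
        obtain ⟨p, hp⟩ := h2
        have := hP.lt _ _ hp
        have : p = 0 := by omega
        subst this
        exact h3 hp
      · by_contra hc
        have : i + 1 = m - 1 := by omega
        obtain ⟨p, hp⟩ := h1
        have := hP.lt _ _ hp
        have : p = i + 1 := by omega
        subst this
        exact h3 hp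
    · rw [cl_swP, op_swP, op_swP, s1, s2, s3]
      exact ⟨h2, h1, h4⟩
  · rintro P hP ⟨h1, h2, h3⟩
    have ti := hP.typ i (by omega)
    have tj := hP.typ (i + 1) (by omega)
    refine ⟨?_, ?_, swP_swP _ _⟩
    · apply isArc_swP hP
      · by_contra hc
        have : i = 0 := by omega
        subst this
        exact hP.not_cl_zero h1
      · by_contra hc
        have : i + 1 = m - 1 := by omega
        rw [this] at h2
        exact hP.not_op_last h2
      · intro hc
        exact ti.1 ⟨_, hc⟩ h1
      · tauto
    · rw [cl_swP, op_swP, op_swP, s1, s2, s3]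
      refine ⟨h2, h1, ?_, h3⟩
      rw [mem_swP, s1, s2]
      intro hc
      have := hP.lt _ _ hc
      omega

theorem cnt_del (m d i j : ℕ) (hm : 2 ≤ m) (hi : i < m) (hj : i + 1 ≤ j) (h : Prop)
    (hd : d = i ∨ d = i + 1) :
    cnt (m + 1) (fun P => (i, i + 1) ∈ P ∧ DelHyp d i P ∧ (h → Op P (j + 1))) =
    cnt m (fun P => ((d = i ∧ Cl P i) ∨ (d = i + 1 ∧ Op P i)) ∧ (h → Op P j)) := by
  have s3 : sk d j = j + 1 := by unfold sk; grind
  apply cnt_bij (del d) (ins d i)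
  · rintro P hP ⟨h1, h2, h3⟩
    refine ⟨isArc_del hP hm h1 h2, ⟨?_, ?_⟩, ins_del hP hm h1 h2⟩
    · rw [cl_del hP hm h1 h2, op_del hP hm h1 h2]
      rcases hd with rfl | rfl
      · left
        refine ⟨rfl, ?_⟩
        have : sk d d = d + 1 := by unfold sk; grind
        rw [this]; exact ⟨_, h1⟩
      · right
        refine ⟨rfl, ?_⟩
        have : sk (i + 1) i = i := by unfold sk; grind
        rw [this]; exact ⟨_, h1⟩
    · rwa [op_del hP hm h1 h2, s3]
  · rintro P hP ⟨h1, h2⟩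
    refine ⟨isArc_ins hP hi h1, ⟨(mem_ins _ _ _ _ _).2 (Or.inl ⟨rfl, rfl⟩), ?_, ?_⟩,
      del_ins _ _ _ hd⟩
    · rcases h1 with ⟨rfl, a, ha⟩ | ⟨rfl, b, hb⟩
      · left
        have h1 := hP.lt _ _ ha
        refine ⟨rfl, a, h1.1, (mem_ins _ _ _ _ _).2 (Or.inr ⟨_, _, ha, ?_, ?_⟩)⟩ <;>
            (unfold sk; grind)
      · right
        have h1 := hP.lt _ _ hb
        refine ⟨rfl, b + 1, by omega, (mem_ins _ _ _ _ _).2 (Or.inr ⟨_, _, hb, ?_, ?_⟩)⟩ <;>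
            (unfold sk; grind)
    · rwa [← s3, op_ins h1]

theorem cnt_rel (m i j : ℕ) (hm : 2 ≤ m) (hi : i < m) (hj : i + 1 ≤ j) (h : Prop) :
    cnt (m + 1) (fun P => Op P i ∧ Cl P (i + 1) ∧ (h → Op P (j + 1))) =
    cnt (m + 1) (fun P => Cl P i ∧ Op P (i + 1) ∧ (h → Op P (j + 1))) +
      cnt m (fun P => (h → Op P j)) := by
  rw [cnt_split _ _ (fun P => (i, i + 1) ∈ P), add_comm]
  congr 1
  · rw [← cnt_swap _ _ _ (by omega) (by omega)]
    apply cnt_congr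
    intro P _
    tauto
  · rw [cnt_split _ _ (fun P => DelHyp i i P), cnt_split m _ (fun P => Cl P i)]
    congr 1
    · rw [cnt_congr (R := fun P => (i, i + 1) ∈ P ∧ DelHyp i i P ∧ (h → Op P (j + 1))),
        cnt_del _ _ _ _ hm hi hj h (Or.inl rfl)]
      · apply cnt_congr
        intro P hP
        have : ¬ (i = i + 1) := by omega
        tauto
      · intro P hP
        have : (i, i + 1) ∈ P → Op P i ∧ Cl P (i + 1) := fun h => ⟨⟨_, h⟩, ⟨_, h⟩⟩
        tauto
    · rw [cnt_congr (R := fun P => (i, i + 1) ∈ P ∧ DelHyp (i + 1) i P ∧ (h → Op P (j + 1))),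
        cnt_del _ _ _ _ hm hi hj h (Or.inr rfl)]
      · apply cnt_congr
        intro P hP
        have := hP.typ i hi
        have : ¬ (i + 1 = i) := by omega
        tauto
      · intro P hP
        have : (i, i + 1) ∈ P → Op P i ∧ Cl P (i + 1) := fun h => ⟨⟨_, h⟩, ⟨_, h⟩⟩
        have h2 : (i, i + 1) ∈ P → (DelHyp (i + 1) i P ↔ ¬ DelHyp i i P) := by
          intro h1
          have ht := hP.tree _ _ h1 (by omega)
          have e : ¬ (i = i + 1) := by omega
          have e' : ¬ (i + 1 = i) := by omega
          simp only [DelHyp, e, e', false_and, or_false, false_or, true_and]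
          exact ht
        tauto

theorem cnt_step (m i j : ℕ) (hm : 2 ≤ m) (hi : i < m) (hj : i + 1 ≤ j) (h : Prop) :
    cnt (m + 1) (fun P => Cl P (i + 1) ∧ (h → Op P (j + 1))) =
    cnt (m + 1) (fun P => Cl P i ∧ (h → Op P (j + 1))) +
      cnt m (fun P => (h → Op P j)) := by
  have hr := cnt_rel m i j hm hi hj h
  rw [cnt_split _ _ (fun P => Op P i),
    cnt_split (m + 1) (fun P => Cl P i ∧ (h → Op P (j + 1))) (fun P => Op P (i + 1))]
  have e1 : cnt (m + 1) (fun P => (Cl P (i + 1) ∧ (h → Op P (j + 1))) ∧ Op P i) =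
    cnt (m + 1) (fun P => Op P i ∧ Cl P (i + 1) ∧ (h → Op P (j + 1))) :=
    cnt_congr (by intro P _; tauto)
  have e2 : cnt (m + 1) (fun P => (Cl P i ∧ (h → Op P (j + 1))) ∧ Op P (i + 1)) =
    cnt (m + 1) (fun P => Cl P i ∧ Op P (i + 1) ∧ (h → Op P (j + 1))) :=
    cnt_congr (by intro P _; tauto)
  have e3 : cnt (m + 1) (fun P => (Cl P (i + 1) ∧ (h → Op P (j + 1))) ∧ ¬ Op P i) =
    cnt (m + 1) (fun P => (Cl P i ∧ (h → Op P (j + 1))) ∧ ¬ Op P (i + 1)) :=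
    cnt_congr (by
      intro P hP
      have := hP.typ i (by omega)
      have := hP.typ (i + 1) (by omega)
      tauto)
  omega

theorem cnt_cl (m i j : ℕ) (hm : 2 ≤ m) (hi : i ≤ m) (hj : i ≤ j) (h : Prop) :
    cnt (m + 1) (fun P => Cl P i ∧ (h → Op P (j + 1))) = i * cnt m (fun P => (h → Op P j)) := by
  induction i with
  | zero =>
    rw [zero_mul]
    apply cnt_zero
    intro P hP h1
    exact hP.not_cl_zero h1.1
  | succ i ih =>
    rw [cnt_step m i j hm (by omega) hj, ih (by omega) (by omega)]
    ring

theorem cnt_cl' (m i : ℕ) (hm : 2 ≤ m) (hi : i ≤ m) :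
    cnt (m + 1) (fun P => Cl P i) = i * cnt m (fun _ => True) := by
  have := cnt_cl m i i hm hi le_rfl False
  simpa using this

theorem cnt_all_succ (m : ℕ) (hm : 2 ≤ m) :
    cnt (m + 1) (fun _ => True) = m * cnt m (fun _ => True) := by
  rw [← cnt_cl' m m hm le_rfl]
  apply cnt_congr
  intro P hP
  simp only [true_iff]
  exact ⟨_, hP.root⟩

theorem cnt_two : cnt 2 (fun _ => True) = 1 := by
  classical
  unfold cnt
  rw [Finset.filter_true, Finset.card_eq_one]
  refine ⟨{(0, 1)}, ?_⟩
  ext P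
  rw [mem_Arcs, Finset.mem_singleton]
  constructor
  · intro h
    ext ⟨p, q⟩
    simp only [Finset.mem_singleton, Prod.mk.injEq]
    constructor
    · intro hp
      have := h.lt _ _ hp
      omega
    · rintro ⟨rfl, rfl⟩
      exact h.root
  · rintro rfl
    refine ⟨?_, ?_, ?_, ?_⟩
    · intro p q h; simp at h; omega
    · simp
    · intro p q h; simp at h; simp [h]
    · intro x hx
      simp only [Op, Cl, Finset.mem_singleton, Prod.mk.injEq]
      simp
      omega

theorem cnt_all (m : ℕ) : cnt (m + 2) (fun _ => True) = (m + 1).factorial := by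
  induction m with
  | zero => simpa using cnt_two
  | succ m ih =>
    rw [cnt_all_succ (m + 2) (by omega), ih, Nat.factorial_succ (m + 1)]

theorem cnt_ne (k i : ℕ) (hi : i < k + 3) :
    cnt (k + 4) (fun P => Cl P i ∧ Op P (i + 1)) = i * (k + 2 - i) * (k + 1).factorial := by
  have h1 := cnt_cl (k + 3) i i (by omega) (by omega) le_rfl True
  simp only [forall_const] at h1
  rw [h1, mul_assoc]
  congr 1
  have h2 := cnt_split (k + 3) (fun _ => True) (fun P => Cl P i)
  simp only [true_and] at h2
  rw [cnt_cl' (k + 2) i (by omega) (by omega), cnt_all (k + 1), cnt_all k] at h2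
  have h3 : cnt (k + 3) (fun P => ¬ Cl P i) = cnt (k + 3) (fun P => Op P i) :=
    cnt_congr (fun P hP => (hP.typ i hi).symm)
  rw [h3, Nat.factorial_succ (k + 1)] at h2
  obtain ⟨t, ht⟩ : ∃ t, k + 2 = i + t := ⟨k + 2 - i, by omega⟩
  have : k + 2 - i = t := by omega
  rw [this]
  have : (k + 1 + 1) * (k + 1).factorial = i * (k + 1).factorial + t * (k + 1).factorial := by
    rw [← add_mul, ← ht]
  omega

theorem sum_ne (k : ℕ) :
    6 * ∑ i ∈ Finset.range (k + 3), i * (k + 2 - i) = (k + 3) * (k + 2) * (k + 1) := by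
  have gen : ∀ k : ℕ, 6 * ∑ i ∈ Finset.range (k + 1), i * (k - i) = (k + 1) * k * (k - 1) := by
    intro k
    have h : ∀ s : ℕ, s ≤ k + 1 → (6 * ∑ i ∈ Finset.range s, (i:ℤ) * (k - i)) =
        3 * k * (s * (s - 1)) - (s - 1) * s * (2 * s - 1) := by
      intro s
      induction s with
      | zero => simp
      | succ s ih =>
        intro hs
        rw [Finset.sum_range_succ, mul_add, ih (by omega)]
        push_cast; ring
    have h2 := h (k + 1) le_rfl
    rcases k with _ | k
    · simp
    zify
    rw [Finset.sum_congr rfl (g := fun i : ℕ => (i : ℤ) * (((k + 1 : ℕ) : ℤ) - i))]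
    · rw [h2]; push_cast; simp; ring
    · intro i hi
      rw [Nat.cast_sub (by simp at hi; omega)]
  exact gen (k + 2)

theorem sum_cnt (n : ℕ) (hn : 3 ≤ n) :
    6 * ∑ i ∈ Finset.range n, cnt (n + 1) (fun P => Cl P i ∧ Op P (i + 1)) =
      n.factorial * (n - 2) := by
  obtain ⟨k, rfl⟩ : ∃ k, n = k + 3 := ⟨n - 3, by omega⟩
  rw [Finset.sum_congr rfl (fun i hi => cnt_ne k i (Finset.mem_range.1 hi)), ← Finset.sum_mul,
    ← mul_assoc, sum_ne, Nat.factorial_succ (k + 2), Nat.factorial_succ (k + 1),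
    show k + 3 - 2 = k + 1 by omega]
  ring

theorem sum_cnt_small (n : ℕ) (hn : n = 1 ∨ n = 2) :
    ∑ i ∈ Finset.range n, cnt (n + 1) (fun P => Cl P i ∧ Op P (i + 1)) = 0 := by
  apply Finset.sum_eq_zero
  intro i hi
  rw [Finset.mem_range] at hi
  apply cnt_zero
  rintro P hP ⟨h1, h2⟩
  rcases Nat.eq_zero_or_pos i with h | h
  · subst h; exact hP.not_cl_zero h1
  · have := hP.not_op_last
    rw [show n + 1 - 1 = i + 1 by omega] at this
    exact this h2

theorem cnt_swap' (m i : ℕ) (hi : i + 1 < m) :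
    cnt m (fun P => Op P i ∧ Cl P (i + 1) ∧ (i, i + 1) ∉ P) =
    cnt m (fun P => Cl P i ∧ Op P (i + 1)) := by
  have := cnt_swap m i (i + 2) hi (by omega) False
  simpa using this

theorem IsArc.card_add_one {m : ℕ} {P : Finset (ℕ × ℕ)} (h : IsArc m P) : P.card + 1 = m := by
  classical
  set Mo := P.filter (fun c => ¬ ∃ q', c.2 < q' ∧ (c.1, q') ∈ P) with hMo
  set Mc := P.filter (fun c => ¬ ∃ p', p' < c.1 ∧ (p', c.2) ∈ P) with hMc
  have hr := h.lt _ _ h.root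
  have hU : Mo ∪ Mc = P := by
    ext ⟨p, q⟩
    simp only [hMo, hMc, Finset.mem_union, Finset.mem_filter]
    constructor
    · tauto
    · intro hp
      by_cases hc : p = 0 ∧ q = m - 1
      · left
        refine ⟨hp, ?_⟩
        rintro ⟨q', h1, h2⟩
        have := h.lt _ _ h2
        omega
      · have := h.tree p q hp hc
        by_cases h1 : ∃ q', q < q' ∧ (p, q') ∈ P
        · exact Or.inr ⟨hp, this.1 h1⟩
        · exact Or.inl ⟨hp, h1⟩
  have hI : Mo ∩ Mc = {(0, m - 1)} := by
    ext ⟨p, q⟩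
    simp only [hMo, hMc, Finset.mem_inter, Finset.mem_filter, Finset.mem_singleton, Prod.mk.injEq]
    constructor
    · rintro ⟨⟨hp, h1⟩, ⟨_, h2⟩⟩
      by_contra hc
      exact h1 ((h.tree p q hp hc).2 h2)
    · rintro ⟨rfl, rfl⟩
      refine ⟨⟨h.root, ?_⟩, h.root, ?_⟩
      · rintro ⟨q', h1, h2⟩
        have := h.lt _ _ h2
        omega
      · rintro ⟨q', h1, h2⟩
        omega
  have cO : Mo.card = ((Finset.range m).filter (fun x => Op P x)).card := by
    apply Finset.card_bij (fun c _ => c.1)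
    · rintro ⟨p, q⟩ hp
      simp only [hMo, Finset.mem_filter] at hp
      have := h.lt _ _ hp.1
      simp only [Finset.mem_filter, Finset.mem_range]
      exact ⟨by omega, _, hp.1⟩
    · rintro ⟨p, q⟩ hp ⟨p', q'⟩ hp' heq
      simp only [hMo, Finset.mem_filter] at hp hp' heq
      subst heq
      by_contra hne
      rcases lt_trichotomy q q' with hq | hq | hq
      · exact hp.2 ⟨_, hq, hp'.1⟩
      · exact hne (by rw [hq])
      · exact hp'.2 ⟨_, hq, hp.1⟩
    · intro x hx
      simp only [Finset.mem_filter, Finset.mem_range] at hx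
      obtain ⟨hx, q, hq⟩ := hx
      obtain ⟨b, hb, hmax⟩ := Finset.exists_max_image (P.filter (fun c => c.1 = x)) (fun c => c.2)
        ⟨(x, q), by simp [hq]⟩
      obtain ⟨b1, b2⟩ := b
      simp only [Finset.mem_filter] at hb
      obtain ⟨hb, rfl⟩ := hb
      refine ⟨(b1, b2), ?_, rfl⟩
      simp only [hMo, Finset.mem_filter]
      refine ⟨hb, ?_⟩
      rintro ⟨q', h1, h2⟩
      have := hmax (b1, q') (by simp [h2])
      simp only at this
      omega
  have cC : Mc.card = ((Finset.range m).filter (fun x => ¬ Op P x)).card := by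
    apply Finset.card_bij (fun c _ => c.2)
    · rintro ⟨p, q⟩ hp
      simp only [hMc, Finset.mem_filter] at hp
      have := h.lt _ _ hp.1
      simp only [Finset.mem_filter, Finset.mem_range]
      refine ⟨by omega, ?_⟩
      rw [h.typ q (by omega), not_not]
      exact ⟨_, hp.1⟩
    · rintro ⟨p, q⟩ hp ⟨p', q'⟩ hp' heq
      simp only [hMc, Finset.mem_filter] at hp hp' heq
      subst heq
      by_contra hne
      rcases lt_trichotomy p p' with hq | hq | hq
      · exact hp'.2 ⟨_, hq, hp.1⟩
      · exact hne (by rw [hq])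
      · exact hp.2 ⟨_, hq, hp'.1⟩
    · intro x hx
      simp only [Finset.mem_filter, Finset.mem_range] at hx
      obtain ⟨hx, hq⟩ := hx
      rw [h.typ x hx, not_not] at hq
      obtain ⟨q, hq⟩ := hq
      obtain ⟨b, hb, hmax⟩ := Finset.exists_min_image (P.filter (fun c => c.2 = x)) (fun c => c.1)
        ⟨(q, x), by simp [hq]⟩
      obtain ⟨b1, b2⟩ := b
      simp only [Finset.mem_filter] at hb
      obtain ⟨hb, rfl⟩ := hb
      refine ⟨(b1, b2), ?_, rfl⟩
      simp only [hMc, Finset.mem_filter]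
      refine ⟨hb, ?_⟩
      rintro ⟨q', h1, h2⟩
      have := hmax (q', b2) (by simp [h2])
      simp only at this
      omega
  have h1 := Finset.card_union_add_card_inter Mo Mc
  have h2 := Finset.card_filter_add_card_filter_not (s := Finset.range m) (fun x => Op P x)
  rw [hU, hI, cO, cC, h2] at h1
  simpa using h1

/-- `κ`, `ρ` label the columns and rows of `D` by the border edges -/
structure Frame (m R C : ℕ) (κ ρ : ℕ → ℕ) (D : Finset (ℕ × ℕ)) : Prop where
  Rpos : 0 < R
  Cpos : 0 < C
  mono : ∀ c c', c < c' → c' < C → κ c < κ c'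
  anti : ∀ r r', r < r' → r' < R → ρ r' < ρ r
  kz : κ 0 = 0
  rz : ρ 0 = m - 1
  cover : ∀ x < m, (∃ c < C, κ c = x) ∨ ∃ r < R, ρ r = x
  kl : ∀ c < C, κ c < m
  rl : ∀ r < R, ρ r < m
  disj : ∀ c < C, ∀ r < R, κ c ≠ ρ r
  dmem : ∀ r c, (r, c) ∈ D ↔ r < R ∧ c < C ∧ κ c < ρ r

structure Link (R C : ℕ) (κ ρ : ℕ → ℕ) (D P P' : Finset (ℕ × ℕ)) : Prop where
  pd : P ⊆ D
  link : ∀ r < R, ∀ c < C, ((r, c) ∈ P ↔ (κ c, ρ r) ∈ P')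
  im : ∀ p q, (p, q) ∈ P' → ∃ c < C, ∃ r < R, κ c = p ∧ ρ r = q

section
variable {m R C : ℕ} {κ ρ : ℕ → ℕ} {D P P' : Finset (ℕ × ℕ)}

theorem Frame.kle (F : Frame m R C κ ρ D) {c c' : ℕ} (h : c ≤ c') (h' : c' < C) : κ c ≤ κ c' := by
  rcases h.lt_or_eq with h | h
  · exact (F.mono _ _ h h').le
  · rw [h]

theorem Frame.rle (F : Frame m R C κ ρ D) {r r' : ℕ} (h : r ≤ r') (h' : r' < R) : ρ r' ≤ ρ r := by
  rcases h.lt_or_eq with h | h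
  · exact (F.anti _ _ h h').le
  · rw [h]

theorem Frame.klt (F : Frame m R C κ ρ D) {c c' : ℕ} (hc : c < C) (h : κ c < κ c') : c < c' := by
  by_contra hc'
  have := F.kle (not_lt.1 hc') hc
  omega

theorem Frame.kinj (F : Frame m R C κ ρ D) {c c' : ℕ} (hc : c < C) (hc' : c' < C)
    (h : κ c = κ c') : c = c' := by
  rcases lt_trichotomy c c' with h1 | h1 | h1
  · have := F.mono _ _ h1 hc'; omega
  · exact h1
  · have := F.mono _ _ h1 hc; omega

theorem Frame.rinj (F : Frame m R C κ ρ D) {c c' : ℕ} (hc : c < R) (hc' : c' < R)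
    (h : ρ c = ρ c') : c = c' := by
  rcases lt_trichotomy c c' with h1 | h1 | h1
  · have := F.anti _ _ h1 hc'; omega
  · exact h1
  · have := F.anti _ _ h1 hc; omega

theorem Frame.row0 (F : Frame m R C κ ρ D) {c : ℕ} (hc : c < C) : (0, c) ∈ D := by
  rw [F.dmem]
  have h1 := F.kl c hc
  have h2 := F.disj c hc 0 F.Rpos
  have h3 := F.rz
  exact ⟨F.Rpos, hc, by omega⟩

theorem Frame.col0 (F : Frame m R C κ ρ D) {r : ℕ} (hr : r < R) : (r, 0) ∈ D := by
  rw [F.dmem]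
  have h2 := F.disj 0 F.Cpos r hr
  have h3 := F.kz
  exact ⟨hr, F.Cpos, by omega⟩

theorem Frame.young (F : Frame m R C κ ρ D) : IsYoung D := by
  intro r c r' c' h hr hc
  rw [F.dmem] at h ⊢
  have h1 := F.kle hc h.2.1
  have h2 := F.rle hr h.1
  omega

theorem Link.mem (F : Frame m R C κ ρ D) (L : Link R C κ ρ D P P') {r c : ℕ} :
    (r, c) ∈ P ↔ r < R ∧ c < C ∧ (κ c, ρ r) ∈ P' := by
  constructor
  · intro h
    have h1 := (F.dmem _ _).1 (L.pd h)
    exact ⟨h1.1, h1.2.1, (L.link _ h1.1 _ h1.2.1).1 h⟩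
  · rintro ⟨h1, h2, h3⟩
    exact (L.link _ h1 _ h2).2 h3

theorem Link.up (F : Frame m R C κ ρ D) (L : Link R C κ ρ D P P') {r c : ℕ} (hr : r < R)
    (hc : c < C) : (∃ q', ρ r < q' ∧ (κ c, q') ∈ P') ↔ ∃ r' < r, (r', c) ∈ P := by
  constructor
  · rintro ⟨q', h1, h2⟩
    obtain ⟨c', hc', r', hr', h3, rfl⟩ := L.im _ _ h2
    refine ⟨r', ?_, (L.link _ hr' _ hc).2 h2⟩
    by_contra hh
    have := F.rle (not_lt.1 hh) hr'
    omega
  · rintro ⟨r', h1, h2⟩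
    exact ⟨ρ r', F.anti _ _ h1 hr, ((L.mem F).1 h2).2.2⟩

theorem Link.left (F : Frame m R C κ ρ D) (L : Link R C κ ρ D P P') {r c : ℕ} (hr : r < R)
    (hc : c < C) : (∃ p', p' < κ c ∧ (p', ρ r) ∈ P') ↔ ∃ k < c, (r, k) ∈ P := by
  constructor
  · rintro ⟨q', h1, h2⟩
    obtain ⟨c', hc', r', hr', rfl, h3⟩ := L.im _ _ h2
    refine ⟨c', ?_, (L.link _ hr _ hc').2 h2⟩
    by_contra hh
    have := F.kle (not_lt.1 hh) hc'
    omega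
  · rintro ⟨r', h1, h2⟩
    exact ⟨κ r', F.mono _ _ h1 hc, ((L.mem F).1 h2).2.2⟩

theorem Link.op (F : Frame m R C κ ρ D) (L : Link R C κ ρ D P P') {c : ℕ}
    (hc : c < C) : Op P' (κ c) ↔ ∃ r, (r, c) ∈ P := by
  constructor
  · rintro ⟨q, h⟩
    obtain ⟨c', hc', r', hr', h3, rfl⟩ := L.im _ _ h
    exact ⟨r', (L.link _ hr' _ hc).2 h⟩
  · rintro ⟨r, h⟩
    exact ⟨_, ((L.mem F).1 h).2.2⟩

theorem Link.cl (F : Frame m R C κ ρ D) (L : Link R C κ ρ D P P') {r : ℕ}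
    (hr : r < R) : Cl P' (ρ r) ↔ ∃ c, (r, c) ∈ P := by
  constructor
  · rintro ⟨q, h⟩
    obtain ⟨c', hc', r', hr', rfl, h3⟩ := L.im _ _ h
    exact ⟨c', (L.link _ hr _ hc').2 h⟩
  · rintro ⟨r, h⟩
    exact ⟨_, ((L.mem F).1 h).2.2⟩

theorem Link.not_cl (F : Frame m R C κ ρ D) (L : Link R C κ ρ D P P') {c : ℕ}
    (hc : c < C) : ¬ Cl P' (κ c) := by
  rintro ⟨q, h⟩
  obtain ⟨c', hc', r', hr', h3, h4⟩ := L.im _ _ h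
  exact F.disj _ hc _ hr' h4.symm

theorem Link.not_op (F : Frame m R C κ ρ D) (L : Link R C κ ρ D P P') {r : ℕ}
    (hr : r < R) : ¬ Op P' (ρ r) := by
  rintro ⟨q, h⟩
  obtain ⟨c', hc', r', hr', h3, h4⟩ := L.im _ _ h
  exact F.disj _ hc' _ hr h3

theorem Link.fwd (F : Frame m R C κ ρ D) (L : Link R C κ ρ D P P') (h : IsTLT D P) :
    IsArc m P' := by
  obtain ⟨hY, hPD, hroot, htree, hfull⟩ := h
  refine ⟨?_, ?_, ?_, ?_⟩
  · intro p q hpq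
    obtain ⟨c, hc, r, hr, rfl, rfl⟩ := L.im _ _ hpq
    have h1 := hPD ((L.link _ hr _ hc).2 hpq)
    rw [F.dmem] at h1
    exact ⟨h1.2.2, F.rl _ hr⟩
  · have := ((L.mem F).1 hroot).2.2
    rwa [F.kz, F.rz] at this
  · intro p q hpq hne
    obtain ⟨c, hc, r, hr, rfl, rfl⟩ := L.im _ _ hpq
    rw [L.up F hr hc, L.left F hr hc]
    apply htree (r, c) ((L.link _ hr _ hc).2 hpq)
    intro he
    simp only [Prod.mk.injEq] at he
    obtain ⟨rfl, rfl⟩ := he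
    exact hne ⟨F.kz, F.rz⟩
  · intro x hx
    rcases F.cover x hx with ⟨c, hc, rfl⟩ | ⟨r, hr, rfl⟩
    · exact iff_of_true ((L.op F hc).2 (hfull _ (F.row0 hc)).2) (L.not_cl F hc)
    · exact iff_of_false (L.not_op F hr) (not_not.2 ((L.cl F hr).2 (hfull _ (F.col0 hr)).1))

theorem Link.bwd (F : Frame m R C κ ρ D) (L : Link R C κ ρ D P P') (h : IsArc m P') :
    IsTLT D P := by
  refine ⟨F.young, L.pd, ?_, ?_, ?_⟩
  · rw [L.mem F, F.kz, F.rz]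
    exact ⟨F.Rpos, F.Cpos, h.root⟩
  · rintro ⟨r, c⟩ hP hne
    obtain ⟨hr, hc, hP'⟩ := (L.mem F).1 hP
    have := h.tree _ _ hP' (by
      rintro ⟨h1, h2⟩
      apply hne
      rw [← F.kz] at h1
      rw [← F.rz] at h2
      rw [F.kinj hc F.Cpos h1, F.rinj hr F.Rpos h2])
    rwa [L.up F hr hc, L.left F hr hc] at this
  · rintro ⟨r, c⟩ hD
    obtain ⟨hr, hc, -⟩ := (F.dmem _ _).1 hD
    constructor
    · rw [← L.cl F hr]
      have := h.typ _ (F.rl _ hr)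
      have := L.not_op F hr
      tauto
    · rw [← L.op F hc]
      have := h.typ _ (F.kl _ hc)
      have := L.not_cl F hc
      tauto

theorem Link.card (F : Frame m R C κ ρ D) (L : Link R C κ ρ D P P') : P.card = P'.card := by
  apply Finset.card_bij (fun x _ => (κ x.2, ρ x.1))
  · rintro ⟨r, c⟩ h
    exact ((L.mem F).1 h).2.2
  · rintro ⟨r, c⟩ h ⟨r', c'⟩ h' he
    simp only [Prod.mk.injEq] at he
    have h1 := (L.mem F).1 h
    have h2 := (L.mem F).1 h'
    rw [F.kinj h1.2.1 h2.2.1 he.1, F.rinj h1.1 h2.1 he.2]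
  · rintro ⟨p, q⟩ h
    obtain ⟨c, hc, r, hr, rfl, rfl⟩ := L.im _ _ h
    exact ⟨(r, c), (L.link _ hr _ hc).2 h, rfl⟩

theorem Frame.corner (F : Frame m R C κ ρ D) {r c : ℕ} (hr : r < R) (hc : c < C) :
    CornerCell D (r, c) ↔ ρ r = κ c + 1 := by
  unfold CornerCell
  simp only [F.dmem]
  constructor
  · rintro ⟨⟨-, -, h1⟩, h2, h3⟩
    by_contra hne
    have hm := F.rl r hr
    rcases F.cover (κ c + 1) (by omega) with ⟨c', hc', h4⟩ | ⟨r', hr', h4⟩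
    · have h5 : c < c' := F.klt hc (by omega)
      have h6 := F.kle (show c + 1 ≤ c' from h5) hc'
      apply h3
      refine ⟨hr, by omega, by omega⟩
    · have h5 : r < r' := by
        by_contra hh
        have := F.rle (not_lt.1 hh) hr
        omega
      have h6 := F.rle (show r + 1 ≤ r' from h5) hr'
      apply h2
      refine ⟨by omega, hc, by omega⟩
  · intro h
    refine ⟨⟨hr, hc, by omega⟩, ?_, ?_⟩
    · rintro ⟨h1, h2, h3⟩
      have := F.anti r (r + 1) (by omega) h1
      omega
    · rintro ⟨h1, h2, h3⟩
      have := F.mono c (c + 1) (by omega) h2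
      omega

open scoped Classical in
theorem Link.noc (F : Frame m R C κ ρ D) (L : Link R C κ ρ D P P') (h : IsArc m P') :
    (nocCornersOf D P).card = ((Finset.range (m - 1)).filter
      (fun i => Op P' i ∧ Cl P' (i + 1) ∧ (i, i + 1) ∉ P')).card := by
  have hfull := (L.bwd F h).2.2.2.2
  apply Finset.card_bij (fun x _ => κ x.2)
  · rintro ⟨r, c⟩ hx
    simp only [nocCornersOf, Finset.mem_filter] at hx
    obtain ⟨hD, hcor, hnP⟩ := hx
    obtain ⟨hr, hc, -⟩ := (F.dmem _ _).1 hD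
    rw [F.corner hr hc] at hcor
    have := F.rl r hr
    simp only [Finset.mem_filter, Finset.mem_range]
    refine ⟨by omega, (L.op F hc).2 (hfull _ hD).2, ?_, ?_⟩
    · rw [← hcor]; exact (L.cl F hr).2 (hfull _ hD).1
    · rw [← hcor, ← L.link _ hr _ hc]; exact hnP
  · rintro ⟨r, c⟩ hx ⟨r', c'⟩ hx' he
    simp only [nocCornersOf, Finset.mem_filter] at hx hx' he
    obtain ⟨hD, hcor, hnP⟩ := hx
    obtain ⟨hr, hc, -⟩ := (F.dmem _ _).1 hD
    rw [F.corner hr hc] at hcor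
    obtain ⟨hD', hcor', hnP'⟩ := hx'
    obtain ⟨hr', hc', -⟩ := (F.dmem _ _).1 hD'
    rw [F.corner hr' hc'] at hcor'
    rw [F.kinj hc hc' he, F.rinj hr hr' (by omega)]
  · intro i hi
    simp only [Finset.mem_filter, Finset.mem_range] at hi
    obtain ⟨him, ⟨q, ho⟩, ⟨p, hcl⟩, hn⟩ := hi
    obtain ⟨c, hc, _, _, h1, _⟩ := L.im _ _ ho
    obtain ⟨_, _, r, hr, _, h2⟩ := L.im _ _ hcl
    refine ⟨(r, c), ?_, h1⟩
    simp only [nocCornersOf, Finset.mem_filter]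
    refine ⟨(F.dmem _ _).2 ⟨hr, hc, by omega⟩, (F.corner hr hc).2 (by omega), ?_⟩
    rw [L.link _ hr _ hc, h1, h2]
    exact hn

end

section
variable {m R C : ℕ} {κ ρ : ℕ → ℕ} {D P P' : Finset (ℕ × ℕ)}

theorem Frame.k_eq (F : Frame m R C κ ρ D) {c : ℕ} (hc : c < C) :
    κ c = c + ((Finset.range R).filter (fun r => (r, c) ∉ D)).card := by
  classical
  have h1 : Finset.range (κ c) = (Finset.range c).image κ ∪
      ((Finset.range R).filter (fun r => (r, c) ∉ D)).image ρ := by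
    ext x
    simp only [Finset.mem_range, Finset.mem_union, Finset.mem_image, Finset.mem_filter, F.dmem]
    constructor
    · intro hx
      have := F.kl c hc
      rcases F.cover x (by omega) with ⟨c', hc', rfl⟩ | ⟨r, hr, rfl⟩
      · exact Or.inl ⟨c', F.klt hc' hx, rfl⟩
      · exact Or.inr ⟨r, ⟨hr, by omega⟩, rfl⟩
    · rintro (⟨c', h, rfl⟩ | ⟨r, ⟨hr, h⟩, rfl⟩)
      · exact F.mono _ _ h hc
      · have := F.disj c hc r hr
        by_contra hh
        exact h ⟨hr, hc, by omega⟩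
  have h2 := congrArg Finset.card h1
  rw [Finset.card_union_of_disjoint, Finset.card_image_of_injOn, Finset.card_image_of_injOn] at h2
  · simpa using h2
  · intro a ha b hb hab
    simp only [Finset.coe_filter, Finset.mem_range, Set.mem_ofPred_eq] at ha hb
    exact F.rinj ha.1 hb.1 hab
  · intro a ha b hb hab
    simp only [Finset.coe_range, Set.mem_Iio] at ha hb
    exact F.kinj (by omega) (by omega) hab
  · rw [Finset.disjoint_left]
    intro x hx hy
    simp only [Finset.mem_image, Finset.mem_range, Finset.mem_filter] at hx hy
    obtain ⟨a, ha, rfl⟩ := hx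
    obtain ⟨b, hb, hab⟩ := hy
    exact F.disj a (by omega) b hb.1 hab.symm

theorem Frame.r_eq (F : Frame m R C κ ρ D) {r : ℕ} (hr : r < R) :
    m - 1 - ρ r = r + ((Finset.range C).filter (fun c => (r, c) ∉ D)).card := by
  classical
  have hrl := F.rl r hr
  have h1 : Finset.Ioo (ρ r) m = (Finset.range r).image ρ ∪
      ((Finset.range C).filter (fun c => (r, c) ∉ D)).image κ := by
    ext x
    simp only [Finset.mem_range, Finset.mem_union, Finset.mem_image, Finset.mem_filter, F.dmem,
      Finset.mem_Ioo]
    constructor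
    · rintro ⟨hx, hxm⟩
      rcases F.cover x hxm with ⟨c', hc', rfl⟩ | ⟨r', hr', rfl⟩
      · exact Or.inr ⟨c', ⟨hc', by omega⟩, rfl⟩
      · refine Or.inl ⟨r', ?_, rfl⟩
        by_contra hh
        have := F.rle (not_lt.1 hh) hr'
        omega
    · rintro (⟨c', h, rfl⟩ | ⟨c, ⟨hc, h⟩, rfl⟩)
      · exact ⟨F.anti _ _ h hr, F.rl _ (by omega)⟩
      · have := F.disj c hc r hr
        refine ⟨?_, F.kl _ hc⟩
        by_contra hh
        exact h ⟨hr, hc, by omega⟩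
  have h2 := congrArg Finset.card h1
  rw [Finset.card_union_of_disjoint, Finset.card_image_of_injOn, Finset.card_image_of_injOn] at h2
  · simp only [Nat.card_Ioo, Finset.card_range] at h2
    omega
  · intro a ha b hb hab
    simp only [Finset.coe_filter, Finset.mem_range, Set.mem_ofPred_eq] at ha hb
    exact F.kinj ha.1 hb.1 hab
  · intro a ha b hb hab
    simp only [Finset.coe_range, Set.mem_Iio] at ha hb
    exact F.rinj (by omega) (by omega) hab
  · rw [Finset.disjoint_left]
    intro x hx hy
    simp only [Finset.mem_image, Finset.mem_range, Finset.mem_filter] at hx hy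
    obtain ⟨a, ha, rfl⟩ := hx
    obtain ⟨b, hb, hab⟩ := hy
    exact F.disj b hb.1 a (by omega) hab

open scoped Classical in
theorem Link.k_cnt (F : Frame m R C κ ρ D) (L : Link R C κ ρ D P P') (h : IsArc m P') {c : ℕ}
    (hc : c < C) : ((Finset.range (κ c)).filter (fun x => Op P' x)).card = c := by
  have hfull := (L.bwd F h).2.2.2.2
  have h1 : (Finset.range (κ c)).filter (fun x => Op P' x) = (Finset.range c).image κ := by
    ext x
    simp only [Finset.mem_range, Finset.mem_image, Finset.mem_filter]
    constructor
    · rintro ⟨hx, q, hq⟩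
      obtain ⟨c', hc', _, _, rfl, _⟩ := L.im _ _ hq
      exact ⟨c', F.klt hc' hx, rfl⟩
    · rintro ⟨c', h, rfl⟩
      exact ⟨F.mono _ _ h hc, (L.op F (by omega)).2 (hfull _ (F.row0 (by omega))).2⟩
  rw [h1, Finset.card_image_of_injOn, Finset.card_range]
  intro a ha b hb hab
  simp only [Finset.coe_range, Set.mem_Iio] at ha hb
  exact F.kinj (by omega) (by omega) hab

open scoped Classical in
theorem Link.r_cnt (F : Frame m R C κ ρ D) (L : Link R C κ ρ D P P') (h : IsArc m P') {r : ℕ}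
    (hr : r < R) : ((Finset.Ioo (ρ r) m).filter (fun x => Cl P' x)).card = r := by
  have hfull := (L.bwd F h).2.2.2.2
  have h1 : (Finset.Ioo (ρ r) m).filter (fun x => Cl P' x) = (Finset.range r).image ρ := by
    ext x
    simp only [Finset.mem_range, Finset.mem_image, Finset.mem_filter, Finset.mem_Ioo]
    constructor
    · rintro ⟨⟨hx, hxm⟩, q, hq⟩
      obtain ⟨_, _, r', hr', _, rfl⟩ := L.im _ _ hq
      refine ⟨r', ?_, rfl⟩
      by_contra hh
      have := F.rle (not_lt.1 hh) hr'
      omega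
    · rintro ⟨c', h, rfl⟩
      exact ⟨⟨F.anti _ _ h hr, F.rl _ (by omega)⟩,
        (L.cl F (by omega)).2 (hfull _ (F.col0 (by omega))).1⟩
  rw [h1, Finset.card_image_of_injOn, Finset.card_range]
  intro a ha b hb hab
  simp only [Finset.coe_range, Set.mem_Iio] at ha hb
  exact F.rinj (by omega) (by omega) hab

end

def TabRel (m : ℕ) (D P P' : Finset (ℕ × ℕ)) : Prop :=
  ∃ (R C : ℕ) (κ ρ : ℕ → ℕ), Frame m R C κ ρ D ∧ Link R C κ ρ D P P'

theorem TabRel.unique {m : ℕ} {D P P₁ P₂ : Finset (ℕ × ℕ)} (h1 : TabRel m D P P₁) (h2 : TabRel m D P P₂) :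
    P₁ ⊆ P₂ := by
  obtain ⟨R, C, κ, ρ, F, L⟩ := h1
  obtain ⟨R', C', κ', ρ', F', L'⟩ := h2
  have hR : ∀ r, r < R ↔ r < R' := fun r =>
    ⟨fun h => ((F'.dmem _ _).1 (F.col0 h)).1, fun h => ((F.dmem _ _).1 (F'.col0 h)).1⟩
  have hC : ∀ r, r < C ↔ r < C' := fun r =>
    ⟨fun h => ((F'.dmem _ _).1 (F.row0 h)).2.1, fun h => ((F.dmem _ _).1 (F'.row0 h)).2.1⟩
  have eR : R = R' := by have := hR R; have := hR R'; omega
  have eC : C = C' := by have := hC C; have := hC C'; omega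
  subst eR eC
  rintro ⟨p, q⟩ h
  obtain ⟨c, hc, r, hr, rfl, rfl⟩ := L.im _ _ h
  have h3 := (L'.link _ hr _ hc).1 ((L.link _ hr _ hc).2 h)
  have e1 : κ c = κ' c := by rw [F.k_eq hc, F'.k_eq hc]
  have e2 : ρ r = ρ' r := by
    have a := F.r_eq hr
    have b := F'.r_eq hr
    have := F.rl r hr
    have := F'.rl r hr
    omega
  rwa [e1, e2]

theorem TabRel.unique' {m : ℕ} {D₁ D₂ P₁ P₂ P' : Finset (ℕ × ℕ)} (h1 : TabRel m D₁ P₁ P')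
    (h2 : TabRel m D₂ P₂ P') (h : IsArc m P') : D₁ ⊆ D₂ ∧ P₁ ⊆ P₂ := by
  classical
  obtain ⟨R, C, κ, ρ, F, L⟩ := h1
  obtain ⟨R', C', κ', ρ', F', L'⟩ := h2
  have hfull := (L.bwd F h).2.2.2.2
  have hk : ∀ c < C, c < C' ∧ κ' c = κ c := by
    intro c hc
    obtain ⟨q, hq⟩ := (L.op F hc).2 (hfull _ (F.row0 hc)).2
    obtain ⟨c', hc', _, _, e, _⟩ := L'.im _ _ hq
    have a := L.k_cnt F h hc
    have b := L'.k_cnt F' h hc'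
    rw [e, a] at b
    subst b
    exact ⟨hc', e⟩
  have hr : ∀ r < R, r < R' ∧ ρ' r = ρ r := by
    intro c hc
    obtain ⟨q, hq⟩ := (L.cl F hc).2 (hfull _ (F.col0 hc)).1
    obtain ⟨_, _, c', hc', _, e⟩ := L'.im _ _ hq
    have a := L.r_cnt F h hc
    have b := L'.r_cnt F' h hc'
    rw [e, a] at b
    subst b
    exact ⟨hc', e⟩
  constructor
  · rintro ⟨r, c⟩ hD
    rw [F.dmem] at hD
    rw [F'.dmem, (hk _ hD.2.1).2, (hr _ hD.1).2]
    exact ⟨(hr _ hD.1).1, (hk _ hD.2.1).1, hD.2.2⟩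
  · rintro ⟨r, c⟩ hD
    rw [L.mem F] at hD
    rw [L'.mem F', (hk _ hD.2.1).2, (hr _ hD.1).2]
    exact ⟨(hr _ hD.1).1, (hk _ hD.2.1).1, hD.2.2⟩

theorem enum_exists (S : Finset ℕ) (h0 : 0 ∈ S) : ∃ (C : ℕ) (κ : ℕ → ℕ), 0 < C ∧ κ 0 = 0 ∧
    (∀ c c', c < c' → c' < C → κ c < κ c') ∧ (∀ c < C, κ c ∈ S) ∧ ∀ x ∈ S, ∃ c < C, κ c = x := by
  have hf : (Set.ofPred (fun x => x ∈ S)).Finite := S.finite_toSet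
  refine ⟨hf.toFinset.card, Nat.nth (fun x => x ∈ S), ?_, Nat.nth_zero_of_zero h0, ?_, ?_, ?_⟩
  · exact Finset.card_pos.2 ⟨0, by simpa using h0⟩
  · intro c c' h h'
    exact Nat.nth_lt_nth_of_lt_card hf h h'
  · intro c hc
    exact Nat.nth_mem_of_lt_card hf hc
  · intro x hx
    exact Nat.exists_lt_card_finite_nth_eq hf hx

theorem exists_rel_of_arc {m : ℕ} {P' : Finset (ℕ × ℕ)} (h : IsArc m P') :
    ∃ D P, TabRel m D P P' := by
  classical
  have hroot := h.lt _ _ h.root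
  obtain ⟨C, κ, Cpos, kz, mono, kS, kI⟩ := enum_exists ((Finset.range m).filter (fun x => Op P' x))
    (by simp only [Finset.mem_filter, Finset.mem_range]; exact ⟨by omega, _, h.root⟩)
  obtain ⟨R, κ', Rpos, kz', mono', kS', kI'⟩ :=
    enum_exists ((Finset.range m).filter (fun x => Cl P' (m - 1 - x)))
    (by simp only [Finset.mem_filter, Finset.mem_range]; exact ⟨by omega, _, h.root⟩)
  simp only [Finset.mem_filter, Finset.mem_range] at kS kI kS' kI'
  set ρ := fun r => m - 1 - κ' r with hρ
  set D := (Finset.range R ×ˢ Finset.range C).filter (fun x => κ x.2 < ρ x.1) with hD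
  have dmem : ∀ r c, (r, c) ∈ D ↔ r < R ∧ c < C ∧ κ c < ρ r := by
    intro r c
    simp only [hD, Finset.mem_filter, Finset.mem_product, Finset.mem_range]
    tauto
  have hcr : ∀ x, x < m → Cl P' x → ∃ r < R, ρ r = x := by
    intro x hx hc
    obtain ⟨r, hr, e⟩ := kI' (m - 1 - x) ⟨by omega, by
      rwa [show m - 1 - (m - 1 - x) = x by omega]⟩
    exact ⟨r, hr, by simp only [hρ]; omega⟩
  refine ⟨D, D.filter (fun x => (κ x.2, ρ x.1) ∈ P'), R, C, κ, ρ, ?_, ?_⟩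
  · refine ⟨Rpos, Cpos, mono, ?_, kz, ?_, ?_, fun c hc => (kS c hc).1, ?_, ?_, dmem⟩
    · intro r r' h1 h2
      have a := mono' _ _ h1 h2
      have b := (kS' _ h2).1
      simp only [hρ]
      omega
    · simp only [hρ, kz']; omega
    · intro x hx
      by_cases ho : Op P' x
      · exact Or.inl (kI x ⟨hx, ho⟩)
      · right
        rw [h.typ x hx, not_not] at ho
        exact hcr x hx ho
    · intro r hr
      simp only [hρ]
      omega
    · intro c hc r hr he
      have a := kS c hc
      have b := (kS' r hr).2
      have : Cl P' (κ c) := by rw [he]; exact b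
      exact (h.typ _ a.1).1 a.2 this
  · refine ⟨Finset.filter_subset _ _, ?_, ?_⟩
    · intro r hr c hc
      simp only [Finset.mem_filter, dmem]
      constructor
      · exact fun h => h.2
      · exact fun h1 => ⟨⟨hr, hc, (h.lt _ _ h1).1⟩, h1⟩
    · intro p q hpq
      have hlt := h.lt _ _ hpq
      obtain ⟨c, hc, e⟩ := kI p ⟨by omega, _, hpq⟩
      obtain ⟨r, hr, e'⟩ := hcr q hlt.2 ⟨_, hpq⟩
      exact ⟨c, hc, r, hr, e, e'⟩

theorem exists_rel_of_tlt {D P : Finset (ℕ × ℕ)} (h : IsTLT D P) :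
    ∃ m P', TabRel m D P P' := by
  classical
  have hY := h.1
  have h00 : (0, 0) ∈ D := h.2.1 h.2.2.1
  let μ : YoungDiagram := ⟨D, by
    rintro ⟨a, b⟩ ⟨a', b'⟩ hle hm
    rw [Prod.mk_le_mk] at hle
    exact hY _ _ _ _ hm hle.1 hle.2⟩
  have hc : ∀ r c, (r, c) ∈ D ↔ r < μ.colLen c := fun r c => YoungDiagram.mem_iff_lt_colLen (μ := μ)
  have hr : ∀ r c, (r, c) ∈ D ↔ c < μ.rowLen r := fun r c => YoungDiagram.mem_iff_lt_rowLen (μ := μ)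
  have ca := μ.colLen_anti
  have ra := μ.rowLen_anti
  have hcr : ∀ r c, r < μ.colLen c ↔ c < μ.rowLen r := fun r c => (hc r c).symm.trans (hr r c)
  generalize hcl : μ.colLen = cl at *
  generalize hrl : μ.rowLen = rl at *
  have Rpos : 0 < cl 0 := (hc _ _).1 h00
  have Cpos : 0 < rl 0 := (hr _ _).1 h00
  set κ : ℕ → ℕ := fun c => c + (cl 0 - cl c) with hκ
  set ρ : ℕ → ℕ := fun r => (cl 0 - 1 - r) + rl r with hρ
  have kd : ∀ r < cl 0, ∀ c < rl 0, (r < cl c → κ c < ρ r) ∧ (¬ r < cl c → ρ r < κ c) := by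
    intro r hr c hc
    have h1 := hcr r c
    have h2 := ca 0 c (by omega)
    simp only [hκ, hρ]
    constructor <;> intro h3 <;> omega
  have dmem : ∀ r c, (r, c) ∈ D ↔ r < cl 0 ∧ c < rl 0 ∧ κ c < ρ r := by
    intro r c
    rw [hc]
    constructor
    · intro h1
      have h2 := ca 0 c (by omega)
      have h3 := ra 0 r (by omega)
      have h4 := (hcr r c).1 h1
      exact ⟨by omega, by omega, (kd r (by omega) c (by omega)).1 h1⟩
    · rintro ⟨h1, h2, h3⟩
      by_contra hh
      have := (kd r h1 c h2).2 hh
      omega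
  have mono : ∀ c c', c < c' → c' < rl 0 → κ c < κ c' := by
    intro c c' h1 h2
    have := ca c c' h1.le
    simp only [hκ]; omega
  have anti : ∀ r r', r < r' → r' < cl 0 → ρ r' < ρ r := by
    intro c c' h1 h2
    have := ra c c' h1.le
    simp only [hρ]; omega
  have kl : ∀ c < rl 0, κ c < cl 0 + rl 0 := by
    intro c hc; simp only [hκ]; omega
  have rll : ∀ r < cl 0, ρ r < cl 0 + rl 0 := by
    intro r hr
    have := ra 0 r (by omega)
    simp only [hρ]; omega
  have disj : ∀ c < rl 0, ∀ r < cl 0, κ c ≠ ρ r := by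
    intro c hc r hr
    have := kd r hr c hc
    by_cases h : r < cl c
    · have := this.1 h; omega
    · have := this.2 h; omega
  have kinj : Set.InjOn κ (Finset.range (rl 0)) := by
    intro a ha b hb hab
    simp only [Finset.coe_range, Set.mem_Iio] at ha hb
    rcases lt_trichotomy a b with h1 | h1 | h1
    · have := mono _ _ h1 hb; omega
    · exact h1
    · have := mono _ _ h1 ha; omega
  have rinj : Set.InjOn ρ (Finset.range (cl 0)) := by
    intro a ha b hb hab
    simp only [Finset.coe_range, Set.mem_Iio] at ha hb
    rcases lt_trichotomy a b with h1 | h1 | h1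
    · have := anti _ _ h1 hb; omega
    · exact h1
    · have := anti _ _ h1 ha; omega
  have hcov : (Finset.range (rl 0)).image κ ∪ (Finset.range (cl 0)).image ρ =
      Finset.range (cl 0 + rl 0) := by
    apply Finset.eq_of_subset_of_card_le
    · intro x hx
      simp only [Finset.mem_union, Finset.mem_image, Finset.mem_range] at hx ⊢
      rcases hx with ⟨c, hc, rfl⟩ | ⟨r, hr, rfl⟩
      · exact kl c hc
      · exact rll r hr
    · rw [Finset.card_union_of_disjoint, Finset.card_image_of_injOn kinj,
        Finset.card_image_of_injOn rinj]
      · simp only [Finset.card_range]; omega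
      · rw [Finset.disjoint_left]
        intro x hx hy
        simp only [Finset.mem_image, Finset.mem_range] at hx hy
        obtain ⟨a, ha, rfl⟩ := hx
        obtain ⟨b, hb, hab⟩ := hy
        exact disj a ha b hb hab.symm
  have inD : ∀ {r c}, (r, c) ∈ P → r < cl 0 ∧ c < rl 0 := by
    intro r c hp
    have := (dmem _ _).1 (h.2.1 hp)
    exact ⟨this.1, this.2.1⟩
  refine ⟨cl 0 + rl 0, P.image (fun x => (κ x.2, ρ x.1)), cl 0, rl 0, κ, ρ, ?_, ?_⟩
  · refine ⟨Rpos, Cpos, mono, anti, ?_, ?_, ?_, kl, rll, disj, dmem⟩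
    · simp [hκ]
    · simp only [hρ]; omega
    · intro x hx
      rw [← Finset.mem_range, ← hcov] at hx
      simpa only [Finset.mem_union, Finset.mem_image, Finset.mem_range] using hx
  · refine ⟨h.2.1, ?_, ?_⟩
    · intro r hr c hc
      simp only [Finset.mem_image, Prod.mk.injEq, Prod.exists]
      constructor
      · intro hp
        exact ⟨r, c, hp, rfl, rfl⟩
      · rintro ⟨r', c', hp, e1, e2⟩
        have hin := inD hp
        have e3 : c' = c := kinj (by simpa using hin.2) (by simpa using hc) e1
        have e4 : r' = r := rinj (by simpa using hin.1) (by simpa using hr) e2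
        rwa [← e3, ← e4]
    · intro p q hpq
      simp only [Finset.mem_image, Prod.mk.injEq, Prod.exists] at hpq
      obtain ⟨r', c', hp, e1, e2⟩ := hpq
      have hin := inD hp
      exact ⟨c', hin.2, r', hin.1, e1, e2⟩

theorem rel_of_mem_TLTs {n : ℕ} {T : Finset (ℕ × ℕ) × Finset (ℕ × ℕ)} (hT : T ∈ TLTs n) :
    ∃ P', TabRel (n + 1) T.1 T.2 P' ∧ IsArc (n + 1) P' := by
  classical
  simp only [TLTs, Finset.mem_filter] at hT
  obtain ⟨-, hT, hcard⟩ := hT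
  obtain ⟨m, P', hrel⟩ := exists_rel_of_tlt hT
  obtain ⟨R, C, κ, ρ, F, L⟩ := id hrel
  have ha := L.fwd F hT
  have h1 := ha.card_add_one
  rw [← L.card F, hcard] at h1
  subst h1
  exact ⟨P', hrel, ha⟩

theorem mem_TLTs_of_rel {n : ℕ} {D P P' : Finset (ℕ × ℕ)} (h : TabRel (n + 1) D P P')
    (ha : IsArc (n + 1) P') : (D, P) ∈ TLTs n := by
  classical
  obtain ⟨R, C, κ, ρ, F, L⟩ := h
  have hT := L.bwd F ha
  have hD : D ⊆ Finset.range (n + 1) ×ˢ Finset.range (n + 1) := by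
    rintro ⟨r, c⟩ hD
    rw [F.dmem] at hD
    have a := F.k_eq hD.2.1
    have b := F.r_eq hD.1
    have := F.kl _ hD.2.1
    simp only [Finset.mem_product, Finset.mem_range]
    omega
  have h1 := ha.card_add_one
  rw [← L.card F] at h1
  simp only [TLTs, Finset.mem_filter, Finset.mem_product, Finset.mem_powerset]
  exact ⟨⟨hD, L.pd.trans hD⟩, hT, by omega⟩

theorem sum_noc (n : ℕ) : ∑ T ∈ TLTs n, (nocCornersOf T.1 T.2).card =
    ∑ i ∈ Finset.range n, cnt (n + 1) (fun P => Cl P i ∧ Op P (i + 1)) := by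
  classical
  have h1 : ∑ T ∈ TLTs n, (nocCornersOf T.1 T.2).card = ∑ P' ∈ Arcs (n + 1),
      ((Finset.range n).filter (fun i => Op P' i ∧ Cl P' (i + 1) ∧ (i, i + 1) ∉ P')).card := by
    refine Finset.sum_bij (fun T hT => (rel_of_mem_TLTs hT).choose) ?_ ?_ ?_ ?_
    · intro T hT
      exact mem_Arcs.2 (rel_of_mem_TLTs hT).choose_spec.2
    · intro T hT T' hT' he
      obtain ⟨r1, a1⟩ := (rel_of_mem_TLTs hT).choose_spec
      obtain ⟨r2, a2⟩ := (rel_of_mem_TLTs hT').choose_spec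
      rw [← he] at r2
      have u := r1.unique' r2 a1
      have v := r2.unique' r1 a1
      exact Prod.ext (u.1.antisymm v.1) (u.2.antisymm v.2)
    · intro P' hP'
      rw [mem_Arcs] at hP'
      obtain ⟨D, P, hrel⟩ := exists_rel_of_arc hP'
      have hT := mem_TLTs_of_rel hrel hP'
      obtain ⟨r1, a1⟩ := (rel_of_mem_TLTs hT).choose_spec
      exact ⟨(D, P), hT, (r1.unique hrel).antisymm (hrel.unique r1)⟩
    · intro T hT
      obtain ⟨⟨R, C, κ, ρ, F, L⟩, a1⟩ := (rel_of_mem_TLTs hT).choose_spec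
      convert L.noc F a1
      omega
  rw [h1]
  simp only [Finset.card_filter]
  rw [Finset.sum_comm]
  apply Finset.sum_congr rfl
  intro i hi
  rw [Finset.mem_range] at hi
  rw [← cnt_swap' (n + 1) i (by omega), cnt, Finset.card_filter]
  congr!

open scoped Classical in
theorem stmt4 (n : ℕ) :
    (3 ≤ n → 6 * ∑ T ∈ TLTs n, (nocCornersOf T.1 T.2).card = n.factorial * (n - 2)) ∧
    (n = 1 ∨ n = 2 → ∑ T ∈ TLTs n, (nocCornersOf T.1 T.2).card = 0) := by
  rw [sum_noc]
  exact ⟨sum_cnt n, sum_cnt_small n⟩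
end

section
/- For n ≥ 2 and 1 ≤ i ≤ n-1, the number of signed permutations σ of [n] such that i is a signed ascent and i+1 is a signed descent equals 2^{n-2}·[(n-1)! + (n-i)(n-1)! + (i-1)(n-2)! + (n-i)(n-2)! + (n-i)(i-1)(n-2)!]. -/
open Finset

/-- The word `σ₁ … σₙ` of a signed permutation, encoded as an (unsigned) permutation
together with a choice of signs; positions `0,…,n-1` give the values `σ₁,…,σₙ`,
and position `n` carries the conventional value `n+1`. -/
def sval (n : ℕ) (σ : Equiv.Perm (Fin n) × (Fin n → Bool)) (t : ℕ) : ℤ :=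
  if h : t < n then
    (if σ.2 ⟨t, h⟩ then -(((σ.1 ⟨t, h⟩ : ℕ) : ℤ) + 1) else ((σ.1 ⟨t, h⟩ : ℕ) : ℤ) + 1)
  else (n : ℤ) + 1

/-- The entry at position `t` is a signed descent. -/
def SDescAt (n : ℕ) (σ : Equiv.Perm (Fin n) × (Fin n → Bool)) (t : ℕ) : Prop :=
  sval n σ t < 0 ∨ sval n σ t > |sval n σ (t + 1)|

/-- The value `i ∈ [n]` is a signed ascent: the entry whose absolute value is `i`
is a signed ascent. -/
def IsSignedAscent (n : ℕ) (σ : Equiv.Perm (Fin n) × (Fin n → Bool)) (i : ℕ) : Prop :=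
  ∃ t < n, |sval n σ t| = (i : ℤ) ∧ ¬ SDescAt n σ t

/-- The value `i ∈ [n]` is a signed descent: the entry whose absolute value is `i`
is a signed descent. -/
def IsSignedDescent (n : ℕ) (σ : Equiv.Perm (Fin n) × (Fin n → Bool)) (i : ℕ) : Prop :=
  ∃ t < n, |sval n σ t| = (i : ℤ) ∧ SDescAt n σ t


/-- value `w` immediately follows value `v`. -/
def Fol {m : ℕ} (π : Equiv.Perm (Fin (m+2))) (v w : Fin (m+2)) : Prop :=
  ∃ t : Fin (m+1), π t.castSucc = v ∧ π t.succ = w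

def AscP {m : ℕ} (π : Equiv.Perm (Fin (m+2))) (a : Fin (m+2)) : Prop :=
  π (Fin.last (m+1)) = a ∨ ∃ w, a < w ∧ Fol π a w

def DesP {m : ℕ} (π : Equiv.Perm (Fin (m+2))) (b : Fin (m+2)) : Prop :=
  ∃ v, v < b ∧ Fol π b v

open scoped Classical in
theorem card_presc {n k : ℕ} (f g : Fin k → Fin n) (hf : Function.Injective f)
    (hg : Function.Injective g) :
    (univ.filter (fun π : Equiv.Perm (Fin n) => ∀ j, π (f j) = g j)).card = (n - k).factorial := by
  let e₀ : Set.range f ≃ Set.range g :=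
    (Equiv.ofInjective f hf).symm.trans (Equiv.ofInjective g hg)
  have h := Fintype.card_congr (Equiv.Set.compl e₀)
  have hc : ∀ h : Fin k → Fin n, Function.Injective h →
      Fintype.card ((Set.range h)ᶜ : Set (Fin n)) = n - k := by
    intro h hh
    rw [Fintype.card_compl_set, Set.card_range_of_injective hh]; simp
  have h2 : Fintype.card (((Set.range f)ᶜ : Set (Fin n)) ≃ ((Set.range g)ᶜ : Set (Fin n)))
      = (n - k).factorial := by
    rw [Fintype.card_equiv (Fintype.equivOfCardEq ((hc f hf).trans (hc g hg).symm)), hc f hf]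
  rw [← h2, ← h, Fintype.card_subtype]
  congr 1
  ext π
  simp only [mem_filter, mem_univ, true_and]
  constructor
  · rintro H ⟨_, j, rfl⟩
    simp [e₀, H]
  · intro H j
    have := H ⟨f j, j, rfl⟩
    simpa [e₀] using this

open scoped Classical in
theorem card_ex {α T : Type*} [Fintype α] [Fintype T] (P : T → α → Prop) (c : ℕ)
    [DecidablePred (fun x => ∃ t, P t x)] [∀ t, DecidablePred (P t)]
    (hc : ∀ t, (univ.filter (P t)).card = c) (hd : ∀ t t' x, P t x → P t' x → t = t') :
    (univ.filter (fun x => ∃ t, P t x)).card = Fintype.card T * c := by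
  have : (univ.filter (fun x => ∃ t, P t x)) = univ.biUnion (fun t => univ.filter (P t)) := by
    ext x; simp
  rw [this, card_biUnion]
  · simp [hc]
  · intro t _ t' _ hne
    rw [Function.onFun, disjoint_left]
    intro x hx hx'
    simp only [mem_filter, mem_univ, true_and] at hx hx'
    exact hne (hd _ _ _ hx hx')

section counts
variable {m : ℕ}
open scoped Classical

theorem card1 (p a : Fin (m+2)) :
    (univ.filter (fun π : Equiv.Perm (Fin (m+2)) => π p = a)).card = (m+1).factorial := by
  have := card_presc ![p] ![a] (Function.injective_of_subsingleton _)
    (Function.injective_of_subsingleton _)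
  simpa using this

theorem inj2 {α : Type*} {p q : α} (h : p ≠ q) : Function.Injective ![p, q] := by
  intro x y; fin_cases x <;> fin_cases y <;> simp [h, h.symm]

theorem inj3 {α : Type*} {p q r : α} (h : p ≠ q) (h2 : p ≠ r) (h3 : q ≠ r) :
    Function.Injective ![p, q, r] := by
  intro x y; fin_cases x <;> fin_cases y <;> simp [h, h.symm, h2, h2.symm, h3, h3.symm]

theorem inj4 {α : Type*} {p q r s : α} (h : p ≠ q) (h2 : p ≠ r) (h3 : q ≠ r)
    (h4 : p ≠ s) (h5 : q ≠ s) (h6 : r ≠ s) :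
    Function.Injective ![p, q, r, s] := by
  intro x y; fin_cases x <;> fin_cases y <;>
    simp [h, h.symm, h2, h2.symm, h3, h3.symm, h4, h4.symm, h5, h5.symm, h6, h6.symm]

theorem card2 {p q a b : Fin (m+2)} (h : p ≠ q) (h' : a ≠ b) :
    (univ.filter (fun π : Equiv.Perm (Fin (m+2)) => π p = a ∧ π q = b)).card = m.factorial := by
  have := card_presc ![p, q] ![a, b] (inj2 h) (inj2 h')
  simpa [Fin.forall_fin_succ] using this

theorem card3 {p q r a b c : Fin (m+2)} (h : p ≠ q) (h2 : p ≠ r) (h3 : q ≠ r)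
    (g : a ≠ b) (g2 : a ≠ c) (g3 : b ≠ c) :
    (univ.filter (fun π : Equiv.Perm (Fin (m+2)) => π p = a ∧ π q = b ∧ π r = c)).card
      = (m-1).factorial := by
  have := card_presc ![p, q, r] ![a, b, c] (inj3 h h2 h3) (inj3 g g2 g3)
  simpa [Fin.forall_fin_succ] using this

theorem card4 {p q r s a b c d : Fin (m+2)} (h : p ≠ q) (h2 : p ≠ r) (h3 : q ≠ r)
    (h4 : p ≠ s) (h5 : q ≠ s) (h6 : r ≠ s)
    (g : a ≠ b) (g2 : a ≠ c) (g3 : b ≠ c) (g4 : a ≠ d) (g5 : b ≠ d) (g6 : c ≠ d) :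
    (univ.filter (fun π : Equiv.Perm (Fin (m+2)) => π p = a ∧ π q = b ∧ π r = c ∧ π s = d)).card
      = (m-2).factorial := by
  have := card_presc ![p, q, r, s] ![a, b, c, d] (inj4 h h2 h3 h4 h5 h6) (inj4 g g2 g3 g4 g5 g6)
  simpa [Fin.forall_fin_succ] using this

theorem cs_ne (t : Fin (m+1)) : t.castSucc ≠ t.succ := by
  simp [Fin.ext_iff]

theorem card_fol {a b : Fin (m+2)} (h : a ≠ b) :
    (univ.filter (fun π : Equiv.Perm (Fin (m+2)) => Fol π a b)).card = (m+1).factorial := by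
  have := card_ex (fun (t : Fin (m+1)) (π : Equiv.Perm (Fin (m+2))) =>
    π t.castSucc = a ∧ π t.succ = b) m.factorial ?_ ?_
  · rw [Fintype.card_fin, ← Nat.factorial_succ] at this
    rw [← this]
    congr 1; ext π; simp only [mem_filter, mem_univ, true_and]; rfl
  · intro t
    convert card2 (cs_ne t) h
  · rintro t t' π ⟨h1, _⟩ ⟨h2, _⟩
    exact Fin.castSucc_injective _ (π.injective (h1.trans h2.symm))

theorem card_fol_last {a b : Fin (m+2)} (h : b ≠ a) :
    (univ.filter (fun π : Equiv.Perm (Fin (m+2)) => π (Fin.last (m+1)) = a ∧ Fol π b a)).card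
      = m.factorial := by
  rw [← card2 (cs_ne (Fin.last m)) h]
  congr 1; ext π
  simp only [mem_filter, mem_univ, true_and]; simp only [Fol]
  constructor
  · rintro ⟨h1, t, h2, h3⟩
    have := π.injective (h3.trans h1.symm)
    have : t = Fin.last m := by
      apply Fin.succ_injective; rw [this]; rfl
    subst this; exact ⟨h2, h3⟩
  · rintro ⟨h1, h2⟩
    exact ⟨h2, _, h1, h2⟩

theorem mfac (h : 1 ≤ m) : m * (m-1).factorial = m.factorial := Nat.mul_factorial_pred (by omega)

theorem pos_of_three {a b c : Fin (m+2)} (h : a ≠ b) (h2 : a ≠ c) (h3 : b ≠ c) : 1 ≤ m := by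
  simp only [ne_eq, Fin.ext_iff] at *; omega

theorem card_fol_last' {a b v : Fin (m+2)} (h : b ≠ a) (h2 : a ≠ v) (h3 : b ≠ v) :
    (univ.filter (fun π : Equiv.Perm (Fin (m+2)) => π (Fin.last (m+1)) = a ∧ Fol π b v)).card
      = m.factorial := by
  have hm := pos_of_three h h3 h2
  rw [← mfac hm]
  trans (univ.filter (fun π : Equiv.Perm (Fin (m+2)) => ∃ t : Fin m,
    π (Fin.last (m+1)) = a ∧ π t.castSucc.castSucc = b ∧ π t.castSucc.succ = v)).card
  · congr 1; ext π
    simp only [mem_filter, mem_univ, true_and]; simp only [Fol]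
    constructor
    · rintro ⟨h1, t, h4, h5⟩
      rcases Fin.eq_castSucc_or_eq_last t with ⟨t, rfl⟩ | rfl
      · exact ⟨t, h1, h4, h5⟩
      · exact absurd (h1.symm.trans h5) h2
    · rintro ⟨t, h1, h4, h5⟩
      exact ⟨h1, _, h4, h5⟩
  · rw [card_ex _ (m-1).factorial]
    · simp
    · intro t
      apply card3 _ _ _ h.symm h2 h3 <;> simp [Fin.ext_iff] <;> omega
    · rintro t t' π ⟨_, h1, _⟩ ⟨_, h2, _⟩
      exact Fin.castSucc_injective _ (Fin.castSucc_injective _ (π.injective (h1.trans h2.symm)))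

theorem card_fol_fol {a b c : Fin (m+2)} (h : a ≠ b) (h2 : a ≠ c) (h3 : b ≠ c) :
    (univ.filter (fun π : Equiv.Perm (Fin (m+2)) => Fol π a b ∧ Fol π b c)).card
      = m.factorial := by
  have hm := pos_of_three h h2 h3
  rw [← mfac hm]
  trans (univ.filter (fun π : Equiv.Perm (Fin (m+2)) => ∃ t : Fin m,
    π t.castSucc.castSucc = a ∧ π t.castSucc.succ = b ∧ π t.succ.succ = c)).card
  · congr 1; ext π
    simp only [mem_filter, mem_univ, true_and]; simp only [Fol]
    constructor
    · rintro ⟨⟨t, h4, h5⟩, u, h6, h7⟩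
      have := π.injective (h5.trans h6.symm)
      rcases Fin.eq_castSucc_or_eq_last t with ⟨t, rfl⟩ | rfl
      · have h8 : u = t.succ := by
          apply Fin.castSucc_injective; rw [← this]; rfl
        subst h8
        exact ⟨t, h4, h5, h7⟩
      · simp [Fin.ext_iff] at this; omega
    · rintro ⟨t, h4, h5, h6⟩
      exact ⟨⟨_, h4, h5⟩, t.succ, h5, h6⟩
  · rw [card_ex _ (m-1).factorial]
    · simp
    · intro t
      apply card3 _ _ _ h h2 h3 <;> simp [Fin.ext_iff] <;> omega
    · rintro t t' π ⟨h1, _⟩ ⟨h2, _⟩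
      exact Fin.castSucc_injective _ (Fin.castSucc_injective _ (π.injective (h1.trans h2.symm)))

theorem card_pairs :
    Fintype.card {x : Fin (m+1) × Fin (m+1) // x.1 ≠ x.2 ∧ x.1.succ ≠ x.2.castSucc ∧
      x.1.castSucc ≠ x.2.succ} = m * (m-1) := by
  rw [Fintype.card_subtype]
  have hA : (univ.filter (fun x : Fin (m+1) × Fin (m+1) => x.1 = x.2)).card = m + 1 := by
    trans (univ.image (fun t : Fin (m+1) => (t, t))).card
    · congr 1; ext ⟨x, y⟩; simp
    · rw [card_image_of_injective]
      · simp
      · intro x y h; simpa using h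
  have hB : (univ.filter (fun x : Fin (m+1) × Fin (m+1) => x.1.succ = x.2.castSucc)).card = m := by
    trans (univ.image (fun t : Fin m => (t.castSucc, t.succ))).card
    · congr 1; ext ⟨x, y⟩
      simp only [mem_filter, mem_univ, true_and, mem_image, Prod.mk.injEq, Fin.ext_iff]
      constructor
      · intro h
        simp at h
        exact ⟨⟨x, by omega⟩, by simp, by simpa using h⟩
      · rintro ⟨t, h1, h2⟩; simp at *; omega
    · rw [card_image_of_injective]
      · simp
      · intro x y h; simpa using h
  have hC : (univ.filter (fun x : Fin (m+1) × Fin (m+1) => x.1.castSucc = x.2.succ)).card = m := by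
    trans (univ.image (fun t : Fin m => (t.succ, t.castSucc))).card
    · congr 1; ext ⟨x, y⟩
      simp only [mem_filter, mem_univ, true_and, mem_image, Prod.mk.injEq, Fin.ext_iff]
      constructor
      · intro h
        simp at h
        exact ⟨⟨y, by omega⟩, by simpa using h.symm, by simp⟩
      · rintro ⟨t, h1, h2⟩; simp at *; omega
    · rw [card_image_of_injective]
      · simp
      · intro x y h; simpa using h
  have h1 := card_filter_add_card_filter_not (s := (univ : Finset (Fin (m+1) × Fin (m+1))))
    (fun x => x.1 ≠ x.2 ∧ x.1.succ ≠ x.2.castSucc ∧ x.1.castSucc ≠ x.2.succ)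
  have h2 : (univ.filter (fun x : Fin (m+1) × Fin (m+1) => ¬ (x.1 ≠ x.2 ∧
      x.1.succ ≠ x.2.castSucc ∧ x.1.castSucc ≠ x.2.succ))) =
      (univ.filter (fun x : Fin (m+1) × Fin (m+1) => x.1 = x.2)) ∪
      ((univ.filter (fun x : Fin (m+1) × Fin (m+1) => x.1.succ = x.2.castSucc)) ∪
       (univ.filter (fun x : Fin (m+1) × Fin (m+1) => x.1.castSucc = x.2.succ))) := by
    ext x; simp only [mem_filter, mem_univ, true_and, mem_union]; tauto
  rw [h2, card_union_of_disjoint, card_union_of_disjoint, hA, hB, hC] at h1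
  · simp at h1
    rcases m with _ | k
    · simp
    · simp; nlinarith
  · rw [disjoint_left]; intro x; simp [Fin.ext_iff]; omega
  · rw [disjoint_left]; intro x; simp [Fin.ext_iff]; omega

theorem card_fol_dis {a w b v : Fin (m+2)} (g : a ≠ w) (g2 : a ≠ b) (g3 : w ≠ b)
    (g4 : a ≠ v) (g5 : w ≠ v) (g6 : b ≠ v) :
    (univ.filter (fun π : Equiv.Perm (Fin (m+2)) => Fol π a w ∧ Fol π b v)).card
      = m.factorial := by
  have hm : 2 ≤ m := by
    simp only [ne_eq, Fin.ext_iff] at *; omega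
  have hfac : m * (m-1) * (m-2).factorial = m.factorial := by
    obtain ⟨k, rfl⟩ := Nat.exists_eq_add_of_le' hm
    simp [Nat.factorial_succ]; ring
  rw [← hfac, ← card_pairs]
  trans (univ.filter (fun π : Equiv.Perm (Fin (m+2)) => ∃ x : {x : Fin (m+1) × Fin (m+1) //
      x.1 ≠ x.2 ∧ x.1.succ ≠ x.2.castSucc ∧ x.1.castSucc ≠ x.2.succ},
    π x.1.1.castSucc = a ∧ π x.1.1.succ = w ∧ π x.1.2.castSucc = b ∧ π x.1.2.succ = v)).card
  · congr 1; ext π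
    simp only [mem_filter, mem_univ, true_and]; simp only [Fol]
    constructor
    · rintro ⟨⟨t, h4, h5⟩, u, h6, h7⟩
      refine ⟨⟨(t, u), ?_, ?_, ?_⟩, h4, h5, h6, h7⟩
      · rintro h; apply g2; simp only at h; rw [← h4, ← h6, h]
      · rintro h; apply g3; simp only at h; rw [← h5, ← h6, h]
      · rintro h; apply g4; simp only at h; rw [← h4, ← h7, h]
    · rintro ⟨x, h4, h5, h6, h7⟩
      exact ⟨⟨_, h4, h5⟩, _, h6, h7⟩
  · rw [card_ex _ (m-2).factorial]
    · rintro ⟨⟨t, u⟩, k1, k2, k3⟩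
      simp only [ne_eq, Fin.ext_iff, Fin.val_succ, Fin.val_castSucc] at k1 k2 k3
      apply card4 _ _ _ _ _ _ g g2 g3 g4 g5 g6 <;> simp only [ne_eq, Fin.ext_iff, Fin.val_succ, Fin.val_castSucc] <;> omega
    · rintro ⟨⟨t, u⟩, k⟩ ⟨⟨t', u'⟩, k'⟩ π ⟨h1, _, h2, _⟩ ⟨h3, _, h4, _⟩
      have e1 := Fin.castSucc_injective _ (π.injective (h1.trans h3.symm))
      have e2 := Fin.castSucc_injective _ (π.injective (h2.trans h4.symm))
      simp at e1 e2; simp [e1, e2]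

theorem fol_unique {π : Equiv.Perm (Fin (m+2))} {a w w' : Fin (m+2)} (h : Fol π a w)
    (h' : Fol π a w') : w = w' := by
  obtain ⟨t, h1, h2⟩ := h
  obtain ⟨u, h3, h4⟩ := h'
  have := Fin.castSucc_injective _ (π.injective (h1.trans h3.symm))
  rw [← h2, ← h4, this]

theorem fol_not_last {π : Equiv.Perm (Fin (m+2))} {a w : Fin (m+2)} (h : Fol π a w) :
    π (Fin.last (m+1)) ≠ a := by
  obtain ⟨t, h1, h2⟩ := h
  intro h3
  have := π.injective (h1.trans h3.symm)
  simp [Fin.ext_iff] at this; omega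

/-- splitting `AscP` together with an arbitrary side condition -/
theorem card_asc_split (a : Fin (m+2)) (Q : Equiv.Perm (Fin (m+2)) → Prop) :
    (univ.filter (fun π : Equiv.Perm (Fin (m+2)) => AscP π a ∧ Q π)).card =
    (univ.filter (fun π : Equiv.Perm (Fin (m+2)) => π (Fin.last (m+1)) = a ∧ Q π)).card +
    ∑ w ∈ Ioi a, (univ.filter (fun π : Equiv.Perm (Fin (m+2)) => Fol π a w ∧ Q π)).card := by
  rw [← card_biUnion, ← card_union_of_disjoint]
  · congr 1; ext π
    simp only [mem_filter, mem_univ, true_and, mem_union, mem_biUnion, mem_Ioi]; simp only [AscP]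
    constructor
    · rintro ⟨h | ⟨w, h, h'⟩, hq⟩
      · exact Or.inl ⟨h, hq⟩
      · exact Or.inr ⟨w, h, h', hq⟩
    · rintro (⟨h, hq⟩ | ⟨w, h, h', hq⟩)
      · exact ⟨Or.inl h, hq⟩
      · exact ⟨Or.inr ⟨w, h, h'⟩, hq⟩
  · rw [disjoint_left]; intro π h1 h2
    simp only [mem_filter, mem_univ, true_and, mem_biUnion] at h1 h2
    obtain ⟨w, _, h2, _⟩ := h2
    exact fol_not_last h2 h1.1
  · intro w _ w' _ hne
    rw [Function.onFun, disjoint_left]; intro π h1 h2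
    simp only [mem_filter, mem_univ, true_and] at h1 h2
    exact hne (fol_unique h1.1 h2.1)

theorem card_des_split (b : Fin (m+2)) (Q : Equiv.Perm (Fin (m+2)) → Prop) :
    (univ.filter (fun π : Equiv.Perm (Fin (m+2)) => Q π ∧ DesP π b)).card =
    ∑ v ∈ Iio b, (univ.filter (fun π : Equiv.Perm (Fin (m+2)) => Q π ∧ Fol π b v)).card := by
  rw [← card_biUnion]
  · congr 1; ext π
    simp only [mem_filter, mem_univ, true_and, mem_biUnion, mem_Iio]; simp only [DesP]
    constructor
    · rintro ⟨hq, w, h, h'⟩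
      exact ⟨w, h, hq, h'⟩
    · rintro ⟨w, h, hq, h'⟩
      exact ⟨hq, w, h, h'⟩
  · intro w _ w' _ hne
    rw [Function.onFun, disjoint_left]; intro π h1 h2
    simp only [mem_filter, mem_univ, true_and] at h1 h2
    exact hne (fol_unique h1.2 h2.2)

theorem card_asc (a : Fin (m+2)) :
    (univ.filter (fun π : Equiv.Perm (Fin (m+2)) => AscP π a)).card =
    (m+1).factorial + (m + 1 - a) * (m+1).factorial := by
  have := card_asc_split a (fun _ => True)
  simp only [and_true] at this
  rw [this, card1, sum_congr rfl (fun w hw => card_fol (mem_Ioi.1 hw).ne)]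
  simp

theorem fol_swap {π : Equiv.Perm (Fin (m+2))} {a b : Fin (m+2)} (h : Fol π a b)
    (h' : Fol π b a) : False := by
  obtain ⟨t, h1, h2⟩ := h
  obtain ⟨u, h3, h4⟩ := h'
  have e1 := π.injective (h1.trans h4.symm)
  have e2 := π.injective (h2.trans h3.symm)
  simp [Fin.ext_iff] at e1 e2; omega

theorem card_asc_fol_self {a b : Fin (m+2)} (hab : (b : ℕ) = a + 1) :
    (univ.filter (fun π : Equiv.Perm (Fin (m+2)) => AscP π a ∧ Fol π b a)).card =
    (m + 1 - a) * m.factorial := by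
  have hlt : a < b := by rw [Fin.lt_def]; omega
  rw [card_asc_split, card_fol_last hlt.ne']
  have : (Ioi a) = insert b (Ioi b) := by
    ext x; simp only [mem_Ioi, mem_Iio, mem_insert, Fin.lt_def, Fin.ext_iff]; omega
  rw [this, sum_insert (by simp), sum_congr rfl (g := fun _ => m.factorial)]
  · have : (univ.filter (fun π : Equiv.Perm (Fin (m+2)) => Fol π a b ∧ Fol π b a)) = ∅ := by
      ext π; simp; exact fun h h' => fol_swap h h'
    rw [this]
    have : m + 1 - (a : ℕ) = (m + 1 - b) + 1 := by omega
    simp [this]; ring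
  · intro w hw
    have hw := mem_Ioi.1 hw
    rw [← card_fol_fol hlt.ne' hw.ne (hlt.trans hw).ne]
    congr 1; ext π; simp [and_comm]

theorem card_asc_fol {a b v : Fin (m+2)} (hab : (b : ℕ) = a + 1) (hv : v < a) :
    (univ.filter (fun π : Equiv.Perm (Fin (m+2)) => AscP π a ∧ Fol π b v)).card =
    (m + 2 - a) * m.factorial := by
  have hlt : a < b := by rw [Fin.lt_def]; omega
  rw [card_asc_split, card_fol_last' hlt.ne' hv.ne' (hv.trans hlt).ne']
  rw [sum_congr rfl (g := fun _ => m.factorial)]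
  · have : m + 2 - (a : ℕ) = (m + 1 - a) + 1 := by omega
    simp [this]; ring
  · intro w hw
    have hw := mem_Ioi.1 hw
    by_cases hwb : w = b
    · subst hwb
      exact card_fol_fol hlt.ne hv.ne' (hv.trans hlt).ne'
    · exact card_fol_dis hw.ne hlt.ne hwb hv.ne' (hv.trans hw).ne' (hv.trans hlt).ne'

theorem card_asc_des {a b : Fin (m+2)} (hab : (b : ℕ) = a + 1) :
    (univ.filter (fun π : Equiv.Perm (Fin (m+2)) => AscP π a ∧ DesP π b)).card =
    (m + 1 - a) * m.factorial + a * ((m + 2 - a) * m.factorial) := by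
  rw [card_des_split]
  have : (Iio b) = insert a (Iio a) := by
    ext x; simp only [mem_Ioi, mem_Iio, mem_insert, Fin.lt_def, Fin.ext_iff]; omega
  rw [this, sum_insert (by simp), card_asc_fol_self hab,
    sum_congr rfl (fun v hv => card_asc_fol hab (mem_Iio.1 hv))]
  simp

theorem card_signs {p q : Fin (m+2)} (h : p ≠ q) (x y : Bool) :
    (univ.filter (fun s : Fin (m+2) → Bool => s p = x ∧ s q = y)).card = 2 ^ m := by
  have : (univ.filter (fun s : Fin (m+2) → Bool => s p = x ∧ s q = y)) =
      Fintype.piFinset (fun t => if t = p then {x} else if t = q then {y} else univ) := by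
    ext s
    simp only [mem_filter, mem_univ, true_and, Fintype.mem_piFinset]
    constructor
    · rintro ⟨h1, h2⟩ t
      split_ifs with h3 h4
      · simp [h3, h1]
      · simp [h4, h2]
      · simp
    · intro H
      have h1 := H p
      have h2 := H q
      simp [h.symm] at h1 h2
      exact ⟨h1, h2⟩
  rw [this, Fintype.card_piFinset]
  rw [← mul_prod_erase univ _ (mem_univ p),
    ← mul_prod_erase (univ.erase p) _ (mem_erase.2 ⟨h.symm, mem_univ q⟩)]
  rw [prod_congr rfl (g := fun _ => 2)]
  · simp [h.symm, h]
  · intro t ht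
    simp at ht
    simp [ht]

end counts

theorem sval_abs_lt {n : ℕ} (σ : Equiv.Perm (Fin n) × (Fin n → Bool)) (t : Fin n) :
    |sval n σ t| = ((σ.1 t : ℕ) : ℤ) + 1 := by
  unfold sval
  simp only [t.2, dite_true, Fin.eta]
  split_ifs
  · rw [abs_neg, abs_of_nonneg (by omega)]
  · rw [abs_of_nonneg (by omega)]

theorem sDescAt_iff {m : ℕ} (σ : Equiv.Perm (Fin (m+2)) × (Fin (m+2) → Bool)) (t : Fin (m+2)) :
    SDescAt (m+2) σ t ↔ (σ.2 t = true ∨ DesP σ.1 (σ.1 t)) := by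
  have hd : DesP σ.1 (σ.1 t) ↔ ∃ r : Fin (m+1), r.castSucc = t ∧ σ.1 r.succ < σ.1 t := by
    constructor
    · rintro ⟨v, hv, r, h1, h2⟩
      exact ⟨r, σ.1.injective h1, h2 ▸ hv⟩
    · rintro ⟨r, rfl, h⟩
      exact ⟨_, h, r, rfl, rfl⟩
  rw [hd]
  unfold SDescAt
  have hs : sval (m+2) σ t = if σ.2 t then -(((σ.1 t : ℕ) : ℤ) + 1) else ((σ.1 t : ℕ) : ℤ) + 1 := by
    unfold sval; simp
  rcases Fin.eq_castSucc_or_eq_last t with ⟨r, rfl⟩ | rfl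
  · have h2 := sval_abs_lt σ r.succ
    simp only [Fin.val_succ] at h2
    simp only [Fin.val_castSucc] at hs ⊢
    rw [h2, hs]
    have : (∃ r' : Fin (m+1), r'.castSucc = r.castSucc ∧ σ.1 r'.succ < σ.1 r.castSucc) ↔
        σ.1 r.succ < σ.1 r.castSucc := by simp
    rw [this, Fin.lt_def]
    cases σ.2 r.castSucc <;> simp <;> omega
  · have h2 : sval (m+2) σ ((Fin.last (m+1) : Fin (m+2)) + 1 : ℕ) = (m+2 : ℕ) + 1 := by
      unfold sval; simp
    rw [h2, hs, abs_of_nonneg (by omega)]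
    have : ¬ (∃ r' : Fin (m+1), r'.castSucc = Fin.last (m+1) ∧
        σ.1 r'.succ < σ.1 (Fin.last (m+1))) := by
      rintro ⟨r, h, _⟩; simp [Fin.ext_iff] at h; omega
    simp only [this, or_false]
    have := (σ.1 (Fin.last (m+1))).2
    cases σ.2 (Fin.last (m+1)) <;> simp <;> omega

theorem ascP_iff {m : ℕ} (π : Equiv.Perm (Fin (m+2))) (a : Fin (m+2)) :
    AscP π a ↔ ¬ DesP π a := by
  constructor
  · rintro (h | ⟨w, h, h'⟩) ⟨v, hv, hf⟩
    · exact fol_not_last hf h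
    · have := fol_unique h' hf
      subst this; exact absurd h hv.asymm
  · intro h
    obtain ⟨t, rfl⟩ := π.surjective a
    rcases Fin.eq_castSucc_or_eq_last t with ⟨r, rfl⟩ | rfl
    · right
      refine ⟨π r.succ, ?_, r, rfl, rfl⟩
      rcases lt_trichotomy (π r.castSucc) (π r.succ) with h1 | h1 | h1
      · exact h1
      · exact absurd (π.injective h1) (cs_ne r)
      · exact absurd ⟨_, h1, r, rfl, rfl⟩ h
    · left; rfl

theorem ex_iff {m : ℕ} (σ : Equiv.Perm (Fin (m+2)) × (Fin (m+2) → Bool)) (a : Fin (m+2)) (i : ℕ)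
    (ha : (a : ℕ) + 1 = i) (P : ℕ → Prop) :
    (∃ t < m+2, |sval (m+2) σ t| = (i : ℤ) ∧ P t) ↔ P (σ.1.symm a) := by
  constructor
  · rintro ⟨t, ht, h1, h2⟩
    have := sval_abs_lt σ ⟨t, ht⟩
    simp only at this
    rw [this] at h1
    have : σ.1 ⟨t, ht⟩ = a := by apply Fin.ext; omega
    rw [← this]; simpa using h2
  · intro h
    refine ⟨_, (σ.1.symm a).2, ?_, h⟩
    rw [sval_abs_lt]; simp; omega

open scoped Classical in
theorem stmt5 (n i : ℕ) (hn : 2 ≤ n) (hi1 : 1 ≤ i) (hi2 : i ≤ n - 1) :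
    (Finset.univ.filter
      (fun σ : Equiv.Perm (Fin n) × (Fin n → Bool) =>
        IsSignedAscent n σ i ∧ IsSignedDescent n σ (i + 1))).card
    = 2 ^ (n - 2) * ((n - 1).factorial + (n - i) * (n - 1).factorial
        + (i - 1) * (n - 2).factorial + (n - i) * (n - 2).factorial
        + (n - i) * (i - 1) * (n - 2).factorial) := by
  obtain ⟨m, rfl⟩ := Nat.exists_eq_add_of_le' hn
  obtain ⟨k, rfl⟩ := Nat.exists_eq_add_of_le' hi1
  let a : Fin (m+2) := ⟨k, by omega⟩
  let b : Fin (m+2) := ⟨k+1, by omega⟩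
  have hab : (b : ℕ) = a + 1 := rfl
  have hne : b ≠ a := by simp [Fin.ext_iff, hab]
  have key : ∀ σ : Equiv.Perm (Fin (m+2)) × (Fin (m+2) → Bool),
      (IsSignedAscent (m+2) σ (k+1) ∧ IsSignedDescent (m+2) σ (k+1+1)) ↔
      ((σ.2 (σ.1.symm a) = false ∧ σ.2 (σ.1.symm b) = true) ∧ AscP σ.1 a) ∨
      ((σ.2 (σ.1.symm a) = false ∧ σ.2 (σ.1.symm b) = false) ∧ (AscP σ.1 a ∧ DesP σ.1 b)) := by
    intro σ
    unfold IsSignedAscent IsSignedDescent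
    rw [ex_iff σ a _ rfl (fun t => ¬ SDescAt (m+2) σ t), ex_iff σ b _ rfl, sDescAt_iff, sDescAt_iff,
      ascP_iff]
    simp only [Equiv.apply_symm_apply]
    cases σ.2 (σ.1.symm a) <;> cases σ.2 (σ.1.symm b) <;> simp
  let S : Bool → Bool → (Equiv.Perm (Fin (m+2)) → Prop) →
      Finset (Equiv.Perm (Fin (m+2)) × (Fin (m+2) → Bool)) := fun x y Q =>
    univ.filter (fun σ => (σ.2 (σ.1.symm a) = x ∧ σ.2 (σ.1.symm b) = y) ∧ Q σ.1)
  have fib : ∀ (x y : Bool) (Q : Equiv.Perm (Fin (m+2)) → Prop),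
      (S x y Q).card = (univ.filter Q).card * 2 ^ m := by
    intro x y Q
    simp only [S]
    rw [card_filter, Fintype.sum_prod_type, card_filter, sum_mul]
    apply sum_congr rfl
    intro π _
    by_cases hQ : Q π
    · simp only [hQ, and_true, if_true, one_mul]
      rw [← card_filter]
      exact card_signs (fun h => hne (π.symm.injective h).symm) x y
    · simp [hQ]
  have f1 : (univ.filter (fun π => AscP π a)).card = _ := card_asc a
  have f2 : (univ.filter (fun π => AscP π a ∧ DesP π b)).card = _ := card_asc_des hab
  trans (S false true (fun π => AscP π a)).card + (S false false (fun π => AscP π a ∧ DesP π b)).card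
  · rw [← card_union_of_disjoint]
    · congr 1; ext σ
      simp only [S, mem_filter, mem_univ, true_and, mem_union]
      exact key σ
    · rw [disjoint_left]; intro σ h1 h2
      simp only [S, mem_filter, mem_univ, true_and] at h1 h2
      rw [h1.1.2] at h2
      simp at h2
  · have e1 : m + 1 - (a : ℕ) = m + 2 - (k + 1) := by simp only [a]; omega
    have e2 : m + 2 - (a : ℕ) = m + 2 - (k + 1) + 1 := by simp only [a]; omega
    have e3 : (a : ℕ) = k := rfl
    rw [e2, e1, e3] at f2
    rw [e1] at f1
    have g1 := fib false true (fun π => AscP π a)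
    have g2 := fib false false (fun π => AscP π a ∧ DesP π b)
    rw [g1, f1, g2]
    trans ((m + 1).factorial + (m + 2 - (k + 1)) * (m + 1).factorial) * 2 ^ m +
      ((m + 2 - (k + 1)) * m.factorial + k * ((m + 2 - (k + 1) + 1) * m.factorial)) * 2 ^ m
    · congr 2
      convert f2
    · simp only [Nat.add_sub_cancel, show m + 2 - 1 = m + 1 from rfl]
      ring
end

section
/- For n ≥ 2, the sum over all signed permutations σ of length n of the number of indices i with 1 ≤ i ≤ n-1 such that i is a signed ascent and i+1 is a signed descent equals 2^{n-1}·(n-1)!·(4n² + 7n - 12)/12. -/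
open Finset

section aux
open Equiv

/-- Cyclic successor of the value `x` in the cyclic word `g`. -/
def nx {m : ℕ} (g : Perm (Fin (m+3))) (x : Fin (m+3)) : Fin (m+3) := g (g.symm x + 1)

lemma nx_ne {m : ℕ} (g : Perm (Fin (m+3))) (x : Fin (m+3)) : nx g x ≠ x := by
  intro h
  unfold nx at h
  have h2 : g.symm x + 1 = g.symm x := by rw [Equiv.eq_symm_apply]; exact h
  simp at h2

lemma nx_inj {m : ℕ} (g : Perm (Fin (m+3))) {x y : Fin (m+3)} (h : nx g x = nx g y) : x = y := by
  unfold nx at h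
  simpa using h

lemma nx_nx_ne {m : ℕ} (g : Perm (Fin (m+3))) (x : Fin (m+3)) : nx g (nx g x) ≠ x := by
  intro h
  unfold nx at h
  have h2 : g.symm x + 1 + 1 = g.symm x := by rw [Equiv.eq_symm_apply]; simpa using h
  rw [add_assoc, add_eq_left] at h2
  have := congrArg Fin.val h2
  simp [Fin.val_add] at this
  rw [Nat.mod_eq_of_lt (by omega)] at this
  omega

lemma nx_mul {m : ℕ} (h g : Perm (Fin (m+3))) (x : Fin (m+3)) :
    nx (h * g) (h x) = h (nx g x) := by
  simp only [nx, Perm.mul_apply]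
  congr 3
  rw [Equiv.symm_apply_eq]; simp

lemma nx_rot {m : ℕ} (g : Perm (Fin (m+3))) (k x : Fin (m+3)) :
    nx (g * Equiv.addRight k) x = nx g x := by
  have : (g * Equiv.addRight k).symm x = g.symm x - k := by
    rw [Equiv.symm_apply_eq]; simp
  simp only [nx, Perm.mul_apply, this, Equiv.coe_addRight]
  congr 1
  abel

def N1 {m : ℕ} (x a : Fin (m+3)) : ℕ := (univ.filter (fun g : Perm (Fin (m+3)) => nx g x = a)).card
def N2 {m : ℕ} (x y a b : Fin (m+3)) : ℕ :=
  (univ.filter (fun g : Perm (Fin (m+3)) => nx g x = a ∧ nx g y = b)).card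

lemma N1_inv {m : ℕ} (h : Perm (Fin (m+3))) (x a : Fin (m+3)) : N1 (h x) (h a) = N1 x a := by
  unfold N1
  symm
  refine Finset.card_bij' (fun g _ => h * g) (fun g _ => h⁻¹ * g) ?_ ?_ ?_ ?_
  · intro g hg; simp at hg ⊢; rw [nx_mul, hg]
  · intro g hg; simp at hg ⊢
    apply h.injective
    rw [← nx_mul]; simpa using hg
  · intro g _; simp
  · intro g _; simp

lemma N2_inv {m : ℕ} (h : Perm (Fin (m+3))) (x y a b : Fin (m+3)) :
    N2 (h x) (h y) (h a) (h b) = N2 x y a b := by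
  unfold N2
  symm
  refine Finset.card_bij' (fun g _ => h * g) (fun g _ => h⁻¹ * g) ?_ ?_ ?_ ?_
  · intro g hg; simp at hg ⊢; rw [nx_mul, nx_mul, hg.1, hg.2]; simp
  · intro g hg; simp at hg ⊢
    constructor <;> apply h.injective <;> rw [← nx_mul]
    · simpa using hg.1
    · simpa using hg.2
  · intro g _; simp
  · intro g _; simp

lemma N1_sum {m : ℕ} (x : Fin (m+3)) : ∑ a, N1 x a = (m+3).factorial := by
  unfold N1
  rw [← Finset.card_eq_sum_card_fiberwise (f := fun g => nx g x) (t := univ) (by simp)]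
  simp [Fintype.card_perm]

lemma N2_sum {m : ℕ} (x y a : Fin (m+3)) : ∑ b, N2 x y a b = N1 x a := by
  unfold N1 N2
  rw [Finset.card_eq_sum_card_fiberwise (f := fun g => nx g y) (t := univ) (by simp)]
  simp [Finset.filter_filter]

lemma N1_val {m : ℕ} (x a : Fin (m+3)) (h : a ≠ x) : (m+2) * N1 x a = (m+3).factorial := by
  rw [← N1_sum x]
  have h0 : N1 x x = 0 := by
    unfold N1; simp [nx_ne]
  rw [← Finset.add_sum_erase _ _ (mem_univ x), h0, zero_add]
  rw [Finset.sum_congr rfl (g := fun _ => N1 x a)]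
  · simp
  · intro b hb
    have hb : b ≠ x := by simpa using hb
    have := N1_inv (swap a b) x a
    rwa [swap_apply_of_ne_of_ne h.symm hb.symm, swap_apply_left] at this

lemma N2_symm {m : ℕ} (x y a b : Fin (m+3)) : N2 x y a b = N2 y x b a := by
  unfold N2; congr 1; ext g; simp [and_comm]

lemma N2_val1 {m : ℕ} (x y b : Fin (m+3)) (hxy : x ≠ y) (hb : b ≠ x) (hb' : b ≠ y) :
    (m+1) * N2 x y y b = N1 x y := by
  rw [← N2_sum x y y]
  have h0 : N2 x y y x = 0 := by
    unfold N2
    rw [Finset.card_eq_zero, Finset.filter_eq_empty_iff]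
    rintro g - ⟨h1, h2⟩
    exact nx_nx_ne g x (by rw [h1, h2])
  have h1 : N2 x y y y = 0 := by
    unfold N2; simp [nx_ne]
  rw [← Finset.add_sum_erase _ _ (mem_univ x), h0, zero_add,
    ← Finset.add_sum_erase _ _ (show y ∈ univ.erase x by simp [hxy.symm]), h1, zero_add]
  rw [Finset.sum_congr rfl (g := fun _ => N2 x y y b)]
  · rw [Finset.sum_const, Finset.card_erase_of_mem (by simp [hxy.symm]),
      Finset.card_erase_of_mem (by simp)]
    simp
  · intro c hc
    have hc : c ≠ y ∧ c ≠ x := by simpa using hc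
    have := N2_inv (swap b c) x y y b
    rwa [swap_apply_of_ne_of_ne hb.symm hc.2.symm, swap_apply_left,
      swap_apply_of_ne_of_ne hb'.symm hc.1.symm] at this

lemma N2_val {m : ℕ} (x y a b : Fin (m+3)) (hxy : x ≠ y) (ha : a ≠ x) (hb : b ≠ y) (hab : a ≠ b)
    (hc : ¬ (a = y ∧ b = x)) : (m+2) * (m+1) * N2 x y a b = (m+3).factorial := by
  by_cases hay : a = y
  · subst hay
    rw [mul_assoc, N2_val1 x a b hxy (by tauto) hb, N1_val x a ha]
  by_cases hbx : b = x
  · subst hbx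
    rw [mul_assoc, N2_symm, N2_val1 y b a hxy.symm hay ha, N1_val y b hb]
  have hs := N2_sum x y a
  have h0 : N2 x y a y = 0 := by
    unfold N2; simp [nx_ne]
  have h1 : N2 x y a a = 0 := by
    unfold N2
    rw [Finset.card_eq_zero, Finset.filter_eq_empty_iff]
    rintro g - ⟨h1, h2⟩
    exact hxy (nx_inj g (by rw [h1, h2]))
  have h2 : (m+1) * N2 x y a x = N1 y x := by
    rw [N2_symm, N2_val1 y x a hxy.symm hay ha]
  have h3 := N1_val y x hxy
  have h4 := N1_val x a ha
  rw [← Finset.add_sum_erase _ _ (mem_univ x),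
    ← Finset.add_sum_erase _ _ (show y ∈ univ.erase x by simp [hxy.symm]), h0, zero_add,
    ← Finset.add_sum_erase _ _ (show a ∈ (univ.erase x).erase y by simp [ha, hay]), h1, zero_add,
    Finset.sum_congr rfl (g := fun _ => N2 x y a b)] at hs
  · rw [Finset.sum_const, Finset.card_erase_of_mem (by simp [ha, hay]),
      Finset.card_erase_of_mem (by simp [hxy.symm]),
      Finset.card_erase_of_mem (by simp)] at hs
    simp at hs
    have hm : 0 < m := by
      have : ({x, y, a, b} : Finset (Fin (m+3))).card ≤ m + 3 := by
        simpa using Finset.card_le_univ ({x, y, a, b} : Finset (Fin (m+3)))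
      rw [Finset.card_insert_of_notMem, Finset.card_insert_of_notMem,
        Finset.card_insert_of_notMem, Finset.card_singleton] at this
      · omega
      · simpa using hab
      · simp [Ne.symm hay, hb.symm]
      · simp [hxy, ha.symm, Ne.symm hbx]
    have : N1 y x = N1 x a := by
      apply Nat.eq_of_mul_eq_mul_left (show 0 < m + 2 by omega); rw [h3, h4]
    rw [this] at h2
    rw [← h4, mul_assoc]
    congr 1
    apply Nat.eq_of_mul_eq_mul_left hm
    nlinarith
  · intro c hc
    have hc : c ≠ a ∧ c ≠ y ∧ c ≠ x := by simpa using hc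
    have := N2_inv (swap b c) x y a b
    rwa [swap_apply_of_ne_of_ne (Ne.symm hbx) hc.2.2.symm, swap_apply_left,
      swap_apply_of_ne_of_ne hb.symm hc.2.1.symm, swap_apply_of_ne_of_ne hab hc.1.symm] at this

/-- extension of a permutation by a fixed `0`. -/
def ext0 {n : ℕ} (π : Perm (Fin n)) : Perm (Fin (n+1)) := Perm.decomposeFin.symm (0, π)

lemma ext0_zero {n : ℕ} (π : Perm (Fin n)) : ext0 π 0 = 0 := by simp [ext0]
lemma ext0_succ {n : ℕ} (π : Perm (Fin n)) (i : Fin n) : ext0 π i.succ = (π i).succ := by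
  simp [ext0]

lemma rot_count {m : ℕ} (P : Perm (Fin (m+3)) → Prop) [DecidablePred P]
    (hP : ∀ g k, P (g * Equiv.addRight k) ↔ P g) :
    (univ.filter P).card = (m+3) * (univ.filter (fun π : Perm (Fin (m+2)) => P (ext0 π))).card := by
  rw [Finset.card_eq_sum_card_fiberwise (f := fun g => g.symm 0) (t := univ) (by simp)]
  rw [Finset.sum_congr rfl
    (g := fun _ => (univ.filter (fun π : Perm (Fin (m+2)) => P (ext0 π))).card)]
  · simp
  · intro k _
    symm
    refine Finset.card_bij (fun π _ => ext0 π * Equiv.addRight (-k)) ?_ ?_ ?_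
    · intro π hπ
      simp at hπ ⊢
      refine ⟨(hP _ _).2 hπ, ?_⟩
      rw [Equiv.symm_apply_eq]
      simp [ext0_zero]
    · intro π _ π' _ h
      have h := mul_right_cancel h
      have := Perm.decomposeFin.symm.injective h
      simpa using this
    · intro g hg
      simp at hg
      obtain ⟨hg, hk⟩ := hg
      rw [Equiv.symm_apply_eq] at hk
      have key : ext0 (Perm.decomposeFin (g * Equiv.addRight k)).2 = g * Equiv.addRight k := by
        unfold ext0
        rw [Equiv.symm_apply_eq]
        ext1
        · have : (Perm.decomposeFin (g * Equiv.addRight k)).1 = (g * Equiv.addRight k) 0 := by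
            conv_rhs => rw [← Perm.decomposeFin.symm_apply_apply (g * Equiv.addRight k)]
            rw [← Prod.mk.eta (p := Perm.decomposeFin (g * Equiv.addRight k)),
              Perm.decomposeFin_symm_apply_zero]
          rw [this]
          simp [hk]
        · rfl
      refine ⟨(Perm.decomposeFin (g * Equiv.addRight k)).2, ?_, ?_⟩
      · simp only [mem_filter, mem_univ, true_and]
        rw [key, hP]; exact hg
      · rw [key]; ext; simp

def PA {m : ℕ} (g : Perm (Fin (m+3))) (x : Fin (m+3)) : Prop := nx g x = 0 ∨ x < nx g x
def PD {m : ℕ} (g : Perm (Fin (m+3))) (x : Fin (m+3)) : Prop := nx g x ≠ 0 ∧ nx g x < x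

instance {m : ℕ} (g : Perm (Fin (m+3))) (x : Fin (m+3)) : Decidable (PA g x) := by
  unfold PA; infer_instance
instance {m : ℕ} (g : Perm (Fin (m+3))) (x : Fin (m+3)) : Decidable (PD g x) := by
  unfold PD; infer_instance

lemma card_PA {m : ℕ} (i : Fin (m+2)) :
    (m+2) * (univ.filter (fun g : Perm (Fin (m+3)) => PA g i.succ)).card
      = (m+2-i) * (m+3).factorial := by
  rw [Finset.card_eq_sum_card_fiberwise (f := fun g => nx g i.succ)
    (t := insert 0 (Finset.Ioi i.succ)) (by intro g hg; simp only [coe_filter, mem_univ, true_and, Set.mem_ofPred_eq] at hg; simpa [PA] using hg)]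
  rw [Finset.mul_sum, Finset.sum_congr rfl (g := fun _ => (m+3).factorial)]
  · rw [Finset.sum_const, Finset.card_insert_of_notMem (by simp)]
    simp
    left; omega
  · intro a ha
    rw [← N1_val i.succ a]
    · unfold N1
      congr 2
      ext g
      simp only [mem_filter, mem_univ, true_and, and_iff_right_iff_imp]
      rintro rfl; simpa [PA] using ha
    · rintro rfl
      simp at ha

lemma card_PAD {m : ℕ} (i : Fin (m+1)) :
    (m+2) * (m+1) * (univ.filter (fun g : Perm (Fin (m+3)) =>
        PA g i.castSucc.succ ∧ PD g i.succ.succ)).card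
      = ((m+2-i) * (i+1) - 1) * (m+3).factorial := by
  have hxy : i.castSucc.succ ≠ i.succ.succ := by simp [Fin.ext_iff]
  rw [Finset.card_eq_sum_card_fiberwise (f := fun g => (nx g i.castSucc.succ, nx g i.succ.succ))
    (t := ((insert 0 (Finset.Ioi i.castSucc.succ)) ×ˢ (Finset.Ioo 0 i.succ.succ)).erase
      (i.succ.succ, i.castSucc.succ)) ?_]
  · rw [Finset.mul_sum, Finset.sum_congr rfl (g := fun _ => (m+3).factorial)]
    · rw [Finset.sum_const, Finset.card_erase_of_mem, Finset.card_product,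
        Finset.card_insert_of_notMem (by simp)]
      · simp
        left
        congr 2
        omega
      · simp only [mem_product, mem_insert, mem_Ioi, mem_Ioo, Fin.lt_def, Fin.ext_iff,
          Fin.val_succ, Fin.val_castSucc, Fin.val_zero]
        omega
    · rintro ⟨a, b⟩ hab
      simp at hab
      rw [← N2_val i.castSucc.succ i.succ.succ a b hxy]
      · unfold N2
        congr 2
        ext g
        simp only [mem_filter, mem_univ, true_and, Prod.mk.injEq, and_iff_right_iff_imp]
        rintro ⟨rfl, rfl⟩
        unfold PA PD
        refine ⟨hab.2.1, Fin.pos_iff_ne_zero.1 hab.2.2.1, hab.2.2.2⟩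
      all_goals simp only [Fin.lt_def, Fin.ext_iff, ne_eq,
          Fin.val_succ, Fin.val_castSucc, Fin.val_zero] at hab ⊢
      all_goals omega
  · intro g hg
    simp only [coe_filter, mem_univ, true_and, Set.mem_ofPred_eq] at hg
    unfold PA PD at hg
    simp
    refine ⟨⟨hg.1, Fin.pos_iff_ne_zero.2 hg.2.1, hg.2.2⟩, ?_⟩
    intro h1 h2
    exact nx_nx_ne g i.castSucc.succ (by rw [h1, h2])

lemma abs_sval {n : ℕ} (σ : Perm (Fin n) × (Fin n → Bool)) (t : Fin n) :
    |sval n σ t| = (σ.1 t : ℤ) + 1 := by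
  unfold sval
  rw [dif_pos t.2]
  split_ifs
  · rw [abs_neg, abs_of_nonneg (by positivity)]
  · rw [abs_of_nonneg (by positivity)]

lemma sdesc_iff {m : ℕ} (σ : Perm (Fin (m+2)) × (Fin (m+2) → Bool)) (t : Fin (m+2)) :
    SDescAt (m+2) σ t ↔ σ.2 t = true ∨ PD (ext0 σ.1) (σ.1 t).succ := by
  have hsym : (ext0 σ.1).symm (σ.1 t).succ = t.succ := by
    rw [Equiv.symm_apply_eq, ext0_succ]
  unfold SDescAt PD nx
  rw [hsym]
  by_cases hs : σ.2 t = true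
  · simp only [hs, true_or, iff_true]
    left
    simp [sval, hs]
    omega
  · simp only [hs, false_or, Bool.false_eq_true]
    have h1 : sval (m+2) σ t = (σ.1 t : ℤ) + 1 := by
      simp [sval, hs]
    rw [h1]
    by_cases ht : (t : ℕ) + 1 < m + 2
    · have h2 := abs_sval σ ⟨t+1, ht⟩
      simp only at h2
      rw [h2]
      have : t.succ + 1 = (⟨t+1, ht⟩ : Fin (m+2)).succ := by
        ext; simp [Fin.val_add]; omega
      rw [this, ext0_succ]
      simp [-Fin.val_fin_lt, Fin.lt_def, Fin.succ_ne_zero]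
      omega
    · have h2 : t.succ + 1 = 0 := by
        ext; simp [Fin.val_add]
        have : (t : ℕ) = m + 1 := by omega
        simp [this]
      rw [h2, ext0_zero]
      have h3 : sval (m+2) σ (t+1) = m + 3 := by
        simp [sval, ht]; ring
      rw [h3, abs_of_nonneg (by positivity)]
      have := (σ.1 t).2
      simp
      omega

lemma PA_iff {m : ℕ} (g : Perm (Fin (m+3))) (x : Fin (m+3)) : PA g x ↔ ¬ PD g x := by
  have := nx_ne g x
  unfold PA PD
  grind

lemma asc_iff {m : ℕ} (σ : Perm (Fin (m+2)) × (Fin (m+2) → Bool)) (i : Fin (m+2)) :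
    IsSignedAscent (m+2) σ (i+1) ↔ σ.2 (σ.1.symm i) = false ∧ PA (ext0 σ.1) i.succ := by
  unfold IsSignedAscent
  constructor
  · rintro ⟨t, ht, h1, h2⟩
    have h3 := abs_sval σ ⟨t, ht⟩
    simp only at h3
    have h4 : σ.1 ⟨t, ht⟩ = i := by
      ext; rw [h3] at h1; push_cast at h1; omega
    have h5 := sdesc_iff σ ⟨t, ht⟩
    simp only at h5
    rw [h5, h4] at h2
    rw [PA_iff, ← h4, Equiv.symm_apply_apply, h4]
    simpa using h2
  · rintro ⟨h1, h2⟩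
    refine ⟨σ.1.symm i, (σ.1.symm i).2, ?_, ?_⟩
    · rw [abs_sval]; simp
    · rw [sdesc_iff, h1, Equiv.apply_symm_apply, ]
      rw [PA_iff] at h2
      simp [h2]

lemma desc_iff {m : ℕ} (σ : Perm (Fin (m+2)) × (Fin (m+2) → Bool)) (i : Fin (m+2)) :
    IsSignedDescent (m+2) σ (i+1) ↔ σ.2 (σ.1.symm i) = true ∨ PD (ext0 σ.1) i.succ := by
  unfold IsSignedDescent
  constructor
  · rintro ⟨t, ht, h1, h2⟩
    have h3 := abs_sval σ ⟨t, ht⟩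
    simp only at h3
    have h4 : σ.1 ⟨t, ht⟩ = i := by
      ext; rw [h3] at h1; push_cast at h1; omega
    have h5 := sdesc_iff σ ⟨t, ht⟩
    simp only at h5
    rw [h5, h4] at h2
    rw [← h4, Equiv.symm_apply_apply, h4]
    exact h2
  · intro h
    refine ⟨σ.1.symm i, (σ.1.symm i).2, ?_, ?_⟩
    · rw [abs_sval]; simp
    · rw [sdesc_iff, Equiv.apply_symm_apply]; exact h

lemma sign_count1 {m : ℕ} (p q : Fin (m+2)) (hpq : p ≠ q) (c : Bool) :
    (univ.filter (fun e : Fin (m+2) → Bool => e p = false ∧ e q = c)).card = 2 ^ m := by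
  have : univ.filter (fun e : Fin (m+2) → Bool => e p = false ∧ e q = c)
      = Fintype.piFinset (fun j => if j = p then {false} else if j = q then {c} else univ) := by
    ext e
    simp only [mem_filter, mem_univ, true_and, Fintype.mem_piFinset]
    constructor
    · rintro ⟨h1, h2⟩ j
      split_ifs with h h'
      · simp [h, h1]
      · simp [h', h2]
      · simp
    · intro h
      have h1 := h p
      have h2 := h q
      simp [hpq.symm] at h1 h2
      exact ⟨h1, h2⟩
  rw [this, Fintype.card_piFinset, ← Finset.mul_prod_erase _ _ (mem_univ p),
    ← Finset.mul_prod_erase _ _ (show q ∈ univ.erase p by simp [hpq.symm]),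
    Finset.prod_congr rfl (g := fun _ => 2)]
  · rw [Finset.prod_const, Finset.card_erase_of_mem (by simp [hpq.symm]),
      Finset.card_erase_of_mem (by simp)]
    simp [hpq.symm]
  · intro j hj
    simp at hj
    simp [hj]

lemma sign_count {m : ℕ} (p q : Fin (m+2)) (hpq : p ≠ q) (A D : Prop) [Decidable A] [Decidable D] :
    (univ.filter (fun e : Fin (m+2) → Bool => (e p = false ∧ A) ∧ (e q = true ∨ D))).card
      = 2 ^ m * ((if A then 1 else 0) + (if A ∧ D then 1 else 0)) := by
  by_cases hA : A
  · by_cases hD : D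
    · simp only [hA, hD, and_true, or_true, if_true]
      have h1 := sign_count1 p q hpq true
      have h2 := sign_count1 p q hpq false
      rw [← Finset.card_filter_add_card_filter_not (fun e => e q = true), Finset.filter_filter,
        Finset.filter_filter, h1]
      simp only [Bool.not_eq_true]
      rw [h2]; ring
    · simp only [hA, hD, and_true, or_false, if_true, if_false, and_false]
      rw [sign_count1 p q hpq true]; simp
  · simp [hA]

open scoped Classical in
lemma per_i {m : ℕ} (i : Fin (m+1)) :
    (univ.filter (fun σ : Perm (Fin (m+2)) × (Fin (m+2) → Bool) =>
      IsSignedAscent (m+2) σ (i+1) ∧ IsSignedDescent (m+2) σ (i+1+1))).card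
    = 2 ^ m * ((m+2-i) * (m+1).factorial + ((m+2-i)*(i+1) - 1) * m.factorial) := by
  have e1 : ∀ σ : Perm (Fin (m+2)) × (Fin (m+2) → Bool),
      (IsSignedAscent (m+2) σ (i+1) ∧ IsSignedDescent (m+2) σ (i+1+1)) ↔
      ((σ.2 (σ.1.symm i.castSucc) = false ∧ PA (ext0 σ.1) i.castSucc.succ) ∧
        (σ.2 (σ.1.symm i.succ) = true ∨ PD (ext0 σ.1) i.succ.succ)) := by
    intro σ
    rw [← asc_iff, ← desc_iff]
    simp
  simp only [e1]
  rw [Finset.card_filter, Fintype.sum_prod_type]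
  simp only [← Finset.card_filter]
  have hA : (univ.filter (fun π : Perm (Fin (m+2)) => PA (ext0 π) i.castSucc.succ)).card
      = (m+2-i) * (m+1).factorial := by
    have h1 := rot_count (fun g : Perm (Fin (m+3)) => PA g i.castSucc.succ)
      (by intro g k; simp only [PA, nx_rot])
    have h2 := card_PA i.castSucc
    rw [h1] at h2
    apply Nat.eq_of_mul_eq_mul_left (show 0 < (m+2)*(m+3) by positivity)
    rw [mul_assoc, h2, Nat.factorial_succ (m+2), Nat.factorial_succ (m+1), Fin.val_castSucc]
    ring
  have hB : (univ.filter (fun π : Perm (Fin (m+2)) =>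
        PA (ext0 π) i.castSucc.succ ∧ PD (ext0 π) i.succ.succ)).card
      = ((m+2-i)*(i+1) - 1) * m.factorial := by
    have h1 := rot_count (fun g : Perm (Fin (m+3)) => PA g i.castSucc.succ ∧ PD g i.succ.succ)
      (by intro g k; simp only [PA, PD, nx_rot])
    have h2 := card_PAD i
    rw [h1] at h2
    apply Nat.eq_of_mul_eq_mul_left (show 0 < (m+2)*(m+1)*(m+3) by positivity)
    rw [mul_assoc, h2, Nat.factorial_succ (m+2), Nat.factorial_succ (m+1), Nat.factorial_succ m]
    ring
  rw [← hA, ← hB, Finset.card_filter, Finset.card_filter, ← Finset.sum_add_distrib, Finset.mul_sum]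
  refine Finset.sum_congr rfl fun π _ => ?_
  rw [← sign_count (π.symm i.castSucc) (π.symm i.succ)]
  simp [Fin.ext_iff]

lemma final_sum (m k : ℕ) (hk : k ≤ m + 1) :
    (6 * ∑ i ∈ Finset.range k, ((m+2-i) * (m+1) + ((m+2-i)*(i+1) - 1) : ℕ) : ℤ)
      = k * (6*(m+2)*(m+2) - 6 - (k - 1) * (2*k-1)) := by
  induction k with
  | zero => simp
  | succ k ih =>
    rw [Finset.sum_range_succ, Nat.cast_add, mul_add, ih (by omega)]
    obtain ⟨j, rfl⟩ : ∃ j, m = k + j := ⟨m - k, by omega⟩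
    have : k + j + 2 - k = j + 2 := by omega
    rw [this]
    have h2 : 1 ≤ (j+2)*(k+1) := by nlinarith
    push_cast [Nat.cast_sub h2]
    ring

end aux

open scoped Classical in
theorem stmt6 (n : ℕ) (hn : 2 ≤ n) :
    12 * ∑ σ : Equiv.Perm (Fin n) × (Fin n → Bool),
        ((Finset.Icc 1 (n - 1)).filter
          (fun i => IsSignedAscent n σ i ∧ IsSignedDescent n σ (i + 1))).card
    = 2 ^ (n - 1) * (n - 1).factorial * (4 * n ^ 2 + 7 * n - 12) := by
  obtain ⟨m, rfl⟩ : ∃ m, n = m + 2 := ⟨n - 2, by omega⟩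
  have hsum : ∑ σ : Equiv.Perm (Fin (m+2)) × (Fin (m+2) → Bool),
        ((Finset.Icc 1 (m + 2 - 1)).filter
          (fun i => IsSignedAscent (m+2) σ i ∧ IsSignedDescent (m+2) σ (i + 1))).card
      = 2 ^ m * m.factorial *
        ∑ i ∈ Finset.range (m+1), ((m+2-i) * (m+1) + ((m+2-i)*(i+1) - 1)) := by
    simp only [Finset.card_filter]
    rw [Finset.sum_comm]
    have : Finset.Icc 1 (m + 2 - 1) = (Finset.range (m+1)).image (· + 1) := by
      ext j; simp
      constructor
      · intro h; exact ⟨j - 1, by omega, by omega⟩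
      · rintro ⟨a, h, rfl⟩; omega
    rw [this, Finset.sum_image (by simp), Finset.mul_sum]
    refine Finset.sum_congr rfl fun i hi => ?_
    have := per_i (m := m) ⟨i, by simpa using hi⟩
    rw [← Finset.card_filter]
    simp only at this
    rw [this, Nat.factorial_succ]
    ring
  rw [hsum]
  have h := final_sum m (m+1) le_rfl
  have h12 : 4 * (m+2)^2 + 7 * (m+2) - 12 = 4*m^2 + 23*m + 18 := by
    have : 4 * (m+2)^2 + 7 * (m+2) = 4*m^2 + 23*m + 18 + 12 := by ring
    omega
  rw [h12]
  have h2 : 6 * ∑ i ∈ Finset.range (m+1), ((m+2-i) * (m+1) + ((m+2-i)*(i+1) - 1))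
      = (m+1) * (4*m^2 + 23*m + 18) := by
    zify
    push_cast at h
    push_cast
    rw [h]
    ring
  have h3 : m + 2 - 1 = m + 1 := rfl
  rw [h3, Nat.factorial_succ, pow_succ]
  linear_combination (2 * 2^m * m.factorial) * h2
end
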